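/- arXiv:1910.13853 — 2 statements merged into one kernel-verified Lean document; each statement's English description precedes it below -/
import Mathlib

section
/- Let N be a level-2 phylogenetic network on X with at least two blobs in which every leaf is contained in a blob, let k, l, m, n ≥ 1, and let B be a pendant level-2 blob of N of one of the forms (k, 0, m, 0), (k, l, m, 0), (k, 0, m, n), or (k, l, m, n), with chains a, b, c, d of lengths k, l, m, n and with c = (c_1, ..., c_m) a chain on the same side of B as the non-trivial cut-edge, c_m being the chain leaf closest to the non-trivial cut-edge. Then for every leaf x of X not in a ∪ b ∪ c ∪ d, the multiset d^{N}(x, c_m) can be uniquely partitioned into three equal-sized multisets A, B', C such that: A − 2 = B' − (m+3) = C − (k+m+3) if B has form (k,0,m,0); A − 2 = B' − (l+m+3) = C − (k+m+3) if B has form (k,l,m,0); A − 2 = B' − (m+n+3) = C − (k+m+n+3) if B has form (k,0,m,n); and A − 2 = B' − (l+m+n+3) = C − (k+m+n+3) if B has form (k,l,m,n). Moreover, replacing the pendant blob by a single new leaf z yields a network N' on X' = (X \ (a ∪ b ∪ c ∪ d)) ∪ {z} whose multisets of distances satisfy d^{N'}(x,y) = d^{N}(x,y) for all x, y ∈ X'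 \ {z} and d^{N'}(x,z) = A − 2 for all x ∈ X' \ {z}. -/
open SimpleGraph

/-- A labelled graph: the raw data of a phylogenetic network on a label set `X`:
a finite vertex type, a simple graph on it, and a labelling map from `X` to vertices. -/
structure LabGraph (X : Type) where
  V : Type
  [fV : Fintype V]
  G : SimpleGraph V
  leaf : X → V

attribute [instance] LabGraph.fV

namespace LabGraph

variable {X : Type} [Fintype X] [DecidableEq X]

/-- The shortest distance `d_m(x,y)` between the leaves labelled `x` and `y`. -/
noncomputable def dm (N : LabGraph X) (x y : X) : ℕ :=
  N.G.dist (N.leaf x) (N.leaf y)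

/-- The multiset `d(x,y)` of the lengths of all paths between the leaves `x` and `y`. -/
noncomputable def dms (N : LabGraph X) (x y : X) : Multiset ℕ := by
  classical
  exact (Finset.univ : Finset (N.G.Path (N.leaf x) (N.leaf y))).val.map fun p => p.1.length

/-- The degree of a vertex. -/
noncomputable def degOf (N : LabGraph X) (v : N.V) : ℕ := (N.G.neighborSet v).ncard

/-- `N` is an (unweighted unrooted binary) phylogenetic network on `X`:
it is connected, the labelling is injective, and either it is the singleton graph
(when `|X| = 1`), or every leaf-labelled vertex has degree 1 and every other
vertex has degree 3 (so the degree-1 vertices are exactly the labelled leaves). -/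
def IsNetwork (N : LabGraph X) : Prop :=
  N.G.Connected ∧ Function.Injective N.leaf ∧
    ((Fintype.card X = 1 ∧ Fintype.card N.V = 1) ∨
      ((∀ x : X, N.degOf (N.leaf x) = 1) ∧
        ∀ v : N.V, v ∉ Set.range N.leaf → N.degOf v = 3))

/-- Two labelled graphs on `X` are isomorphic by a graph isomorphism fixing the leaf labels. -/
def IsomLabelled (N M : LabGraph X) : Prop :=
  ∃ φ : N.G ≃g M.G, ∀ x : X, φ (N.leaf x) = M.leaf x

/-- A subgraph is 2-connected (with at least three vertices): it is connected and
remains connected after deleting any one of its vertices. -/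
def TwoConnSub (N : LabGraph X) (H : N.G.Subgraph) : Prop :=
  3 ≤ H.verts.ncard ∧ H.coe.Connected ∧
    ∀ v ∈ H.verts, (H.deleteVerts {v}).coe.Connected

/-- A blob: a maximal 2-connected subgraph with at least three vertices. -/
def IsBlob (N : LabGraph X) (H : N.G.Subgraph) : Prop :=
  N.TwoConnSub H ∧ ∀ H' : N.G.Subgraph, N.TwoConnSub H' → H ≤ H' → H' = H

/-- Exactly `r` edges must be deleted from the (connected) subgraph `H` to obtain a
tree: `|E(H)| - |V(H)| + 1 = r`.  A level-1 blob has rank 1, a level-2 blob rank 2. -/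
def BlobRank (N : LabGraph X) (H : N.G.Subgraph) (r : ℕ) : Prop :=
  H.edgeSet.ncard + 1 = H.verts.ncard + r

/-- A network is level-`k` if at most `k` edges must be deleted from every blob
to obtain a tree. -/
def IsLevel (N : LabGraph X) (k : ℕ) : Prop :=
  ∀ H : N.G.Subgraph, N.IsBlob H → H.edgeSet.ncard + 1 ≤ H.verts.ncard + k

/-- A cut-edge: an edge whose deletion disconnects the graph. -/
def IsCutEdge (N : LabGraph X) (e : Sym2 N.V) : Prop :=
  e ∈ N.G.edgeSet ∧ ¬ (N.G.deleteEdges {e}).Connected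

/-- A trivial (cut-)edge: one incident to a leaf. -/
def TrivialEdge (N : LabGraph X) (e : Sym2 N.V) : Prop :=
  ∃ x : X, N.leaf x ∈ e

/-- An edge is incident to a blob if one of its endpoints is a vertex of the blob. -/
def EdgeIncBlob (N : LabGraph X) (e : Sym2 N.V) (H : N.G.Subgraph) : Prop :=
  ∃ v ∈ H.verts, v ∈ e

/-- A pendant blob: a blob with exactly one incident non-trivial cut-edge. -/
def IsPendantBlob (N : LabGraph X) (H : N.G.Subgraph) : Prop :=
  N.IsBlob H ∧
    ∃! e : Sym2 N.V, N.IsCutEdge e ∧ ¬ N.TrivialEdge e ∧ N.EdgeIncBlob e H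

/-- A leaf is contained in a blob if its neighbour is a vertex of the blob. -/
def LeafInBlob (N : LabGraph X) (x : X) (H : N.G.Subgraph) : Prop :=
  ∃ v : N.V, N.G.Adj (N.leaf x) v ∧ v ∈ H.verts

/-- `N` has at least two blobs. -/
def TwoBlobs (N : LabGraph X) : Prop :=
  ∃ H₁ H₂ : N.G.Subgraph, N.IsBlob H₁ ∧ N.IsBlob H₂ ∧ H₁ ≠ H₂

/-- Every leaf of `N` is contained in a blob. -/
def AllLeavesInBlobs (N : LabGraph X) : Prop :=
  ∀ x : X, ∃ H : N.G.Subgraph, N.IsBlob H ∧ N.LeafInBlob x H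

/-- A chain: a `k`-tuple of leaves with consecutive shortest distances equal to 3. -/
def IsChainT (N : LabGraph X) (k : ℕ) (a : Fin k → X) : Prop :=
  ∀ (i : ℕ) (h : i + 1 < k),
    N.dm (a ⟨i, Nat.lt_of_succ_lt h⟩) (a ⟨i + 1, h⟩) = 3

/-- A maximal chain: a chain whose leaf set is not properly contained in the leaf
set of another chain. -/
def IsMaxChainT (N : LabGraph X) (k : ℕ) (a : Fin k → X) : Prop :=
  N.IsChainT k a ∧ ∀ (l : ℕ) (b : Fin l → X), N.IsChainT l b →
    Set.range a ⊆ Set.range b → Set.range a = Set.range b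

/-- The chain `a` is contained in the blob `H`: the edges between the neighbours of
consecutive chain leaves are edges of `H`. -/
def ChainInBlob (N : LabGraph X) (k : ℕ) (a : Fin k → X) (H : N.G.Subgraph) : Prop :=
  ∀ (i : ℕ) (h : i + 1 < k) (p q : N.V),
    N.G.Adj (N.leaf (a ⟨i, Nat.lt_of_succ_lt h⟩)) p →
    N.G.Adj (N.leaf (a ⟨i + 1, h⟩)) q → H.Adj p q

/-- The multiset of natural numbers `A`, viewed in `ℤ`. -/
def toZ (A : Multiset ℕ) : Multiset ℤ := A.map (fun t => (t : ℤ))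

/-- `A - n`: subtract `n` from every element of the multiset `A` (in `ℤ`). -/
def zsub (A : Multiset ℕ) (n : ℤ) : Multiset ℤ := A.map (fun t => (t : ℤ) - n)

/-- The branch vertices of a blob `H`: its vertices of degree at least 3 in `H`. -/
def branchVerts (N : LabGraph X) (H : N.G.Subgraph) : Set N.V :=
  {w | w ∈ H.verts ∧ 3 ≤ (H.neighborSet w).ncard}

/-- `p` and `q` lie on a common side of the blob `H`: they are non-branch vertices of `H`
that are connected in `H` after deleting all branch vertices. -/
def SameSide (N : LabGraph X) (H : N.G.Subgraph) (p q : N.V) : Prop :=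
  ∃ (hp : p ∈ (H.deleteVerts (N.branchVerts H)).verts)
    (hq : q ∈ (H.deleteVerts (N.branchVerts H)).verts),
    (H.deleteVerts (N.branchVerts H)).coe.Reachable ⟨p, hp⟩ ⟨q, hq⟩

/-- `p` and `q` are separated by the vertex `u` within the sides of the blob `H`:
they are not connected in `H` after deleting all branch vertices and `u`. -/
def SepBy (N : LabGraph X) (H : N.G.Subgraph) (u p q : N.V) : Prop :=
  ¬ ∃ (hp : p ∈ (H.deleteVerts (N.branchVerts H ∪ {u})).verts)
      (hq : q ∈ (H.deleteVerts (N.branchVerts H ∪ {u})).verts),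
      (H.deleteVerts (N.branchVerts H ∪ {u})).coe.Reachable ⟨p, hp⟩ ⟨q, hq⟩

/-- The pendant level-2 blob `H` is of the form `(k, l, m, n)`, witnessed by the chains
`a, b, c, d` and the non-trivial cut-edge `s(u, w)` with `u ∈ H`: the chains `c` and `d`
lie on the same side of `H` as the cut-edge (separated by its endpoint `u`), the chains
`a` and `b` lie on two further (distinct) sides, and `a, b, c, d` are precisely the
(maximal) chains contained in `H`. A length-0 chain denotes a side without leaves. -/
def IsFormBlob (N : LabGraph X) (H : N.G.Subgraph) (u w : N.V) (k l m n : ℕ)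
    (a : Fin k → X) (b : Fin l → X) (c : Fin m → X) (d : Fin n → X) : Prop :=
  N.IsPendantBlob H ∧ N.BlobRank H 2 ∧
  N.IsCutEdge s(u, w) ∧ ¬ N.TrivialEdge s(u, w) ∧ u ∈ H.verts ∧ w ∉ H.verts ∧
  (0 < k → N.IsMaxChainT k a) ∧ (0 < l → N.IsMaxChainT l b) ∧
  (0 < m → N.IsMaxChainT m c) ∧ (0 < n → N.IsMaxChainT n d) ∧
  Function.Injective a ∧ Function.Injective b ∧
  Function.Injective c ∧ Function.Injective d ∧
  (Set.range a ∩ Set.range b = ∅) ∧ (Set.range a ∩ Set.range c = ∅) ∧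
  (Set.range a ∩ Set.range d = ∅) ∧ (Set.range b ∩ Set.range c = ∅) ∧
  (Set.range b ∩ Set.range d = ∅) ∧ (Set.range c ∩ Set.range d = ∅) ∧
  (∀ x : X, N.LeafInBlob x H ↔
    (x ∈ Set.range a ∨ x ∈ Set.range b ∨ x ∈ Set.range c ∨ x ∈ Set.range d)) ∧
  N.ChainInBlob k a H ∧ N.ChainInBlob l b H ∧ N.ChainInBlob m c H ∧ N.ChainInBlob n d H ∧
  (∀ (i : Fin k) (j : Fin l) (p q : N.V),
    N.G.Adj (N.leaf (a i)) p → N.G.Adj (N.leaf (b j)) q → ¬ N.SameSide H p q) ∧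
  (∀ (i : Fin k) (p : N.V), N.G.Adj (N.leaf (a i)) p → ¬ N.SameSide H p u) ∧
  (∀ (j : Fin l) (q : N.V), N.G.Adj (N.leaf (b j)) q → ¬ N.SameSide H q u) ∧
  (∀ (i : Fin m) (p : N.V), N.G.Adj (N.leaf (c i)) p → N.SameSide H p u) ∧
  (∀ (j : Fin n) (q : N.V), N.G.Adj (N.leaf (d j)) q → N.SameSide H q u) ∧
  (∀ (i : Fin m) (j : Fin n) (p q : N.V),
    N.G.Adj (N.leaf (c i)) p → N.G.Adj (N.leaf (d j)) q → N.SepBy H u p q)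

/-- Replace a part `S` of the network (e.g. a pendant blob together with its pendant
leaves, labelled by `A`) by a single new leaf (the `Unit` summand) attached to `w`. -/
noncomputable def blobReplace (N : LabGraph X) (A : Set X) (S : Set N.V) (w : N.V)
    (hmem : ∀ x : X, x ∉ A → N.leaf x ∉ S) (hw : w ∉ S) :
    LabGraph ({x : X // x ∉ A} ⊕ Unit) where
  V := {v : N.V // v ∉ S} ⊕ Unit
  fV := by classical exact inferInstance
  G := SimpleGraph.fromRel (fun w₁ w₂ =>
    (∃ v₁ v₂ : {v : N.V // v ∉ S}, w₁ = Sum.inl v₁ ∧ w₂ = Sum.inl v₂ ∧ N.G.Adj v₁.1 v₂.1) ∨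
    (w₁ = Sum.inl ⟨w, hw⟩ ∧ w₂ = Sum.inr ()))
  leaf := Sum.elim (fun x => Sum.inl ⟨N.leaf x.1, hmem x.1 x.2⟩) (fun _ => Sum.inr ())

/-- The last chain leaf `c_m` of the chain `c` (on the cut-edge side of the blob `H`)
is the chain leaf closest to the non-trivial cut-edge endpoint `u`: its neighbour is
connected to `u` within `H` avoiding all branch vertices and the neighbours of the
other chain leaves `c_1, ..., c_{m-1}`. -/
def ClosestToCut (N : LabGraph X) (H : N.G.Subgraph) (u : N.V)
    (m : ℕ) (c : Fin m → X) : Prop :=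
  ∀ (hm : 0 < m) (p : N.V), N.G.Adj (N.leaf (c ⟨m - 1, by omega⟩)) p →
    ∃ (hp : p ∈ (H.deleteVerts (N.branchVerts H ∪
        {q | ∃ i : Fin m, (i : ℕ) + 1 < m ∧ N.G.Adj (N.leaf (c i)) q})).verts)
      (hu : u ∈ (H.deleteVerts (N.branchVerts H ∪
        {q | ∃ i : Fin m, (i : ℕ) + 1 < m ∧ N.G.Adj (N.leaf (c i)) q})).verts),
      (H.deleteVerts (N.branchVerts H ∪
        {q | ∃ i : Fin m, (i : ℕ) + 1 < m ∧ N.G.Adj (N.leaf (c i)) q})).coe.Reachable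
        ⟨p, hp⟩ ⟨u, hu⟩

end LabGraph

namespace LabGraph

theorem last_lt {r : ℕ} (h : 1 ≤ r) : r - 1 < r := by omega
open SimpleGraph

theorem finite_path {V : Type} [Finite V] (G : SimpleGraph V) (v y : V) :
    Finite (G.Path v y) := by
  classical
  have := Fintype.ofFinite V
  infer_instance

/-- Paths from `v` to `y` avoiding `T`. -/
noncomputable def pf {V : Type} [Finite V] (G : SimpleGraph V) (T : Set V) (v y : V) :
    Finset (G.Path v y) :=
  haveI := finite_path G v y
  (Set.toFinite {p : G.Path v y | ∀ z ∈ p.1.support, z ∉ T}).toFinset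

theorem mem_pf {V : Type} [Finite V] (G : SimpleGraph V) (T : Set V) (v y : V)
    (p : G.Path v y) : p ∈ pf G T v y ↔ ∀ z ∈ p.1.support, z ∉ T := by
  simp [pf]

/-- Lengths of all paths from `v` to `y` avoiding `T`. -/
noncomputable def pl {V : Type} [Finite V] (G : SimpleGraph V) (T : Set V) (v y : V) :
    Multiset ℕ := ∑ p ∈ pf G T v y, {p.1.length}

theorem pl_eq_zero_of_mem {V : Type} [Finite V] (G : SimpleGraph V) {T : Set V} {v y : V}
    (h : v ∈ T) : pl G T v y = 0 := by
  unfold pl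
  have : pf G T v y = ∅ := by
    apply Finset.eq_empty_of_forall_notMem
    intro p hp
    rw [mem_pf] at hp
    exact hp v (Walk.start_mem_support _) h
  rw [this, Finset.sum_empty]

theorem pl_self {V : Type} [Finite V] (G : SimpleGraph V) {T : Set V} {v : V}
    (h : v ∉ T) : pl G T v v = {0} := by
  unfold pl
  have : pf G T v v = {Path.nil} := by
    ext p
    have := Path.loop_eq p
    subst this
    simp [h, mem_pf]
  rw [this, Finset.sum_singleton]
  simp

theorem pl_rec {V : Type} [Fintype V] (G : SimpleGraph V) {T : Set V} {v y : V}
    (h : v ∉ T) (hvy : v ≠ y) [DecidableRel G.Adj] :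
    pl G T v y = ∑ v' : V, if G.Adj v v' then (pl G (insert v T) v' y).map (· + 1) else 0 := by
  classical
  have e1 : ∀ v' : V, (if G.Adj v v' then (pl G (insert v T) v' y).map (· + 1) else 0)
      = ∑ p ∈ (if G.Adj v v' then pf G (insert v T) v' y else ∅), {p.1.length + 1} := by
    intro v'
    split_ifs with hv
    · unfold pl
      have := map_sum (Multiset.mapAddMonoidHom (fun i : ℕ => i + 1))
        (fun p : G.Path v' y => ({p.1.length} : Multiset ℕ)) (pf G (insert v T) v' y)
      simpa only [Multiset.coe_mapAddMonoidHom, Multiset.map_singleton] using this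
    · simp
  rw [Finset.sum_congr rfl (fun v' _ => e1 v')]
  rw [Finset.sum_sigma']
  symm
  have hadj : ∀ a : (Σ v' : V, G.Path v' y), a ∈ (Finset.univ : Finset V).sigma
      (fun v' => if G.Adj v v' then pf G (insert v T) v' y else ∅) →
      G.Adj v a.1 ∧ ∀ z ∈ a.2.1.support, z ∉ insert v T := by
    rintro ⟨v', p⟩ ha
    simp only [Finset.mem_sigma, Finset.mem_univ, true_and] at ha
    split_ifs at ha with hv
    · exact ⟨hv, (mem_pf _ _ _ _ _).1 ha⟩
    · simp at ha
  refine Finset.sum_bij (fun a ha => ⟨Walk.cons (hadj a ha).1 a.2.1, ?_⟩) ?_ ?_ ?_ ?_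
  · rw [Walk.cons_isPath_iff]
    exact ⟨a.2.2, fun hh => (hadj a ha).2 v hh (Set.mem_insert _ _)⟩
  · intro a ha
    rw [mem_pf]
    intro z hz
    simp only [Walk.support_cons, List.mem_cons] at hz
    rcases hz with rfl | hz
    · exact h
    · exact fun hT => (hadj a ha).2 z hz (Set.mem_insert_of_mem _ hT)
  · rintro ⟨a, p, hp⟩ ha ⟨b, q, hq⟩ hb hab
    simp only [Subtype.mk.injEq, Walk.cons.injEq] at hab
    obtain ⟨rfl, hab⟩ := hab
    simp at hab
    subst hab
    rfl
  · rintro ⟨p, hp⟩ hpm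
    rw [mem_pf] at hpm
    cases p with
    | nil => exact absurd rfl hvy
    | cons hv q =>
      rename_i v'
      rw [Walk.cons_isPath_iff] at hp
      refine ⟨⟨v', q, hp.1⟩, ?_, rfl⟩
      simp only [Finset.mem_sigma, Finset.mem_univ, true_and]
      rw [if_pos hv, mem_pf]
      intro z hz
      simp only [Walk.support_cons, List.mem_cons] at hpm
      rw [Set.mem_insert_iff]
      rintro (rfl | hT)
      · exact hp.2 hz
      · exact hpm z (Or.inr hz) hT
  · intro a ha
    simp

theorem dms_eq_pl {X : Type} (N : LabGraph X) (x y : X) :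
    N.dms x y = pl N.G ∅ (N.leaf x) (N.leaf y) := by
  classical
  unfold dms pl
  have : pf N.G ∅ (N.leaf x) (N.leaf y) = Finset.univ := by
    ext p; simp [mem_pf]
  rw [this, ← Finset.sum_multiset_singleton, ← Multiset.coe_mapAddMonoidHom]
  rw [map_sum]
  simp

theorem pl_symm {V : Type} [Finite V] (G : SimpleGraph V) (T : Set V) (v y : V) :
    pl G T v y = pl G T y v := by
  classical
  unfold pl
  refine Finset.sum_bij (fun p _ => p.reverse) ?_ ?_ ?_ ?_
  · intro p hp
    rw [mem_pf] at hp ⊢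
    simpa using hp
  · intro p _ q _ h
    have := congrArg (fun r => (r.1).reverse) h
    simpa [Subtype.ext_iff] using this
  · intro p hp
    refine ⟨p.reverse, ?_, ?_⟩
    · rw [mem_pf] at hp ⊢
      simpa using hp
    · ext1; simp
  · intro p _; simp

end LabGraph

namespace LabGraph
open SimpleGraph

/-- add `n` to all elements -/
def sh (n : ℕ) (A : Multiset ℕ) : Multiset ℕ := A.map (· + n)

theorem sh_sh (a b : ℕ) (A : Multiset ℕ) : sh a (sh b A) = sh (a + b) A := by
  simp [sh, Multiset.map_map, add_assoc, add_comm a b]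

theorem sh_add (a : ℕ) (A B : Multiset ℕ) : sh a (A + B) = sh a A + sh a B := by
  simp [sh]

theorem sh_zero (a : ℕ) : sh a 0 = 0 := by simp [sh]

theorem sh_0 (A : Multiset ℕ) : sh 0 A = A := by simp [sh]

section
set_option linter.unusedSectionVars false
variable {V : Type} [Finite V] {G : SimpleGraph V}

/-- general step -/
theorem pl_step {T : Set V} {v y : V} (h : v ∉ T) (hvy : v ≠ y) (F : Finset V)
    (hF : ∀ f ∈ F, G.Adj v f)
    (h0 : ∀ f, G.Adj v f → f ∉ F → pl G (insert v T) f y = 0) :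
    pl G T v y = ∑ f ∈ F, sh 1 (pl G (insert v T) f y) := by
  classical
  have := Fintype.ofFinite V
  rw [pl_rec G h hvy]
  symm
  have : ∀ f ∈ F, sh 1 (pl G (insert v T) f y)
      = if G.Adj v f then (pl G (insert v T) f y).map (· + 1) else 0 := by
    intro f hf; rw [if_pos (hF f hf)]; rfl
  rw [Finset.sum_congr rfl this]
  apply Finset.sum_subset (Finset.subset_univ _)
  intro f _ hf
  split_ifs with hv
  · rw [h0 f hv hf]; rfl
  · rfl

theorem pl_step0 {T : Set V} {v y : V} (hvy : v ≠ y)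
    (h0 : ∀ f, G.Adj v f → pl G (insert v T) f y = 0) :
    pl G T v y = 0 := by
  by_cases h : v ∈ T
  · exact pl_eq_zero_of_mem G h
  · rw [pl_step h hvy ∅ (by simp) (fun f hf _ => h0 f hf)]; simp

theorem pl_step1 {T : Set V} {v y : V} (h : v ∉ T) (hvy : v ≠ y) (f : V)
    (hf : G.Adj v f)
    (h0 : ∀ g, G.Adj v g → g ≠ f → pl G (insert v T) g y = 0) :
    pl G T v y = sh 1 (pl G (insert v T) f y) := by
  rw [pl_step h hvy {f} (by simpa using hf) (fun g hg hgf => h0 g hg (by simpa using hgf))]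
  simp

theorem pl_step2 {T : Set V} {v y : V} (h : v ∉ T) (hvy : v ≠ y) (f f' : V)
    (hff : f ≠ f')
    (hf : G.Adj v f) (hf' : G.Adj v f')
    (h0 : ∀ g, G.Adj v g → g ≠ f → g ≠ f' → pl G (insert v T) g y = 0) :
    pl G T v y = sh 1 (pl G (insert v T) f y) + sh 1 (pl G (insert v T) f' y) := by
  classical
  rw [pl_step h hvy {f, f'} (by simp [hf, hf'])
    (fun g hg hgf => by simp only [Finset.mem_insert, Finset.mem_singleton, not_or] at hgf
                        exact h0 g hg hgf.1 hgf.2)]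
  rw [Finset.sum_pair hff]

/-- induction principle for vanishing -/
theorem pl_zero_of_closed {S : Set V} {u y : V} (hy : y ∉ S)
    (hS : ∀ v ∈ S, v ≠ u → ∀ f, G.Adj v f → f ∈ S)
    (T : Set V) (hu : u ∈ T) (v : V) (hv : v ∈ S) : pl G T v y = 0 := by
  unfold pl
  have : pf G T v y = ∅ := by
    apply Finset.eq_empty_of_forall_notMem
    rintro ⟨p, hp⟩ hm
    rw [mem_pf] at hm
    simp only at hm
    clear hp
    induction p with
    | nil => exact hy hv
    | cons h q ih =>
      refine ih hy (hS _ hv ?_ _ h) ?_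
      · rintro rfl; exact hm _ (by simp) hu
      · intro z hz; exact hm z (by simp [hz])
  rw [this, Finset.sum_empty]

/-- A line. -/
structure Line (G : SimpleGraph V) (S : Set V) (r : ℕ) (q : ℕ → V) : Prop where
  adj : ∀ i ≤ r, G.Adj (q i) (q (i + 1))
  mem : ∀ i ≤ r + 1, q i ∈ S
  inj : ∀ i j, i ≤ r + 1 → j ≤ r + 1 → q i = q j → i = j
  nbr : ∀ i, 1 ≤ i → i ≤ r → ∀ v, G.Adj (q i) v →
    v = q (i - 1) ∨ v = q (i + 1) ∨ (v ∈ S ∧ ∀ v', G.Adj v v' → v' = q i)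

/-- interior -/
def seg (q : ℕ → V) (r : ℕ) : Set V := {v | ∃ i, 1 ≤ i ∧ i ≤ r ∧ q i = v}

theorem Line.rev {S : Set V} {r : ℕ} {q : ℕ → V} (h : Line G S r q) :
    Line G S r (fun i => q (r + 1 - i)) where
  adj i hi := by
    have := (h.adj (r - i) (by omega)).symm
    rw [show r - i + 1 = r + 1 - i by omega] at this
    rw [show r + 1 - (i + 1) = r - i by omega]
    exact this
  mem i hi := h.mem _ (by omega)
  inj i j hi hj he := by have := h.inj _ _ (by omega) (by omega) he; omega
  nbr i h1 h2 v hv := by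
    rcases h.nbr (r + 1 - i) (by omega) (by omega) v hv with h' | h' | h'
    · right; left; rw [h']; congr 1
    · left; rw [h']; congr 1; omega
    · right; right; exact h'

theorem seg_rev (q : ℕ → V) (r : ℕ) : seg (fun i => q (r + 1 - i)) r = seg q r := by
  ext v
  constructor
  · rintro ⟨i, h1, h2, h3⟩; exact ⟨r + 1 - i, by omega, by omega, h3⟩
  · rintro ⟨i, h1, h2, h3⟩
    refine ⟨r + 1 - i, by omega, by omega, ?_⟩
    simp only
    rw [← h3]; congr 1; omega

theorem Line.pl {S : Set V} {r : ℕ} {q : ℕ → V} (h : Line G S r q) {y : V} (hy : y ∉ S)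
    {T : Set V} (h0 : q 0 ∈ T) (hT : ∀ v ∈ seg q r, v ∉ T) :
    pl G T (q 1) y = sh r (LabGraph.pl G (T ∪ seg q r) (q (r + 1)) y) := by
  have key : ∀ j ≤ r, LabGraph.pl G T (q 1) y
      = sh j (LabGraph.pl G (T ∪ seg q j) (q (j + 1)) y) := by
    intro j hj
    induction j with
    | zero =>
      have : seg q 0 = ∅ := by
        ext v; simp only [seg, Set.mem_ofPred_eq, Set.mem_empty_iff_false, iff_false]
        rintro ⟨i, h1, h2, _⟩; omega
      rw [sh_0, this, Set.union_empty]
    | succ j ih =>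
      rw [ih (by omega)]
      have hins : insert (q (j + 1)) (T ∪ seg q j) = T ∪ seg q (j + 1) := by
        ext v
        simp only [Set.mem_insert_iff, Set.mem_union, seg, Set.mem_ofPred_eq]
        constructor
        · rintro (rfl | h' | ⟨i, h1, h2, h3⟩)
          · exact Or.inr ⟨j + 1, by omega, le_rfl, rfl⟩
          · exact Or.inl h'
          · exact Or.inr ⟨i, h1, by omega, h3⟩
        · rintro (h' | ⟨i, h1, h2, h3⟩)
          · exact Or.inr (Or.inl h')
          · by_cases hij : i = j + 1
            · subst hij; exact Or.inl h3.symm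
            · exact Or.inr (Or.inr ⟨i, h1, by omega, h3⟩)
      have hprev : q j ∈ T ∪ seg q (j + 1) := by
        by_cases hj0 : j = 0
        · subst hj0; exact Or.inl h0
        · exact Or.inr ⟨j, by omega, by omega, rfl⟩
      have hstep : LabGraph.pl G (T ∪ seg q j) (q (j + 1)) y
          = sh 1 (LabGraph.pl G (insert (q (j + 1)) (T ∪ seg q j)) (q (j + 1 + 1)) y) := by
        apply pl_step1
        · rintro (h' | ⟨i, h1, h2, h3⟩)
          · exact hT (q (j + 1)) ⟨j + 1, by omega, hj, rfl⟩ h'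
          · have := h.inj _ _ (by omega) (by omega) h3; omega
        · rintro rfl; exact hy (h.mem _ (by omega))
        · exact h.adj _ hj
        · intro g hg hne
          rw [hins]
          rcases h.nbr (j + 1) (by omega) hj g hg with h' | h' | ⟨h', h''⟩
          · apply pl_eq_zero_of_mem
            rw [h']; exact hprev
          · exact absurd h' hne
          · apply pl_step0
            · rintro rfl; exact hy h'
            · intro f hf
              apply pl_eq_zero_of_mem
              rw [h'' f hf]
              exact Or.inr (Or.inr ⟨j + 1, by omega, le_rfl, rfl⟩)
      rw [hstep, sh_sh, hins]
  exact key r le_rfl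

end
end LabGraph

namespace LabGraph
open SimpleGraph
section
set_option linter.unusedSectionVars false
variable {V : Type} [Finite V] {G : SimpleGraph V}

/-- Theta structure of a pendant blob. -/
structure Theta (G : SimpleGraph V) (S : Set V) (u w s t z0 : V) (k l m n : ℕ)
    (qA qB qC qD : ℕ → V) : Prop where
  A : Line G S k qA
  B : Line G S l qB
  C : Line G S m qC
  D : Line G S n qD
  A0 : qA 0 = s
  A1 : qA (k + 1) = t
  B0 : qB 0 = s
  B1 : qB (l + 1) = t
  C0 : qC 0 = u
  C1 : qC (m + 1) = s
  D0 : qD 0 = u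
  D1 : qD (n + 1) = t
  z0S : z0 ∈ S
  z0adj : G.Adj z0 (qC 1)
  z0nbr : ∀ v, G.Adj z0 v → v = qC 1
  bd : ∀ v ∈ S, ∀ f, f ∉ S → G.Adj v f → v = u ∧ f = w
  wS : w ∉ S
  uw : G.Adj u w
  snbr : ∀ v, G.Adj s v → v = qC m ∨ v = qA 1 ∨ v = qB 1
  AB1 : qA 1 ≠ qB 1
  tnbr : ∀ v, G.Adj t v → v = qA k ∨ v = qB l ∨ v = qD n
  dAB : Disjoint (seg qA k) (seg qB l)
  dAC : Disjoint (seg qA k) (seg qC m)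
  dAD : Disjoint (seg qA k) (seg qD n)
  dBC : Disjoint (seg qB l) (seg qC m)
  dBD : Disjoint (seg qB l) (seg qD n)
  dCD : Disjoint (seg qC m) (seg qD n)
  uA : u ∉ seg qA k
  uB : u ∉ seg qB l
  tC : t ∉ seg qC m
  sD : s ∉ seg qD n
  zA : z0 ∉ seg qA k
  zB : z0 ∉ seg qB l
  zC : z0 ∉ seg qC m
  zD : z0 ∉ seg qD n
  zs : z0 ≠ s
  zt : z0 ≠ t
  zu : z0 ≠ u

theorem Theta.swap {S : Set V} {u w s t z0 : V} {k l m n : ℕ}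
    {qA qB qC qD : ℕ → V} (h : Theta G S u w s t z0 k l m n qA qB qC qD) :
    Theta G S u w s t z0 l k m n qB qA qC qD :=
  { A := h.B, B := h.A, C := h.C, D := h.D, A0 := h.B0, A1 := h.B1, B0 := h.A0, B1 := h.A1
    C0 := h.C0, C1 := h.C1, D0 := h.D0, D1 := h.D1, z0S := h.z0S, z0adj := h.z0adj
    z0nbr := h.z0nbr, bd := h.bd, wS := h.wS, uw := h.uw
    snbr := fun v hv => by have := h.snbr v hv; tauto
    AB1 := h.AB1.symm
    tnbr := fun v hv => by have := h.tnbr v hv; tauto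
    dAB := h.dAB.symm, dAC := h.dBC, dAD := h.dBD, dBC := h.dAC, dBD := h.dAD, dCD := h.dCD
    uA := h.uB, uB := h.uA, tC := h.tC, sD := h.sD, zA := h.zB, zB := h.zA, zC := h.zC
    zD := h.zD, zs := h.zs, zt := h.zt, zu := h.zu }

theorem pl_avoid {S : Set V} {u w x : V}
    (bd : ∀ v ∈ S, ∀ f, f ∉ S → G.Adj v f → v = u ∧ f = w)
    (T : Set V) (hu : u ∈ T) (hT : T ⊆ S) (v : V) (hv : v ∉ S) : pl G T v x = pl G S v x := by
  unfold pl
  refine Finset.sum_congr ?_ (fun _ _ => rfl)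
  ext ⟨p, hp⟩
  rw [mem_pf, mem_pf]
  constructor
  · intro hm
    simp only at hm ⊢
    clear hp
    induction p with
    | nil => intro z hz; simp at hz; subst hz; exact hv
    | cons h q ih =>
      rename_i a b c
      have hb : b ∉ S := by
        intro hb
        have := (bd b hb a hv h.symm).1
        subst this
        exact hm b (by simp) hu
      have := ih hb (fun z hz => hm z (by simp [hz]))
      intro z hz
      rw [Walk.support_cons, List.mem_cons] at hz
      rcases hz with rfl | hz
      · exact hv
      · exact this z hz
  · intro hm z hz hzT; exact hm z hz (hT hzT)

theorem Theta.fromU {S : Set V} {u w s t z0 : V} {k l m n : ℕ}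
    {qA qB qC qD : ℕ → V} (h : Theta G S u w s t z0 k l m n qA qB qC qD) {x : V} (hx : x ∉ S)
    {T : Set V} (hT : T ⊆ S) (hu : u ∉ T) : pl G T u x = sh 1 (pl G S w x) := by
  have huS : u ∈ S := h.C0 ▸ h.C.mem 0 (by omega)
  rw [pl_step1 hu (by rintro rfl; exact hx huS) w h.uw]
  · rw [pl_avoid h.bd _ (Set.mem_insert _ _) (Set.insert_subset huS hT) _ h.wS]
  · intro g hg hgw
    apply pl_zero_of_closed hx (u := u) _ _ (Set.mem_insert _ _)
    · by_contra hgS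
      exact hgw (h.bd u huS g hgS hg).2
    · intro v hv hvu f hf
      by_contra hfS
      exact hvu (h.bd v hv f hfS hf).1

theorem Line.seg_sub {S : Set V} {r : ℕ} {q : ℕ → V} (h : Line G S r q) : seg q r ⊆ S := by
  rintro v ⟨i, h1, h2, rfl⟩; exact h.mem _ (by omega)

theorem Line.last_notMem {S : Set V} {r : ℕ} {q : ℕ → V} (h : Line G S r q) :
    q (r + 1) ∉ seg q r := by
  rintro ⟨i, h1, h2, h3⟩; have := h.inj _ _ (by omega) (by omega) h3; omega

theorem Line.first_notMem {S : Set V} {r : ℕ} {q : ℕ → V} (h : Line G S r q) :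
    q 0 ∉ seg q r := by
  rintro ⟨i, h1, h2, h3⟩; have := h.inj _ _ (by omega) (by omega) h3; omega

theorem Theta.viaA {S : Set V} {u w s t z0 : V} {k l m n : ℕ}
    {qA qB qC qD : ℕ → V} (h : Theta G S u w s t z0 k l m n qA qB qC qD) {x : V} (hx : x ∉ S)
    {T : Set V} (hs : s ∈ T) (hT : ∀ v ∈ T, v = s ∨ v = z0 ∨ v ∈ seg qC m) :
    pl G T (qA 1) x = sh (k + n + 2) (pl G S w x) := by
  have huS : u ∈ S := h.C0 ▸ h.C.mem 0 (by omega)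
  have hsS : s ∈ S := h.A0 ▸ h.A.mem 0 (by omega)
  have htS : t ∈ S := h.A1 ▸ h.A.mem (k + 1) (by omega)
  have hst : s ≠ t := by
    intro e; rw [← h.A0, ← h.A1] at e
    have := h.A.inj _ _ (by omega) (by omega) e; omega
  have hus : u ≠ s := by
    intro e; rw [← h.C0, ← h.C1] at e
    have := h.C.inj _ _ (by omega) (by omega) e; omega
  have hut : u ≠ t := by
    intro e; rw [← h.D0, ← h.D1] at e
    have := h.D.inj _ _ (by omega) (by omega) e; omega
  have hsA : s ∉ seg qA k := h.A0 ▸ h.A.first_notMem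
  have hsB : s ∉ seg qB l := h.B0 ▸ h.B.first_notMem
  have huC : u ∉ seg qC m := h.C0 ▸ h.C.first_notMem
  have huD : u ∉ seg qD n := h.D0 ▸ h.D.first_notMem
  have htA : t ∉ seg qA k := h.A1 ▸ h.A.last_notMem
  have htB : t ∉ seg qB l := h.B1 ▸ h.B.last_notMem
  have htD : t ∉ seg qD n := h.D1 ▸ h.D.last_notMem
  have hTS : T ⊆ S := by
    intro v hv
    rcases hT v hv with rfl | rfl | hv
    · exact hsS
    · exact h.z0S
    · exact h.C.seg_sub hv
  rw [h.A.pl hx (h.A0.symm ▸ hs), h.A1]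
  swap
  · intro v hv hvT
    rcases hT v hvT with rfl | rfl | hv'
    · exact hsA hv
    · exact h.zA hv
    · exact Set.disjoint_left.1 h.dAC hv hv'
  have hT3 : ∀ v ∈ T ∪ seg qA k, v = s ∨ v = z0 ∨ v ∈ seg qC m ∨ v ∈ seg qA k := by
    rintro v (hv | hv)
    · have := hT v hv; tauto
    · tauto
  have hdB := h.B.rev.pl hx (T := insert t (T ∪ seg qA k)) (y := x)
    (by simp [h.B1]) (by
      rw [seg_rev]
      intro v hv hvT
      rcases hvT with rfl | hvT
      · exact htB hv
      rcases hT3 v hvT with rfl | rfl | hv' | hv'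
      · exact hsB hv
      · exact h.zB hv
      · exact Set.disjoint_left.1 h.dBC hv hv'
      · exact Set.disjoint_left.1 h.dAB hv' hv)
  have hdD := h.D.rev.pl hx (T := insert t (T ∪ seg qA k)) (y := x)
    (by simp [h.D1]) (by
      rw [seg_rev]
      intro v hv hvT
      rcases hvT with rfl | hvT
      · exact htD hv
      rcases hT3 v hvT with rfl | rfl | hv' | hv'
      · exact h.sD hv
      · exact h.zD hv
      · exact Set.disjoint_left.1 h.dCD hv' hv
      · exact Set.disjoint_left.1 h.dAD hv' hv)
  simp only [Nat.add_sub_cancel, Nat.sub_self, h.B0, h.D0, seg_rev] at hdB hdD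
  have hsM : s ∈ insert t (T ∪ seg qA k) ∪ seg qB l := Or.inl (Or.inr (Or.inl hs))
  rw [pl_eq_zero_of_mem G hsM, sh_zero] at hdB
  rw [h.fromU hx] at hdD
  rotate_left
  · refine Set.union_subset (Set.insert_subset htS (Set.union_subset hTS h.A.seg_sub)) h.D.seg_sub
  · rintro ((h' | h') | h')
    · exact hut h'
    · rcases hT3 u h' with h' | h' | h' | h'
      · exact hus h'
      · exact h.zu h'.symm
      · exact huC h'
      · exact h.uA h'
    · exact huD h'
  rw [pl_step1 _ (by rintro rfl; exact hx htS) (qD n)]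
  · rw [hdD, sh_sh, sh_sh, sh_sh]; congr 1; omega
  · have := h.D.adj n le_rfl; rw [h.D1] at this; exact this.symm
  · intro g hg hgD
    rcases h.tnbr g hg with rfl | rfl | rfl
    · apply pl_eq_zero_of_mem
      by_cases hk : k = 0
      · subst hk; rw [h.A0]; exact Or.inr (Or.inl hs)
      · exact Or.inr (Or.inr ⟨k, by omega, le_rfl, rfl⟩)
    · exact hdB
    · exact absurd rfl hgD
  · intro h'
    rcases hT3 t h' with h' | h' | h' | h'
    · exact hst h'.symm
    · exact h.zt h'.symm
    · exact h.tC h'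
    · exact htA h'

theorem Theta.count {S : Set V} {u w s t z0 : V} {k l m n : ℕ}
    {qA qB qC qD : ℕ → V} (h : Theta G S u w s t z0 k l m n qA qB qC qD) {x : V} (hx : x ∉ S)
    (hm : 1 ≤ m) :
    pl G ∅ z0 x = sh 3 (pl G S w x) + sh (l + m + n + 4) (pl G S w x)
      + sh (k + m + n + 4) (pl G S w x) := by
  have huS : u ∈ S := h.C0 ▸ h.C.mem 0 (by omega)
  have hsS : s ∈ S := h.A0 ▸ h.A.mem 0 (by omega)
  have hp : qC 1 ∈ seg qC m := ⟨1, le_rfl, hm, rfl⟩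
  have hpS := h.C.seg_sub hp
  have huC : u ∉ seg qC m := h.C0 ▸ h.C.first_notMem
  have hsC : s ∉ seg qC m := h.C1 ▸ h.C.last_notMem
  have e1 : pl G ∅ z0 x = sh 1 (pl G {z0} (qC 1) x) := by
    rw [pl_step1 (by simp) (by rintro rfl; exact hx h.z0S) (qC 1) h.z0adj]
    · simp
    · intro g hg hne; exact absurd (h.z0nbr g hg) hne
  have e2 : pl G {z0} (qC 1) x
      = sh 1 (pl G {qC 1, z0} u x) + sh 1 (pl G {qC 1, z0} (qC 2) x) := by
    apply pl_step2
    · intro h'; rw [Set.mem_singleton_iff] at h'; exact h.zC (h' ▸ hp)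
    · rintro rfl; exact hx hpS
    · intro h'; rw [← h.C0] at h'; have := h.C.inj _ _ (by omega) (by omega) h'; omega
    · have := h.C.adj 0 (by omega); rw [h.C0] at this; exact this.symm
    · exact h.C.adj 1 (by omega)
    · intro g hg h1 h2
      rcases h.C.nbr 1 le_rfl hm g hg with h' | h' | ⟨h', h''⟩
      · rw [Nat.sub_self, h.C0] at h'; exact absurd h' h1
      · exact absurd h' h2
      · apply pl_step0
        · rintro rfl; exact hx h'
        · intro f hf
          apply pl_eq_zero_of_mem
          rw [h'' f hf]; simp
  have hsub : ({qC 1, z0} : Set V) ⊆ S := by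
    rintro v (rfl | rfl)
    · exact hpS
    · exact h.z0S
  have e3 := h.fromU hx hsub (by
    rintro (h' | h')
    · exact huC (h' ▸ hp)
    · exact h.zu h'.symm)
  have hC' : Line G S (m - 1) (fun i => qC (i + 1)) := by
    refine ⟨fun i hi => h.C.adj _ (by omega), fun i hi => h.C.mem _ (by omega),
      fun i j hi hj e => ?_, fun i h1 h2 v hv => ?_⟩
    · have := h.C.inj _ _ (by omega) (by omega) e; omega
    · have := h.C.nbr (i + 1) (by omega) (by omega) v hv
      simpa [Nat.sub_add_cancel h1] using this
  have hCseg : seg (fun i => qC (i + 1)) (m - 1) ⊆ seg qC m := by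
    rintro v ⟨i, h1, h2, h3⟩
    exact ⟨i + 1, by omega, by omega, h3⟩
  have e4 := hC'.pl hx (T := {qC 1, z0}) (by simp) (by
    rintro v hv (rfl | h')
    · obtain ⟨i, h1, h2, h3⟩ := hv
      have := h.C.inj _ _ (by omega) (by omega) h3; omega
    · rw [Set.mem_singleton_iff] at h'; exact h.zC (h' ▸ hCseg hv))
  simp only [show m - 1 + 1 + 1 = m + 1 by omega, h.C1, Nat.reduceAdd] at e4
  have hT1 : ∀ v ∈ ({qC 1, z0} ∪ seg (fun i => qC (i + 1)) (m - 1) : Set V),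
      v = z0 ∨ v ∈ seg qC m := by
    rintro v ((rfl | rfl) | hv)
    · exact Or.inr hp
    · exact Or.inl rfl
    · exact Or.inr (hCseg hv)
  have hmT : qC m ∈ ({qC 1, z0} ∪ seg (fun i => qC (i + 1)) (m - 1) : Set V) := by
    by_cases h1 : m = 1
    · subst h1; simp
    · right; exact ⟨m - 1, by omega, le_rfl, by simp only; congr 1; omega⟩
  generalize ({qC 1, z0} ∪ seg (fun i => qC (i + 1)) (m - 1) : Set V) = T1 at *
  have hT2 : ∀ v ∈ insert s T1, v = s ∨ v = z0 ∨ v ∈ seg qC m := by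
    rintro v (hv | hv)
    · exact Or.inl hv
    · exact Or.inr (hT1 v hv)
  have e5 : pl G T1 s x = sh 1 (pl G (insert s T1) (qA 1) x)
      + sh 1 (pl G (insert s T1) (qB 1) x) := by
    apply pl_step2
    · intro h'
      rcases hT1 s h' with h' | h'
      · exact h.zs h'.symm
      · exact hsC h'
    · rintro rfl; exact hx hsS
    · exact h.AB1
    · have := h.A.adj 0 (by omega); rw [h.A0] at this; exact this
    · have := h.B.adj 0 (by omega); rw [h.B0] at this; exact this
    · intro g hg h1 h2
      rcases h.snbr g hg with rfl | h' | h'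
      · exact pl_eq_zero_of_mem _ (Or.inr hmT)
      · exact absurd h' h1
      · exact absurd h' h2
  rw [h.viaA hx (Set.mem_insert _ _) hT2, h.swap.viaA hx (Set.mem_insert _ _) hT2] at e5
  rw [e1, e2, e3, e4, e5]
  simp only [sh_add, sh_sh]
  rw [show 1 + (1 + (m - 1 + (1 + (k + n + 2)))) = k + m + n + 4 by omega,
    show 1 + (1 + (m - 1 + (1 + (l + n + 2)))) = l + m + n + 4 by omega,
    add_assoc (sh 3 _), add_comm (sh (l + m + n + 4) _)]

end
end LabGraph

namespace LabGraph
open SimpleGraph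

theorem walk_exit {V : Type} {G : SimpleGraph V} {S : Set V} {u w : V}
    (bd : ∀ v ∈ S, ∀ f, f ∉ S → G.Adj v f → v = u ∧ f = w) {v y : V} (p : G.Walk v y)
    (hv : v ∈ S) (hy : y ∉ S) : w ∈ p.support := by
  induction p with
  | nil => exact absurd hv hy
  | cons h q ih =>
    rename_i a b c
    by_cases hb : b ∈ S
    · simp [ih hb hy]
    · have := (bd a hv b hb h).2
      subst this
      simp

theorem path_avoid {V : Type} {G : SimpleGraph V} {S : Set V} {u w : V}
    (bd : ∀ v ∈ S, ∀ f, f ∉ S → G.Adj v f → v = u ∧ f = w) {v y : V} (p : G.Walk v y)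
    (hp : p.IsPath) (hv : v ∉ S) (hy : y ∉ S) : ∀ z ∈ p.support, z ∉ S := by
  induction p with
  | nil => intro z hz; simp at hz; subst hz; exact hv
  | cons h q ih =>
    rename_i a b c
    rw [Walk.cons_isPath_iff] at hp
    have hb : b ∉ S := by
      intro hb
      have := (bd b hb a hv h.symm).2
      subst this
      exact hp.2 (walk_exit bd q hb hy)
    intro z hz
    rw [Walk.support_cons, List.mem_cons] at hz
    rcases hz with rfl | hz
    · exact hv
    · exact ih hp.1 hb hy z hz

theorem pl_empty_eq {V : Type} [Finite V] {G : SimpleGraph V} {S : Set V} {u w : V}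
    (bd : ∀ v ∈ S, ∀ f, f ∉ S → G.Adj v f → v = u ∧ f = w) {v y : V}
    (hv : v ∉ S) (hy : y ∉ S) : pl G ∅ v y = pl G S v y := by
  unfold pl
  refine Finset.sum_congr ?_ (fun _ _ => rfl)
  ext ⟨p, hp⟩
  rw [mem_pf, mem_pf]
  simp only [Set.mem_empty_iff_false, not_false_eq_true, implies_true, true_iff]
  exact path_avoid bd p hp hv hy

section
variable {V : Type} [Finite V] {G : SimpleGraph V} {S : Set V} {w : V} (hw : w ∉ S)
  {G' : SimpleGraph ({v : V // v ∉ S} ⊕ Unit)}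
  (h1 : ∀ a b, G'.Adj (Sum.inl a) (Sum.inl b) ↔ G.Adj a.1 b.1)
  (h2 : ∀ b, G'.Adj (Sum.inr ()) (Sum.inl b) ↔ b = ⟨w, hw⟩)

include h1 in
theorem pl_transfer (T : Set V) (hT : S ⊆ T) (v y : {v : V // v ∉ S}) :
    pl G' {z | ∀ a, z = Sum.inl a → a.1 ∈ T} (Sum.inl v) (Sum.inl y) = pl G T v.1 y.1 := by
  classical
  induction hn : Tᶜ.ncard using Nat.strong_induction_on generalizing T v with
  | _ N ih =>
  have := Fintype.ofFinite V
  by_cases hv : v.1 ∈ T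
  · rw [pl_eq_zero_of_mem G hv, pl_eq_zero_of_mem]
    intro a ha; cases ha; exact hv
  by_cases hvy : v = y
  · subst hvy
    rw [pl_self G hv, pl_self]
    intro h; exact hv (h v rfl)
  have hins : insert (Sum.inl v) {z : {v : V // v ∉ S} ⊕ Unit | ∀ a, z = Sum.inl a → a.1 ∈ T}
      = {z | ∀ a, z = Sum.inl a → a.1 ∈ insert v.1 T} := by
    ext z
    simp only [Set.mem_insert_iff, Set.mem_ofPred_eq]
    constructor
    · rintro (rfl | h) a ha
      · cases ha; exact Or.inl rfl
      · exact Or.inr (h a ha)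
    · intro h
      by_cases hz : z = Sum.inl v
      · exact Or.inl hz
      · right
        intro a ha
        rcases h a ha with h' | h'
        · exact absurd (by rw [ha]; congr 1; exact Subtype.ext h') hz
        · exact h'
  have hlt : ((insert v.1 T)ᶜ).ncard < N := by
    rw [← hn]
    apply Set.ncard_lt_ncard _ (Set.toFinite _)
    refine ⟨fun z hz hzT => hz (Or.inr hzT), fun h => ?_⟩
    exact (h hv : v.1 ∈ (insert v.1 T)ᶜ) (Set.mem_insert _ _)
  rw [pl_rec G hv (fun h => hvy (Subtype.ext h)), pl_rec G']
  · rw [Fintype.sum_sum_type, hins]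
    have e0 : ∑ a₂ : Unit, (if G'.Adj (Sum.inl v) (Sum.inr a₂) then
        Multiset.map (fun x => x + 1) (pl G' {z | ∀ a, z = Sum.inl a → a.1 ∈ insert v.1 T}
          (Sum.inr a₂) (Sum.inl y)) else 0) = 0 := by
      apply Finset.sum_eq_zero
      intro a _
      rw [pl_eq_zero_of_mem]
      · simp
      · intro a ha; cases ha
    rw [e0, add_zero]
    rw [← Finset.sum_subset (Finset.subset_univ (Finset.univ.filter (fun v => v ∉ S)))]
    · rw [← Finset.sum_subtype_eq_sum_filter]
      simp only [Finset.subtype_univ]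
      refine Finset.sum_congr rfl ?_
      intro a _
      rw [ih _ hlt _ (hT.trans (Set.subset_insert _ _)) a rfl]
      simp only [h1]
    · intro z _ hz
      simp at hz
      rw [pl_eq_zero_of_mem]
      · simp
      · exact Or.inr (hT hz)
  · intro h; exact hv (h v rfl)
  · intro h; exact hvy (Sum.inl.inj h)

include h1 in
theorem pl_transfer' (v y : {v : V // v ∉ S}) :
    pl G' {Sum.inr ()} (Sum.inl v) (Sum.inl y) = pl G S v.1 y.1 := by
  rw [← pl_transfer h1 S le_rfl]
  congr 1
  ext z
  rcases z with z | z
  · simp only [Set.mem_singleton_iff, reduceCtorEq, Set.mem_ofPred_eq, false_iff]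
    exact fun h => z.2 (h z rfl)
  · simp

include h1 h2 in
theorem pl_new_leaf (y : {v : V // v ∉ S}) :
    pl G' ∅ (Sum.inr ()) (Sum.inl y) = sh 1 (pl G S w y.1) := by
  rw [pl_step1 (by simp) (by simp) (Sum.inl ⟨w, hw⟩) ((h2 _).2 rfl)]
  · rw [show insert (Sum.inr ()) (∅ : Set ({v : V // v ∉ S} ⊕ Unit)) = {Sum.inr ()} by simp,
      pl_transfer' h1]
  · rintro (g | g) hg hne
    · exact absurd (by rw [(h2 g).1 hg]) hne
    · exact absurd hg (G'.irrefl)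

include h1 h2 in
theorem pl_old_leaves {u : V} (bd : ∀ v ∈ S, ∀ f, f ∉ S → G.Adj v f → v = u ∧ f = w)
    (x y : {v : V // v ∉ S}) :
    pl G' ∅ (Sum.inl x) (Sum.inl y) = pl G ∅ x.1 y.1 := by
  rw [pl_empty_eq bd x.2 y.2, ← pl_transfer' h1]
  apply pl_empty_eq (u := Sum.inr ()) (w := Sum.inl ⟨w, hw⟩)
  · rintro v hv f hf hvf
    rw [Set.mem_singleton_iff] at hv
    subst hv
    rcases f with f | f
    · exact ⟨rfl, by rw [(h2 f).1 hvf]⟩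
    · exact absurd hvf (G'.irrefl)
  · simp
  · simp

end

theorem count_sh (n : ℕ) (A : Multiset ℕ) (i : ℕ) :
    (sh n A).count i = if n ≤ i then A.count (i - n) else 0 := by
  split_ifs with h
  · obtain ⟨j, rfl⟩ := Nat.exists_eq_add_of_le' h
    rw [Nat.add_sub_cancel, sh]
    exact Multiset.count_map_eq_count' (· + n) A (fun a b h => by simpa using h) j
  · rw [Multiset.count_eq_zero]
    simp only [sh, Multiset.mem_map, not_exists, not_and]
    intro j _ hj
    omega

theorem sh_cancel {p q : ℕ} (hp : 1 ≤ p) (hq : 1 ≤ q) {A A' : Multiset ℕ}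
    (h : A + sh p A + sh q A = A' + sh p A' + sh q A') : A = A' := by
  ext i
  induction i using Nat.strong_induction_on with
  | _ i ih =>
  have := congrArg (Multiset.count i) h
  simp only [Multiset.count_add, count_sh] at this
  split_ifs at this with h1 h2 h2
  · rw [ih (i - p) (by omega), ih (i - q) (by omega)] at this; omega
  · rw [ih (i - p) (by omega)] at this; omega
  · rw [ih (i - q) (by omega)] at this; omega
  · omega

theorem lift_eq (A : Multiset ℕ) :
    (do let a ← A; pure ((a : ℕ) : ℤ) : Multiset ℤ) = A.map (fun t : ℕ => (t : ℤ)) := by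
  show A.bind (fun a => {(a : ℤ)}) = _
  rw [Multiset.bind_singleton]

theorem zsub_def (A : Multiset ℕ) (n : ℤ) : zsub A n = A.map (fun t : ℕ => (t : ℤ) - n) := by
  unfold zsub
  rw [lift_eq, Multiset.map_map]
  rfl

theorem toZ_def (A : Multiset ℕ) : toZ A = A.map (fun t : ℕ => (t : ℤ)) := by
  unfold toZ
  rw [lift_eq, Multiset.map_map]
  rfl

theorem zsub_eq {A B : Multiset ℕ} {r : ℕ} (h : zsub A 2 = zsub B ((r : ℤ) + 3)) :
    B = sh (r + 1) A := by
  have h2 := congrArg (Multiset.map (fun z : ℤ => (z + r + 3).toNat)) h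
  simp only [zsub_def, Multiset.map_map] at h2
  have e1 : Multiset.map ((fun z : ℤ => (z + r + 3).toNat) ∘ fun t : ℕ => (t : ℤ) - 2) A
      = sh (r + 1) A := by
    apply Multiset.map_congr rfl
    intro x _; simp only [Function.comp]; omega
  have e2 : Multiset.map ((fun z : ℤ => (z + r + 3).toNat) ∘ fun t : ℕ => (t : ℤ) - (r + 3)) B
      = B := by
    conv_rhs => rw [← Multiset.map_id B]
    apply Multiset.map_congr rfl
    intro x _; simp only [Function.comp, id]; omega
  rw [e1, e2] at h2
  exact h2.symm

theorem zsub_sh (A : Multiset ℕ) (r : ℕ) : zsub A 2 = zsub (sh (r + 1) A) ((r : ℤ) + 3) := by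
  simp only [zsub_def, sh, Multiset.map_map]
  apply Multiset.map_congr rfl
  intro x _; simp only [Function.comp]; push_cast; ring

theorem zsub_sh2 (A : Multiset ℕ) : zsub (sh 2 A) 2 = toZ A := by
  simp only [zsub_def, sh, toZ_def, Multiset.map_map]
  apply Multiset.map_congr rfl
  intro x _; simp only [Function.comp]; push_cast; ring

theorem card_sh (n : ℕ) (A : Multiset ℕ) : Multiset.card (sh n A) = Multiset.card A := by
  simp [sh]

end LabGraph

namespace LabGraph
open SimpleGraph Relation

theorem rtg_lift {α β : Type} {r : α → α → Prop} {p : β → β → Prop} (f : α → β)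
    (h : ∀ a b, r a b → p (f a) (f b)) {a b : α} (hab : ReflTransGen r a b) :
    ReflTransGen p (f a) (f b) := by
  induction hab with
  | refl => exact ReflTransGen.refl
  | tail _ hbc ih => exact ih.tail (h _ _ hbc)

theorem rtg_mono {α : Type} {r p : α → α → Prop} {a b : α} (hab : ReflTransGen r a b)
    (h : ∀ a b, r a b → p a b) : ReflTransGen p a b := rtg_lift id h hab

theorem coe_conn_iff {V : Type} {G : SimpleGraph V} (K : G.Subgraph) :
    K.coe.Connected ↔ K.verts.Nonempty ∧
      ∀ x ∈ K.verts, ∀ y ∈ K.verts, ReflTransGen K.Adj x y := by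
  constructor
  · intro h
    refine ⟨?_, ?_⟩
    · obtain ⟨⟨x, hx⟩⟩ := h.nonempty; exact ⟨x, hx⟩
    · intro x hx y hy
      have := (reachable_iff_reflTransGen _ _).1 (h.preconnected ⟨x, hx⟩ ⟨y, hy⟩)
      exact rtg_lift (p := K.Adj) (fun a : K.verts => a.1) (fun a b hab => hab) this
  · rintro ⟨⟨x0, hx0⟩, h⟩
    have : Nonempty K.verts := ⟨⟨x0, hx0⟩⟩
    refine Connected.mk ?_
    rintro ⟨x, hx⟩ ⟨y, hy⟩
    have := h x hx y hy
    rw [reachable_iff_reflTransGen]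
    induction this with
    | refl => exact ReflTransGen.refl
    | tail hab hbc ih => exact (ih hbc.fst_mem).tail hbc

theorem coe_reach {V : Type} {G : SimpleGraph V} (K : G.Subgraph) {x y : V}
    {hx : x ∈ K.verts} {hy : y ∈ K.verts} (h : K.coe.Reachable ⟨x, hx⟩ ⟨y, hy⟩) :
    ReflTransGen K.Adj x y :=
  rtg_lift (p := K.Adj) (fun a : K.verts => a.1) (fun a b hab => hab)
    ((reachable_iff_reflTransGen _ _).1 h)

theorem coe_reach' {V : Type} {G : SimpleGraph V} (K : G.Subgraph) {x y : V}
    {hx : x ∈ K.verts} {hy : y ∈ K.verts} (h : ReflTransGen K.Adj x y) :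
    K.coe.Reachable ⟨x, hx⟩ ⟨y, hy⟩ := by
  rw [reachable_iff_reflTransGen]
  induction h with
  | refl => exact ReflTransGen.refl
  | tail hab hbc ih => exact (ih (hy := hbc.fst_mem)).tail hbc

/-- adjacency avoiding `z` -/
def avo {V : Type} {G : SimpleGraph V} (K : G.Subgraph) (z : V) (a b : V) : Prop :=
  K.Adj a b ∧ a ≠ z ∧ b ≠ z

theorem avo_symm {V : Type} {G : SimpleGraph V} {K : G.Subgraph} {z : V} {a b : V}
    (h : ReflTransGen (avo K z) a b) : ReflTransGen (avo K z) b a := by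
  induction h with
  | refl => exact ReflTransGen.refl
  | tail _ hbc ih => exact ReflTransGen.head ⟨hbc.1.symm, hbc.2.2, hbc.2.1⟩ ih

theorem del_conn_iff {V : Type} {G : SimpleGraph V} (K : G.Subgraph) (z : V) :
    (K.deleteVerts {z}).coe.Connected ↔ (∃ x ∈ K.verts, x ≠ z) ∧
      ∀ x ∈ K.verts, x ≠ z → ∀ y ∈ K.verts, y ≠ z → ReflTransGen (avo K z) x y := by
  rw [coe_conn_iff]
  have : (K.deleteVerts {z}).Adj = avo K z := by
    funext a b
    simp only [Subgraph.deleteVerts_adj, Set.mem_singleton_iff, avo, eq_iff_iff]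
    constructor
    · rintro ⟨_, h1, _, h2, h3⟩; exact ⟨h3, h1, h2⟩
    · rintro ⟨h3, h1, h2⟩; exact ⟨h3.fst_mem, h1, h3.snd_mem, h2, h3⟩
  rw [this]
  simp only [Subgraph.deleteVerts_verts, Set.mem_sdiff, Set.mem_singleton_iff, and_imp]
  rfl

section
variable {X : Type} {N : LabGraph X} {H : N.G.Subgraph}

theorem twoC (hT : N.TwoConnSub H) (P : Set N.V) (hP : P ⊆ H.verts) (hne : P.Nonempty)
    (e : N.V) (he : e ∈ H.verts) (heP : e ∉ P) (o : N.V) (ho : o ∈ H.verts) (hoP : o ∉ P)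
    (hoe : o ≠ e) : ∃ f ∈ P, ∃ g, g ∉ P ∧ g ≠ e ∧ H.Adj f g := by
  obtain ⟨f0, hf0⟩ := hne
  have h := ((del_conn_iff H e).1 (hT.2.2 e he)).2 f0 (hP hf0) (by rintro rfl; exact heP hf0)
    o ho hoe
  by_contra hcon
  push Not at hcon
  have : ∀ z, ReflTransGen (avo H e) f0 z → z ∈ P := by
    intro z hz
    induction hz with
    | refl => exact hf0
    | tail _ hbc ih =>
      rename_i b c _
      by_contra hc
      exact hcon b ih c hc hbc.2.2 hbc.1
  exact hoP (this o h)

theorem outs (hT : N.TwoConnSub H) (P : Set N.V) (hP : P ⊆ H.verts) (hne : P.Nonempty)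
    (o o' : N.V) (ho : o ∈ H.verts) (hoP : o ∉ P) (ho' : o' ∈ H.verts) (hoP' : o' ∉ P)
    (hoe : o ≠ o') : ∃ f₁ ∈ P, ∃ f₂ ∈ P, ∃ g₁ g₂, g₁ ∉ P ∧ g₂ ∉ P ∧ g₁ ≠ g₂ ∧
      H.Adj f₁ g₁ ∧ H.Adj f₂ g₂ := by
  obtain ⟨f₁, hf₁, g₁, hg₁, hne₁, ha₁⟩ := twoC hT P hP hne o ho hoP o' ho' hoP' hoe.symm
  obtain ⟨f₂, hf₂, g₂, hg₂, hne₂, ha₂⟩ := twoC hT P hP hne g₁ ha₁.snd_mem hg₁ o ho hoP hne₁.symm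
  exact ⟨f₁, hf₁, f₂, hf₂, g₁, g₂, hg₁, hg₂, hne₂.symm, ha₁, ha₂⟩

theorem exists_third {V : Type} [Finite V] {s : Set V} (h : 3 ≤ s.ncard) (x y : V) :
    ∃ z ∈ s, z ≠ x ∧ z ≠ y := by
  by_contra hcon
  push Not at hcon
  have hsub : s ⊆ {x, y} := by
    intro z hz
    by_cases hzx : z = x
    · exact Or.inl hzx
    · exact Or.inr (hcon z hz hzx)
  have := Set.ncard_le_ncard hsub (Set.toFinite _)
  have := Set.ncard_insert_le x {y}
  rw [Set.ncard_singleton] at this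
  omega

theorem two_nbrs (hT : N.TwoConnSub H) {v : N.V} (hv : v ∈ H.verts) :
    ∃ g₁ g₂, g₁ ≠ g₂ ∧ H.Adj v g₁ ∧ H.Adj v g₂ := by
  obtain ⟨o, ho, hov, _⟩ := exists_third hT.1 v v
  obtain ⟨o', ho', hov', hoo⟩ := exists_third hT.1 v o
  obtain ⟨f₁, hf₁, f₂, hf₂, g₁, g₂, _, _, hne, h1, h2⟩ := outs hT {v} (by simpa using hv)
    (Set.singleton_nonempty v) o o' ho hov ho' hov' hoo.symm
  rw [Set.mem_singleton_iff] at hf₁ hf₂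
  subst hf₁; subst hf₂
  exact ⟨g₁, g₂, hne, h1, h2⟩

theorem walk_avo {V : Type} {G : SimpleGraph V} {K : G.Subgraph} {z a b : V} (p : G.Walk a b)
    (hp : p.toSubgraph ≤ K) (hz : z ∉ p.support) {y : V} (hy : y ∈ p.support) :
    ReflTransGen (avo K z) y b := by
  induction p generalizing y with
  | nil => simp at hy; subst hy; exact ReflTransGen.refl
  | cons h q ih =>
    rename_i a a' b
    rw [Walk.toSubgraph, sup_le_iff] at hp
    rw [Walk.support_cons, List.mem_cons, not_or] at hz
    have hadj : K.Adj a a' := hp.1.2 (by simp)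
    have h1 : ∀ y ∈ q.support, ReflTransGen (avo K z) y b := fun y hy => ih hp.2 hz.2 hy
    rw [Walk.support_cons, List.mem_cons] at hy
    rcases hy with rfl | hy
    · refine ReflTransGen.head ⟨hadj, fun e => hz.1 e.symm, ?_⟩ (h1 a' (by simp)) 
      rintro rfl; exact hz.2 (by simp)
    · exact h1 y hy

theorem path_avo {V : Type} {G : SimpleGraph V} {K : G.Subgraph} {z a b : V} (p : G.Walk a b)
    (hp : p.toSubgraph ≤ K) (hpath : p.IsPath) {y : V} (hy : y ∈ p.support) (hyz : y ≠ z) :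
    (a ≠ z ∧ ReflTransGen (avo K z) y a) ∨ (b ≠ z ∧ ReflTransGen (avo K z) y b) := by
  induction p with
  | nil => simp at hy; subst hy; exact Or.inl ⟨hyz, ReflTransGen.refl⟩
  | cons h q ih =>
    rename_i a a' b
    rw [Walk.toSubgraph, sup_le_iff] at hp
    rw [Walk.cons_isPath_iff] at hpath
    have hadj : K.Adj a a' := hp.1.2 (by simp)
    rw [Walk.support_cons, List.mem_cons] at hy
    rcases hy with rfl | hy
    · exact Or.inl ⟨hyz, ReflTransGen.refl⟩
    · rcases ih hp.2 hpath.1 hy with ⟨h1, h2⟩ | h'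
      · by_cases haz : a = z
        · subst haz
          right
          refine ⟨?_, walk_avo q hp.2 hpath.2 hy⟩
          rintro rfl; exact hpath.2 (by simp)
        · exact Or.inl ⟨haz, h2.tail ⟨hadj.symm, h1, haz⟩⟩
      · exact Or.inr h'

theorem ear (hT : N.TwoConnSub H) {v g : N.V} (hv : v ∈ H.verts) (hg : g ∈ H.verts)
    (p : N.G.Walk v g) (hp : p.IsPath) : N.TwoConnSub (H ⊔ p.toSubgraph) := by
  set H' := H ⊔ p.toSubgraph with hH'
  have hle : H ≤ H' := le_sup_left
  have h3 : 3 ≤ H'.verts.ncard := hT.1.trans (Set.ncard_le_ncard hle.1 (Set.toFinite _))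
  have hmono : ∀ z a b, avo H z a b → avo H' z a b := fun z a b h => ⟨hle.2 h.1, h.2⟩
  have hmono2 : ∀ z, z ∉ H.verts → ∀ a b, H.Adj a b → avo H' z a b := fun z hz a b h =>
    ⟨hle.2 h, by rintro rfl; exact hz h.fst_mem, by rintro rfl; exact hz h.snd_mem⟩
  have hH : ∀ z, ∀ x ∈ H.verts, x ≠ z → ∀ y ∈ H.verts, y ≠ z → ReflTransGen (avo H' z) x y := by
    intro z x hx hxz y hy hyz
    by_cases hz : z ∈ H.verts
    · exact rtg_mono (((del_conn_iff H z).1 (hT.2.2 z hz)).2 x hx hxz y hy hyz) (hmono z)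
    · exact rtg_mono (((coe_conn_iff H).1 hT.2.1).2 x hx y hy) (hmono2 z hz)
  have hto : ∀ z, ∀ x ∈ H'.verts, x ≠ z → ∃ h ∈ H.verts, h ≠ z ∧ ReflTransGen (avo H' z) x h := by
    intro z x hx hxz
    rcases hx with hx | hx
    · exact ⟨x, hx, hxz, ReflTransGen.refl⟩
    · rw [Walk.mem_verts_toSubgraph] at hx
      rcases path_avo p (le_sup_right : _ ≤ H') hp hx hxz with h | h
      · exact ⟨v, hv, h⟩
      · exact ⟨g, hg, h⟩
  have hall : ∀ z, ∀ x ∈ H'.verts, x ≠ z → ∀ y ∈ H'.verts, y ≠ z →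
      ReflTransGen (avo H' z) x y := by
    intro z x hx hxz y hy hyz
    obtain ⟨h1, hh1, hz1, r1⟩ := hto z x hx hxz
    obtain ⟨h2, hh2, hz2, r2⟩ := hto z y hy hyz
    exact (r1.trans (hH z h1 hh1 hz1 h2 hh2 hz2)).trans (avo_symm r2)
  refine ⟨h3, ?_, ?_⟩
  · rw [coe_conn_iff]
    refine ⟨⟨v, hle.1 hv⟩, ?_⟩
    intro x hx y hy
    obtain ⟨z, hz, hzx, hzy⟩ := exists_third h3 x y
    exact rtg_mono (hall z x hx hzx.symm y hy hzy.symm) (fun a b h => h.1)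
  · intro z hz
    rw [del_conn_iff]
    obtain ⟨x, hx, hxz, _⟩ := exists_third h3 z z
    exact ⟨⟨x, hx, hxz⟩, hall z⟩

theorem blob_bridge (hB : N.IsBlob H) {v v' : N.V} (hv : v ∈ H.verts) (hadj : N.G.Adj v v')
    (hnot : ¬ H.Adj v v') (hdeg : ∀ y, N.G.Adj v y → y ≠ v' → H.Adj v y) :
    N.IsCutEdge s(v, v') := by
  classical
  refine ⟨hadj, fun hc => ?_⟩
  obtain ⟨q, hq⟩ := hc.exists_isPath v v'
  cases q with
  | nil => exact hadj.ne rfl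
  | cons h r =>
    rename_i g
    rw [Walk.cons_isPath_iff] at hq
    rw [deleteEdges_adj] at h
    have hg : H.Adj v g := hdeg g h.1 (by rintro rfl; exact h.2 rfl)
    have hle : N.G.deleteEdges {s(v, v')} ≤ N.G := deleteEdges_le _
    let r' := r.mapLe hle
    have hr' : r'.IsPath := (Walk.isPath_mapLe hle).2 hq.1
    let W : N.G.Walk v g := Walk.cons hadj r'.reverse
    have hW : W.IsPath := by
      rw [Walk.cons_isPath_iff]
      refine ⟨hr'.reverse, ?_⟩
      simpa [r'] using hq.2
    have hear := ear hB.1 hv hg.snd_mem W hW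
    have := hB.2 _ hear le_sup_left
    apply hnot
    rw [← this]
    right
    simp [W, Walk.toSubgraph]

end
end LabGraph

namespace LabGraph
open SimpleGraph Relation

theorem deg3_cover {V : Type} [Finite V] {G : SimpleGraph V} {v a b c : V}
    (h : (G.neighborSet v).ncard = 3) (ha : G.Adj v a) (hb : G.Adj v b) (hc : G.Adj v c)
    (hab : a ≠ b) (hac : a ≠ c) (hbc : b ≠ c) {y : V} (hy : G.Adj v y) :
    y = a ∨ y = b ∨ y = c := by
  have hsub : ({a, b, c} : Set V) ⊆ G.neighborSet v := by
    rintro z (rfl | rfl | rfl)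
    · exact ha
    · exact hb
    · exact hc
  have hcard : ({a, b, c} : Set V).ncard = 3 := Set.ncard_eq_three.2 ⟨a, b, c, hab, hac, hbc, rfl⟩
  have heq := Set.eq_of_subset_of_ncard_le hsub (by omega) (Set.toFinite _)
  have : y ∈ ({a, b, c} : Set V) := by rw [heq]; exact hy
  simpa using this

section
variable {X : Type} {N : LabGraph X} {H : N.G.Subgraph}

/-- Basic context. -/
structure Ctx (N : LabGraph X) (H : N.G.Subgraph) (S : Set N.V) (nb : X → N.V) (K : Set X) :
    Prop where
  two : N.TwoConnSub H
  deg3 : ∀ v ∈ H.verts, (N.G.neighborSet v).ncard = 3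
  adjnb : ∀ x, N.G.Adj (N.leaf x) (nb x)
  uniq : ∀ x v, N.G.Adj (N.leaf x) v → v = nb x
  leafnot : ∀ x, N.leaf x ∉ H.verts
  leafinj : Function.Injective N.leaf
  nbH : ∀ x ∈ K, nb x ∈ H.verts
  SH : H.verts ⊆ S
  SL : ∀ x ∈ K, N.leaf x ∈ S

variable {S : Set N.V} {nb : X → N.V} {K : Set X}

theorem Ctx.nbr (hc : Ctx N H S nb K) {v v' : N.V} (hv : v ∈ H.verts) (hv' : v' ∉ H.verts)
    (hadj : N.G.Adj v v') {y : N.V} (hy : N.G.Adj v y) : y = v' ∨ H.Adj v y := by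
  obtain ⟨g1, g2, hne, h1, h2⟩ := two_nbrs hc.two hv
  rcases deg3_cover (hc.deg3 v hv) h1.adj_sub h2.adj_sub hadj hne
    (by rintro rfl; exact hv' h1.snd_mem) (by rintro rfl; exact hv' h2.snd_mem) hy with
    rfl | rfl | rfl
  · exact Or.inr h1
  · exact Or.inr h2
  · exact Or.inl rfl

theorem Ctx.nb_inj (hc : Ctx N H S nb K) {x y : X} (hx : x ∈ K) (h : nb x = nb y) : x = y := by
  have hy := hc.adjnb y
  rw [← h] at hy
  rcases hc.nbr (hc.nbH x hx) (hc.leafnot x) (hc.adjnb x).symm hy.symm with h | h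
  · exact (hc.leafinj h).symm
  · exact absurd h.snd_mem (hc.leafnot y)

theorem Ctx.nbrH (hc : Ctx N H S nb K) {r : ℕ} {q : ℕ → N.V} (hq : Line N.G S r q)
    {i : ℕ} (h1 : 1 ≤ i) (h2 : i ≤ r) {v : N.V} (hv : v ∈ H.verts) (ha : N.G.Adj (q i) v) :
    v = q (i - 1) ∨ v = q (i + 1) := by
  rcases hq.nbr i h1 h2 v ha with h | h | ⟨_, h⟩
  · exact Or.inl h
  · exact Or.inr h
  · obtain ⟨g1, g2, hne, h1, h2⟩ := two_nbrs hc.two hv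
    exact absurd ((h g1 h1.adj_sub).trans (h g2 h2.adj_sub).symm) hne

/-- neighbours of chain vertices are limited -/
theorem Ctx.four (hc : Ctx N H S nb K) {x : X} (hx : x ∈ K) {a b c : N.V}
    (ha : H.Adj (nb x) a) (hb : H.Adj (nb x) b) (hcc : H.Adj (nb x) c) (hab : a ≠ b) :
    c = a ∨ c = b := by
  have hl : ∀ z, H.Adj (nb x) z → z ≠ N.leaf x := by
    rintro z hz rfl; exact hc.leafnot x hz.snd_mem
  rcases deg3_cover (hc.deg3 _ (hc.nbH x hx)) ha.adj_sub hb.adj_sub (hc.adjnb x).symm hab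
    (hl _ ha) (hl _ hb) hcc.adj_sub with h | h | h
  · exact Or.inl h
  · exact Or.inr h
  · exact absurd h (hl _ hcc)

theorem chain_line (hc : Ctx N H S nb K) (r : ℕ) (hr : 1 ≤ r) (f : Fin r → X)
    (hf : Function.Injective f) (hfK : ∀ i, f i ∈ K) (hch : N.ChainInBlob r f H)
    (o o' : N.V) (ho : o ∈ H.verts) (ho' : o' ∈ H.verts) (hoo : o ≠ o')
    (hoP : ∀ i, o ≠ nb (f i)) (hoP' : ∀ i, o' ≠ nb (f i)) :
    ∃ q : ℕ → N.V, Line N.G S r q ∧ seg q r = nb '' Set.range f ∧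
      q 0 ∈ H.verts ∧ q (r + 1) ∈ H.verts ∧ (∀ i, q 0 ≠ nb (f i)) ∧ (∀ i, q (r + 1) ≠ nb (f i)) ∧
      H.Adj (nb (f ⟨0, hr⟩)) (q 0) ∧ H.Adj (nb (f ⟨r - 1, last_lt hr⟩)) (q (r + 1)) ∧
      q r = nb (f ⟨r - 1, last_lt hr⟩) := by
  have hadj : ∀ i (h : i + 1 < r), H.Adj (nb (f ⟨i, by omega⟩)) (nb (f ⟨i + 1, h⟩)) :=
    fun i h => hch i h _ _ (hc.adjnb _) (hc.adjnb _)
  have hinj : ∀ i j : Fin r, nb (f i) = nb (f j) → i = j :=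
    fun i j h => hf (hc.nb_inj (hfK i) h)
  obtain ⟨_, ⟨i1, rfl⟩, _, ⟨i2, rfl⟩, g1, g2, hg1, hg2, hne, ha1, ha2⟩ :=
    outs hc.two (Set.range fun i => nb (f i))
      (by rintro _ ⟨i, rfl⟩; exact hc.nbH _ (hfK i)) ⟨_, ⟨⟨0, hr⟩, rfl⟩⟩ o o' ho
      (by rintro ⟨i, h⟩; exact hoP i h.symm) ho' (by rintro ⟨i, h⟩; exact hoP' i h.symm) hoo
  -- an outside neighbour forces an end
  have hend : ∀ (i : Fin r) (g : N.V), g ∉ Set.range (fun i => nb (f i)) → H.Adj (nb (f i)) g →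
      i.1 = 0 ∨ i.1 = r - 1 := by
    rintro ⟨i, hi⟩ g hg hag
    by_contra hcon
    push Not at hcon
    simp only at hcon
    have e1 := (hadj (i - 1) (by omega)).symm
    simp only [show i - 1 + 1 = i by omega] at e1
    have e2 := hadj i (by omega)
    rcases hc.four (hfK _) e1 e2 hag (by
      intro h; have := hinj _ _ h; simp only [Fin.mk.injEq] at this; omega) with h | h
    · exact hg ⟨_, h.symm⟩
    · exact hg ⟨_, h.symm⟩
  have hends : ∃ e1 e2, e1 ≠ e2 ∧ e1 ∉ Set.range (fun i => nb (f i)) ∧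
      e2 ∉ Set.range (fun i => nb (f i)) ∧ H.Adj (nb (f ⟨0, hr⟩)) e1 ∧
      H.Adj (nb (f ⟨r - 1, last_lt hr⟩)) e2 := by
    have c1 := hend i1 g1 hg1 ha1
    have c2 := hend i2 g2 hg2 ha2
    have d : (i1.1 = 0 ∧ i2.1 = r - 1) ∨ (i1.1 = r - 1 ∧ i2.1 = 0) := by
      by_contra hcon
      have hr2 : 2 ≤ r := by omega
      have h12 : i1 = i2 := by ext; omega
      subst h12
      have : ∃ j, H.Adj (nb (f i1)) (nb (f j)) := by
        rcases c1 with c | c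
        · refine ⟨⟨1, by omega⟩, ?_⟩
          have := hadj 0 (by omega)
          rwa [show i1 = ⟨0, by omega⟩ from Fin.ext c]
        · refine ⟨⟨r - 2, by omega⟩, ?_⟩
          have := (hadj (r - 2) (by omega)).symm
          simp only [show r - 2 + 1 = r - 1 by omega] at this
          rwa [show i1 = ⟨r - 1, last_lt hr⟩ from Fin.ext c]
      obtain ⟨j, hj⟩ := this
      rcases hc.four (hfK _) ha1 ha2 hj hne with h | h
      · exact hg1 ⟨j, h⟩
      · exact hg2 ⟨j, h⟩
    rcases d with ⟨d1, d2⟩ | ⟨d1, d2⟩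
    · refine ⟨g1, g2, hne, hg1, hg2, ?_, ?_⟩
      · rwa [show i1 = ⟨0, by omega⟩ from Fin.ext d1] at ha1
      · rwa [show i2 = ⟨r - 1, last_lt hr⟩ from Fin.ext d2] at ha2
    · refine ⟨g2, g1, hne.symm, hg2, hg1, ?_, ?_⟩
      · rwa [show i2 = ⟨0, by omega⟩ from Fin.ext d2] at ha2
      · rwa [show i1 = ⟨r - 1, last_lt hr⟩ from Fin.ext d1] at ha1
  obtain ⟨e1, e2, hee, he1, he2, hae1, hae2⟩ := hends
  let q : ℕ → N.V := fun i => if i = 0 then e1 else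
    if h : i - 1 < r then nb (f ⟨i - 1, h⟩) else e2
  have q0 : q 0 = e1 := by simp [q]
  have qi : ∀ i (h1 : 1 ≤ i) (h2 : i ≤ r), q i = nb (f ⟨i - 1, by omega⟩) := by
    intro i h1 h2
    simp only [q]
    rw [if_neg (by omega), dif_pos (by omega)]
  have qe : q (r + 1) = e2 := by simp [q]
  have hqadj : ∀ i ≤ r, H.Adj (q i) (q (i + 1)) := by
    intro i hi
    by_cases h0 : i = 0
    · subst h0; rw [q0, qi 1 le_rfl hr]; exact hae1.symm
    · by_cases h1 : i = r
      · subst h1; rw [qe, qi i (by omega) le_rfl]; exact hae2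
      · rw [qi i (by omega) hi, qi (i + 1) (by omega) (by omega)]
        have := hadj (i - 1) (by omega)
        simp only [show i - 1 + 1 = i by omega] at this
        exact this
  have hqmem : ∀ i ≤ r + 1, q i ∈ H.verts := by
    intro i hi
    by_cases h1 : i = r + 1
    · subst h1; exact (hqadj r le_rfl).snd_mem
    · exact (hqadj i (by omega)).fst_mem
  have hqinj : ∀ i j, i ≤ r + 1 → j ≤ r + 1 → i < j → q i ≠ q j := by
    intro i j hi hj hij
    by_cases h0 : i = 0
    · subst h0
      rw [q0]
      by_cases h1 : j = r + 1
      · subst h1; rw [qe]; exact hee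
      · rw [qi j (by omega) (by omega)]; intro h; exact he1 ⟨_, h.symm⟩
    · rw [qi i (by omega) (by omega)]
      by_cases h1 : j = r + 1
      · subst h1; rw [qe]; intro h; exact he2 ⟨_, h⟩
      · rw [qi j (by omega) (by omega)]
        intro h; have := hinj _ _ h; simp only [Fin.mk.injEq] at this; omega
  refine ⟨q, ⟨fun i hi => (hqadj i hi).adj_sub, fun i hi => hc.SH (hqmem i hi), ?_, ?_⟩,
    ?_, hqmem _ (by omega), hqmem _ le_rfl, ?_, ?_, ?_, ?_, ?_⟩
  · intro i j hi hj h
    rcases lt_trichotomy i j with h' | h' | h'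
    · exact absurd h (hqinj i j hi hj h')
    · exact h'
    · exact absurd h.symm (hqinj j i hj hi h')
  · intro i h1 h2 v hv
    have hp := (hqadj (i - 1) (by omega)).symm
    rw [show i - 1 + 1 = i by omega] at hp
    have hn := hqadj i h2
    have hx := hfK ⟨i - 1, by omega⟩
    have hqi := qi i h1 h2
    rcases hc.nbr (hqmem i (by omega)) (hc.leafnot (f ⟨i - 1, by omega⟩))
      (hqi ▸ (hc.adjnb _).symm) hv with h | h
    · right; right
      subst h
      refine ⟨hc.SL _ hx, fun v' hv' => ?_⟩
      rw [hqi]; exact hc.uniq _ _ hv'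
    · have hpn : q (i - 1) ≠ q (i + 1) := hqinj _ _ (by omega) (by omega) (by omega)
      rw [hqi] at h hp hn
      rcases hc.four hx hp hn h hpn with h | h
      · exact Or.inl h
      · exact Or.inr (Or.inl h)
  · ext v
    constructor
    · rintro ⟨i, h1, h2, rfl⟩; exact ⟨_, ⟨_, rfl⟩, (qi i h1 h2).symm⟩
    · rintro ⟨_, ⟨i, rfl⟩, rfl⟩
      exact ⟨i.1 + 1, by omega, by omega, by rw [qi _ (by omega) (by omega)]; rfl⟩
  · intro i h; rw [q0] at h; exact he1 ⟨i, h.symm⟩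
  · intro i h; rw [qe] at h; exact he2 ⟨i, h.symm⟩
  · rw [q0]; exact hae1
  · rw [qe]; exact hae2
  · exact qi r hr le_rfl

theorem triv_line {s t : N.V} (hs : s ∈ S) (ht : t ∈ S) (h : N.G.Adj s t) :
    ∃ q : ℕ → N.V, Line N.G S 0 q ∧ seg q 0 = ∅ ∧ q 0 = s ∧ q (0 + 1) = t := by
  refine ⟨fun i => if i = 0 then s else t, ⟨?_, ?_, ?_, ?_⟩, ?_, by simp, by simp⟩
  · intro i hi; obtain rfl : i = 0 := by omega
    simpa using h
  · intro i hi; split_ifs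
    · exact hs
    · exact ht
  · intro i j hi hj he
    have := h.ne
    split_ifs at he with h1 h2 h2
    · omega
    · exact absurd he this
    · exact absurd he.symm this
    · omega
  · intro i h1 h2; omega
  · ext v; simp only [seg, Set.mem_ofPred_eq, Set.mem_empty_iff_false, iff_false]
    rintro ⟨i, h1, h2, _⟩; omega

theorem orient {s t : N.V} {r : ℕ} {q : ℕ → N.V} (hq : Line N.G S r q)
    (h0 : q 0 = s ∨ q 0 = t) (h1 : q (r + 1) = s ∨ q (r + 1) = t) :
    ∃ q' : ℕ → N.V, Line N.G S r q' ∧ seg q' r = seg q r ∧ q' 0 = s ∧ q' (r + 1) = t := by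
  have hne : q 0 ≠ q (r + 1) := fun h => by
    have := hq.inj _ _ (by omega) (by omega) h; omega
  rcases h0 with h0 | h0
  · refine ⟨q, hq, rfl, h0, ?_⟩
    rcases h1 with h1 | h1
    · exact absurd (h0.trans h1.symm) hne
    · exact h1
  · refine ⟨_, hq.rev, seg_rev q r, ?_, ?_⟩
    · rcases h1 with h1 | h1
      · simpa using h1
      · exact absurd (h0.trans h1.symm) hne
    · simpa using h0

end
end LabGraph

namespace LabGraph
open SimpleGraph Relation

section
variable {X : Type} {N : LabGraph X} {H : N.G.Subgraph}

/-- The combinatorial shape of a pendant level-2 blob. -/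
structure Hyp (N : LabGraph X) (H : N.G.Subgraph) (S : Set N.V) (nb : X → N.V) (K : Set X)
    (u w s t : N.V) (k l m n : ℕ) (hm : 1 ≤ m)
    (a : Fin k → X) (b : Fin l → X) (c : Fin m → X) (d : Fin n → X) : Prop where
  ctx : Ctx N H S nb K
  hK : ∀ x, x ∈ K → (∃ i, a i = x) ∨ (∃ i, b i = x) ∨ (∃ i, c i = x) ∨ (∃ i, d i = x)
  hS : ∀ v, v ∈ S → v ∈ H.verts ∨ ∃ x ∈ K, v = N.leaf x
  aK : ∀ i, a i ∈ K
  bK : ∀ i, b i ∈ K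
  cK : ∀ i, c i ∈ K
  dK : ∀ i, d i ∈ K
  ai : Function.Injective a
  bi : Function.Injective b
  ci : Function.Injective c
  di : Function.Injective d
  ab : ∀ i j, a i ≠ b j
  ac : ∀ i j, a i ≠ c j
  ad : ∀ i j, a i ≠ d j
  bc : ∀ i j, b i ≠ c j
  bd : ∀ i j, b i ≠ d j
  cd : ∀ i j, c i ≠ d j
  cha : N.ChainInBlob k a H
  chb : N.ChainInBlob l b H
  chc : N.ChainInBlob m c H
  chd : N.ChainInBlob n d H
  st : s ≠ t
  sH : s ∈ H.verts
  tH : t ∈ H.verts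
  sall : ∀ v, N.G.Adj s v → H.Adj s v
  tall : ∀ v, N.G.Adj t v → H.Adj t v
  uH : u ∈ H.verts
  us : u ≠ s
  ut : u ≠ t
  uw : N.G.Adj u w
  wS : w ∉ S
  nbs : ∀ x ∈ K, nb x ≠ s
  nbt : ∀ x ∈ K, nb x ≠ t
  nbu : ∀ x ∈ K, nb x ≠ u
  cover : ∀ v ∈ H.verts, v = s ∨ v = t ∨ v = u ∨ ∃ x ∈ K, v = nb x
  hA : ∀ i v, H.Adj (nb (a i)) v → v = s ∨ v = t ∨ ∃ j, v = nb (a j)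
  hB : ∀ i v, H.Adj (nb (b i)) v → v = s ∨ v = t ∨ ∃ j, v = nb (b j)
  hC : ∀ i v, H.Adj (nb (c i)) v → v = s ∨ v = t ∨ v = u ∨ ∃ j, v = nb (c j)
  hD : ∀ i v, H.Adj (nb (d i)) v → v = s ∨ v = t ∨ v = u ∨ ∃ j, v = nb (d j)
  hCu : H.Adj (nb (c ⟨m - 1, last_lt hm⟩)) u
  hDu : 1 ≤ n → ∃ j, H.Adj (nb (d j)) u

variable {S : Set N.V} {nb : X → N.V} {K : Set X} {u w s t : N.V} {k l m n : ℕ} {hm : 1 ≤ m}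
    {a : Fin k → X} {b : Fin l → X} {c : Fin m → X} {d : Fin n → X}

theorem Hyp.swap (h : Hyp N H S nb K u w s t k l m n hm a b c d) :
    Hyp N H S nb K u w t s k l m n hm a b c d :=
  { h with
    st := h.st.symm, sH := h.tH, tH := h.sH, sall := h.tall, tall := h.sall
    us := h.ut, ut := h.us, nbs := h.nbt, nbt := h.nbs
    cover := fun v hv => by have := h.cover v hv; tauto
    hA := fun i v hv => by have := h.hA i v hv; tauto
    hB := fun i v hv => by have := h.hB i v hv; tauto
    hC := fun i v hv => by have := h.hC i v hv; tauto
    hD := fun i v hv => by have := h.hD i v hv; tauto }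

theorem end_adj (hc : Ctx N H S nb K) {r : ℕ} {q : ℕ → N.V} (hq : Line N.G S r q)
    {f g : N.V} (hf : f ∈ seg q r) (hg : g ∉ seg q r) (ha : H.Adj f g) :
    (g = q 0 ∧ f = q 1) ∨ (g = q (r + 1) ∧ f = q r) := by
  obtain ⟨i, h1, h2, rfl⟩ := hf
  rcases hc.nbrH hq h1 h2 ha.snd_mem ha.adj_sub with h | h
  · left
    by_cases hi : i = 1
    · subst hi; exact ⟨h, rfl⟩
    · exact absurd ⟨i - 1, by omega, by omega, h.symm⟩ hg
  · right
    by_cases hi : i = r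
    · subst hi; exact ⟨h, rfl⟩
    · exact absurd ⟨i + 1, by omega, by omega, h.symm⟩ hg

theorem notseg {r : ℕ} {q : ℕ → N.V} {f : Fin r → X} (hs : seg q r = nb '' Set.range f)
    {v : N.V} (hv : ∀ i, nb (f i) ≠ v) : v ∉ seg q r := by
  rw [hs]; rintro ⟨_, ⟨i, rfl⟩, h⟩; exact hv i h

theorem segdisj (hc : Ctx N H S nb K) {r r' : ℕ} {q q' : ℕ → N.V} {f : Fin r → X} {f' : Fin r' → X}
    (hs : seg q r = nb '' Set.range f) (hs' : seg q' r' = nb '' Set.range f')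
    (hf : ∀ i, f i ∈ K) (hd : ∀ i j, f i ≠ f' j) : Disjoint (seg q r) (seg q' r') := by
  rw [hs, hs', Set.disjoint_left]
  rintro _ ⟨_, ⟨i, rfl⟩, rfl⟩ ⟨_, ⟨j, rfl⟩, h⟩
  exact hd i j (hc.nb_inj (hf i) h.symm)

theorem segfirst {r : ℕ} (hr : 1 ≤ r) (q : ℕ → N.V) : q 1 ∈ seg q r := ⟨1, le_rfl, hr, rfl⟩
theorem seglast {r : ℕ} (hr : 1 ≤ r) (q : ℕ → N.V) : q r ∈ seg q r := ⟨r, hr, le_rfl, rfl⟩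

theorem Hyp.cline (h : Hyp N H S nb K u w s t k l m n hm a b c d) :
    ∃ q : ℕ → N.V, Line N.G S m q ∧ seg q m = nb '' Set.range c ∧ q 0 = u ∧
      q 1 = nb (c ⟨m - 1, last_lt hm⟩) ∧ (q (m + 1) = s ∨ q (m + 1) = t) := by
  obtain ⟨q, hq, hseg, h0, h1, hn0, hn1, ha0, ha1, hlast⟩ := chain_line h.ctx m hm c h.ci h.cK h.chc
    s t h.sH h.tH h.st (fun i e => h.nbs _ (h.cK i) e.symm) (fun i e => h.nbt _ (h.cK i) e.symm)
  have e0 : q 0 = s ∨ q 0 = t ∨ q 0 = u := by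
    rcases h.hC _ _ ha0 with e | e | e | ⟨j, e⟩
    · exact Or.inl e
    · exact Or.inr (Or.inl e)
    · exact Or.inr (Or.inr e)
    · exact absurd e (hn0 j)
  have e1 : q (m + 1) = s ∨ q (m + 1) = t ∨ q (m + 1) = u := by
    rcases h.hC _ _ ha1 with e | e | e | ⟨j, e⟩
    · exact Or.inl e
    · exact Or.inr (Or.inl e)
    · exact Or.inr (Or.inr e)
    · exact absurd e (hn1 j)
  have hne : q 0 ≠ q (m + 1) := fun e => by
    have := hq.inj _ _ (by omega) (by omega) e; omega
  have huseg : u ∉ seg q m := notseg hseg (fun i => h.nbu _ (h.cK i))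
  have hcu := h.hCu
  rw [← hlast] at hcu
  rcases end_adj h.ctx hq (seglast hm q) huseg hcu with ⟨e, e'⟩ | ⟨e, e'⟩
  · refine ⟨q, hq, hseg, e.symm, e'.symm.trans hlast, ?_⟩
    rcases e1 with h' | h' | h'
    · exact Or.inl h'
    · exact Or.inr h'
    · exact absurd (e.symm.trans h'.symm) hne
  · refine ⟨_, hq.rev, (seg_rev q m).trans hseg, by simpa using e.symm, by simpa using hlast, ?_⟩
    simp only [Nat.sub_self]
    rcases e0 with h' | h' | h'
    · exact Or.inl h'
    · exact Or.inr h'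
    · exact absurd (h'.trans e) hne

theorem Hyp.abline (h : Hyp N H S nb K u w s t k l m n hm a b c d) {r : ℕ} (hr : 1 ≤ r)
    (f : Fin r → X) (hf : Function.Injective f) (hfK : ∀ i, f i ∈ K) (hch : N.ChainInBlob r f H)
    (hF : ∀ i v, H.Adj (nb (f i)) v → v = s ∨ v = t ∨ ∃ j, v = nb (f j)) :
    ∃ q : ℕ → N.V, Line N.G S r q ∧ seg q r = nb '' Set.range f ∧ q 0 = s ∧ q (r + 1) = t := by
  obtain ⟨q, hq, hseg, h0, h1, hn0, hn1, ha0, ha1, hlast⟩ := chain_line h.ctx r hr f hf hfK hch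
    s t h.sH h.tH h.st (fun i e => h.nbs _ (hfK i) e.symm) (fun i e => h.nbt _ (hfK i) e.symm)
  obtain ⟨q', hq', hseg', e0, e1⟩ := orient (s := s) (t := t) hq (by
    rcases hF _ _ ha0 with e | e | ⟨j, e⟩
    · exact Or.inl e
    · exact Or.inr e
    · exact absurd e (hn0 j)) (by
    rcases hF _ _ ha1 with e | e | ⟨j, e⟩
    · exact Or.inl e
    · exact Or.inr e
    · exact absurd e (hn1 j))
  exact ⟨q', hq', hseg'.trans hseg, e0, e1⟩

theorem Hyp.u_nbr (h : Hyp N H S nb K u w s t k l m n hm a b c d) {g : N.V} (hg : H.Adj u g) :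
    g = s ∨ g = t ∨ (∃ i, g = nb (c i)) ∨ ∃ j, g = nb (d j) := by
  rcases h.cover g hg.snd_mem with e | e | e | ⟨x, hx, e⟩
  · exact Or.inl e
  · exact Or.inr (Or.inl e)
  · subst e; exact absurd rfl hg.ne
  · subst e
    rcases h.hK x hx with ⟨i, rfl⟩ | ⟨i, rfl⟩ | ⟨i, rfl⟩ | ⟨i, rfl⟩
    · rcases h.hA _ _ hg.symm with e | e | ⟨j, e⟩
      · exact absurd e h.us
      · exact absurd e h.ut
      · exact absurd e.symm (h.nbu _ (h.aK j))
    · rcases h.hB _ _ hg.symm with e | e | ⟨j, e⟩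
      · exact absurd e h.us
      · exact absurd e h.ut
      · exact absurd e.symm (h.nbu _ (h.bK j))
    · exact Or.inr (Or.inr (Or.inl ⟨i, rfl⟩))
    · exact Or.inr (Or.inr (Or.inr ⟨i, rfl⟩))

theorem Hyp.wH (h : Hyp N H S nb K u w s t k l m n hm a b c d) : w ∉ H.verts :=
  fun e => h.wS (h.ctx.SH e)

theorem Hyp.dline (h : Hyp N H S nb K u w s t k l m n hm a b c d) {qC : ℕ → N.V}
    (hC : Line N.G S m qC) (hsC : seg qC m = nb '' Set.range c) (hC0 : qC 0 = u)
    (hC1 : qC (m + 1) = s) :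
    ∃ q : ℕ → N.V, Line N.G S n q ∧ seg q n = nb '' Set.range d ∧ q 0 = u ∧ q (n + 1) = t := by
  have sC : s ∉ seg qC m := notseg hsC (fun i => h.nbs _ (h.cK i))
  have tC : t ∉ seg qC m := notseg hsC (fun i => h.nbt _ (h.cK i))
  have hCH : seg qC m ⊆ H.verts := by
    rw [hsC]; rintro _ ⟨_, ⟨i, rfl⟩, rfl⟩; exact h.ctx.nbH _ (h.cK i)
  by_cases hn : n = 0
  · subst hn
    obtain ⟨f, hf, g, hg, hgs, hfg⟩ := twoC h.ctx.two (insert u (seg qC m))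
      (Set.insert_subset h.uH hCH) ⟨u, Set.mem_insert _ _⟩ s h.sH
      (by rintro (e | e); exacts [h.us e.symm, sC e]) t h.tH
      (by rintro (e | e); exacts [h.ut e.symm, tC e]) h.st.symm
    rw [Set.mem_insert_iff, not_or] at hg
    rcases hf with rfl | hf
    · rcases h.u_nbr hfg with e | e | ⟨i, e⟩ | ⟨i, e⟩
      · exact absurd e hgs
      · subst e
        obtain ⟨q, hq, hs, h0, h1⟩ := triv_line (N := N) (h.ctx.SH h.uH) (h.ctx.SH h.tH) hfg.adj_sub
        refine ⟨q, hq, ?_, h0, h1⟩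
        rw [hs, Set.range_eq_empty, Set.image_empty]
      · exact absurd (by rw [hsC]; exact ⟨_, ⟨i, rfl⟩, e.symm⟩) hg.2
      · exact i.elim0
    · rcases end_adj h.ctx hC hf hg.2 hfg with ⟨e, _⟩ | ⟨e, _⟩
      · exact absurd (e.trans hC0) hg.1
      · exact absurd (e.trans hC1) hgs
  · have hn1 : 1 ≤ n := by omega
    obtain ⟨q, hq, hseg, h0, h1, hn0, hn1', ha0, ha1, hlast⟩ := chain_line h.ctx n hn1 d h.di h.dK
      h.chd s t h.sH h.tH h.st (fun i e => h.nbs _ (h.dK i) e.symm)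
      (fun i e => h.nbt _ (h.dK i) e.symm)
    have e0 : q 0 = s ∨ q 0 = t ∨ q 0 = u := by
      rcases h.hD _ _ ha0 with e | e | e | ⟨j, e⟩
      · exact Or.inl e
      · exact Or.inr (Or.inl e)
      · exact Or.inr (Or.inr e)
      · exact absurd e (hn0 j)
    have e1 : q (n + 1) = s ∨ q (n + 1) = t ∨ q (n + 1) = u := by
      rcases h.hD _ _ ha1 with e | e | e | ⟨j, e⟩
      · exact Or.inl e
      · exact Or.inr (Or.inl e)
      · exact Or.inr (Or.inr e)
      · exact absurd e (hn1' j)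
    have hne : q 0 ≠ q (n + 1) := fun e => by
      have := hq.inj _ _ (by omega) (by omega) e; omega
    have huseg : u ∉ seg q n := notseg hseg (fun i => h.nbu _ (h.dK i))
    obtain ⟨j, hj⟩ := h.hDu hn1
    have hjs : nb (d j) ∈ seg q n := by rw [hseg]; exact ⟨_, ⟨j, rfl⟩, rfl⟩
    have key : ∃ q' : ℕ → N.V, Line N.G S n q' ∧ seg q' n = nb '' Set.range d ∧ q' 0 = u ∧
        (q' (n + 1) = s ∨ q' (n + 1) = t) := by
      rcases end_adj h.ctx hq hjs huseg hj with ⟨e, e'⟩ | ⟨e, e'⟩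
      · refine ⟨q, hq, hseg, e.symm, ?_⟩
        rcases e1 with h' | h' | h'
        · exact Or.inl h'
        · exact Or.inr h'
        · exact absurd (e.symm.trans h'.symm) hne
      · refine ⟨_, hq.rev, (seg_rev q n).trans hseg, by simpa using e.symm, ?_⟩
        simp only [Nat.sub_self]
        rcases e0 with h' | h' | h'
        · exact Or.inl h'
        · exact Or.inr h'
        · exact absurd (h'.trans e) hne
    obtain ⟨q', hq', hs', h0', h1'⟩ := key
    refine ⟨q', hq', hs', h0', ?_⟩
    rcases h1' with h1' | h1'
    swap
    · exact h1'
    exfalso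
    have sD : s ∉ seg q' n := notseg hs' (fun i => h.nbs _ (h.dK i))
    have tD : t ∉ seg q' n := notseg hs' (fun i => h.nbt _ (h.dK i))
    have hDH : seg q' n ⊆ H.verts := by
      rw [hs']; rintro _ ⟨_, ⟨i, rfl⟩, rfl⟩; exact h.ctx.nbH _ (h.dK i)
    obtain ⟨f, hf, g, hg, hgs, hfg⟩ := twoC h.ctx.two (insert u (seg qC m ∪ seg q' n))
      (Set.insert_subset h.uH (Set.union_subset hCH hDH)) ⟨u, Set.mem_insert _ _⟩ s h.sH
      (by rintro (e | e | e); exacts [h.us e.symm, sC e, sD e]) t h.tH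
      (by rintro (e | e | e); exacts [h.ut e.symm, tC e, tD e]) h.st.symm
    rw [Set.mem_insert_iff, Set.mem_union, not_or, not_or] at hg
    rcases hf with rfl | hf | hf
    · have c1 : N.G.Adj f (qC 1) := by have := hC.adj 0 (by omega); rwa [hC0] at this
      have d1 : N.G.Adj f (q' 1) := by have := hq'.adj 0 (by omega); rwa [h0'] at this
      have hcd : qC 1 ≠ q' 1 := fun e =>
        Set.disjoint_left.1 (segdisj h.ctx hsC hs' h.cK h.cd) (segfirst hm qC)
          (e ▸ segfirst hn1 q')
      rcases deg3_cover (h.ctx.deg3 _ h.uH) c1 d1 h.uw hcd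
        (fun e => h.wH (e ▸ hCH (segfirst hm qC))) (fun e => h.wH (e ▸ hDH (segfirst hn1 q')))
        hfg.adj_sub with e | e | e
      · exact hg.2.1 (e ▸ segfirst hm qC)
      · exact hg.2.2 (e ▸ segfirst hn1 q')
      · exact h.wH (e ▸ hfg.snd_mem)
    · rcases end_adj h.ctx hC hf hg.2.1 hfg with ⟨e, _⟩ | ⟨e, _⟩
      · exact absurd (e.trans hC0) hg.1
      · exact absurd (e.trans hC1) hgs
    · rcases end_adj h.ctx hq' hf hg.2.2 hfg with ⟨e, _⟩ | ⟨e, _⟩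
      · exact absurd (e.trans h0') hg.1
      · exact absurd (e.trans h1') hgs

theorem Hyp.bline (h : Hyp N H S nb K u w s t k l m n hm a b c d) (hk : 1 ≤ k) {qA qC qD : ℕ → N.V}
    (hC : Line N.G S m qC) (hsC : seg qC m = nb '' Set.range c) (hC0 : qC 0 = u)
    (hC1 : qC (m + 1) = s)
    (hA : Line N.G S k qA) (hsA : seg qA k = nb '' Set.range a) (hA0 : qA 0 = s)
    (hA1 : qA (k + 1) = t)
    (hD : Line N.G S n qD) (hsD : seg qD n = nb '' Set.range d) (hD0 : qD 0 = u)
    (hD1 : qD (n + 1) = t) :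
    ∃ q : ℕ → N.V, Line N.G S l q ∧ seg q l = nb '' Set.range b ∧ q 0 = s ∧ q (l + 1) = t := by
  by_cases hl : l = 0
  swap
  · exact h.abline (by omega) b h.bi h.bK h.chb h.hB
  subst hl
  have sC : s ∉ seg qC m := notseg hsC (fun i => h.nbs _ (h.cK i))
  have sA : s ∉ seg qA k := notseg hsA (fun i => h.nbs _ (h.aK i))
  have sD : s ∉ seg qD n := notseg hsD (fun i => h.nbs _ (h.dK i))
  obtain ⟨y, hy, hy1, hy2⟩ := exists_third (h.ctx.deg3 s h.sH).ge (qC m) (qA 1)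
  have hyH := h.sall y hy
  have hyt : y = t := by
    rcases h.cover y hyH.snd_mem with e | e | e | ⟨x, hx, e⟩
    · exact absurd e.symm hy.ne
    · exact e
    · subst e
      exfalso
      have c1 : N.G.Adj y (qC 1) := by have := hC.adj 0 (by omega); rwa [hC0] at this
      have d1 : N.G.Adj y (qD 1) := by have := hD.adj 0 (by omega); rwa [hD0] at this
      have hsw : s ≠ w := fun e => h.wH (e ▸ h.sH)
      have hsc : s ≠ qC 1 := fun e => sC (e ▸ segfirst hm qC)
      have hsd : s ≠ qD 1 := by
        intro e
        by_cases hn : n = 0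
        · subst hn; exact h.st (e.trans hD1)
        · exact sD (e ▸ segfirst (by omega) qD)
      obtain hh | hh | hh := deg3_cover (h.ctx.deg3 _ h.uH) hyH.symm.adj_sub c1 h.uw hsc hsw
        (fun e => h.wH (e ▸ (by
          have := segfirst hm qC; rw [hsC] at this
          obtain ⟨_, ⟨i, rfl⟩, e⟩ := this; exact e ▸ h.ctx.nbH _ (h.cK i)))) d1
      · exact hsd hh.symm
      · by_cases hn : n = 0
        · subst hn
          have : t ∈ seg qC m := by
            have := segfirst hm qC; rw [← hh] at this; rw [zero_add] at hD1; rwa [hD1] at this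
          exact notseg hsC (fun i => h.nbt _ (h.cK i)) this
        · exact Set.disjoint_left.1 (segdisj h.ctx hsC hsD h.cK h.cd) (segfirst hm qC)
            (hh ▸ segfirst (by omega) qD)
      · by_cases hn : n = 0
        · subst hn; exact h.wH (hh ▸ hD1 ▸ h.tH)
        · have := segfirst (r := n) (by omega) qD
          rw [hsD, hh] at this
          obtain ⟨_, ⟨i, rfl⟩, e⟩ := this
          exact h.wH (e ▸ h.ctx.nbH _ (h.dK i))
    · exfalso
      subst e
      rcases h.hK x hx with ⟨i, rfl⟩ | ⟨i, rfl⟩ | ⟨i, rfl⟩ | ⟨i, rfl⟩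
      · rcases end_adj h.ctx hA (by rw [hsA]; exact ⟨_, ⟨i, rfl⟩, rfl⟩) sA hyH.symm with
          ⟨_, e⟩ | ⟨e, _⟩
        · exact hy2 e
        · exact h.st (e.trans hA1)
      · exact i.elim0
      · rcases end_adj h.ctx hC (by rw [hsC]; exact ⟨_, ⟨i, rfl⟩, rfl⟩) sC hyH.symm with
          ⟨e, _⟩ | ⟨_, e⟩
        · exact h.us (e.trans hC0).symm
        · exact hy1 e
      · rcases end_adj h.ctx hD (by rw [hsD]; exact ⟨_, ⟨i, rfl⟩, rfl⟩) sD hyH.symm with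
          ⟨e, _⟩ | ⟨e, _⟩
        · exact h.us (e.trans hD0).symm
        · exact h.st (e.trans hD1)
  subst hyt
  obtain ⟨q, hq, hs, h0, h1⟩ := triv_line (N := N) (h.ctx.SH h.sH) (h.ctx.SH h.tH) hy
  refine ⟨q, hq, ?_, h0, h1⟩
  rw [hs, Set.range_eq_empty, Set.image_empty]

theorem Hyp.bdry (h : Hyp N H S nb K u w s t k l m n hm a b c d) :
    ∀ v ∈ S, ∀ f, f ∉ S → N.G.Adj v f → v = u ∧ f = w := by
  intro v hv f hf ha
  have hfH : f ∉ H.verts := fun e => hf (h.ctx.SH e)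
  rcases h.hS v hv with hv | ⟨x, hx, rfl⟩
  · rcases h.cover v hv with rfl | rfl | rfl | ⟨x, hx, rfl⟩
    · exact absurd (h.sall _ ha).snd_mem hfH
    · exact absurd (h.tall _ ha).snd_mem hfH
    · rcases h.ctx.nbr hv h.wH h.uw ha with e | e
      · exact ⟨rfl, e⟩
      · exact absurd e.snd_mem hfH
    · rcases h.ctx.nbr hv (h.ctx.leafnot x) (h.ctx.adjnb x).symm ha with e | e
      · exact absurd (e ▸ h.ctx.SL x hx) hf
      · exact absurd e.snd_mem hfH
  · exact absurd (h.ctx.uniq _ _ ha ▸ h.ctx.nbH x hx) hfH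

theorem Hyp.theta' (h : Hyp N H S nb K u w s t k l m n hm a b c d) (hk : 1 ≤ k) {qC : ℕ → N.V}
    (hC : Line N.G S m qC) (hsC : seg qC m = nb '' Set.range c) (hC0 : qC 0 = u)
    (hC1 : qC (m + 1) = s) (hz : qC 1 = nb (c ⟨m - 1, last_lt hm⟩)) :
    ∃ qA qB qD, Theta N.G S u w s t (N.leaf (c ⟨m - 1, last_lt hm⟩)) k l m n qA qB qC qD := by
  obtain ⟨qA, hA, hsA, hA0, hA1⟩ := h.abline hk a h.ai h.aK h.cha h.hA
  obtain ⟨qD, hD, hsD, hD0, hD1⟩ := h.dline hC hsC hC0 hC1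
  obtain ⟨qB, hB, hsB, hB0, hB1⟩ := h.bline hk hC hsC hC0 hC1 hA hsA hA0 hA1 hD hsD hD0 hD1
  have dAB := segdisj h.ctx hsA hsB h.aK h.ab
  have dAC := segdisj h.ctx hsA hsC h.aK h.ac
  have dAD := segdisj h.ctx hsA hsD h.aK h.ad
  have dBC := segdisj h.ctx hsB hsC h.bK h.bc
  have dBD := segdisj h.ctx hsB hsD h.bK h.bd
  have dCD := segdisj h.ctx hsC hsD h.cK h.cd
  have tC : t ∉ seg qC m := notseg hsC (fun i => h.nbt _ (h.cK i))
  have tA : t ∉ seg qA k := notseg hsA (fun i => h.nbt _ (h.aK i))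
  have tD : t ∉ seg qD n := notseg hsD (fun i => h.nbt _ (h.dK i))
  have sA : s ∉ seg qA k := notseg hsA (fun i => h.nbs _ (h.aK i))
  have sD : s ∉ seg qD n := notseg hsD (fun i => h.nbs _ (h.dK i))
  have uA : u ∉ seg qA k := notseg hsA (fun i => h.nbu _ (h.aK i))
  have uB : u ∉ seg qB l := notseg hsB (fun i => h.nbu _ (h.bK i))
  have zz : ∀ v, v ∈ H.verts → N.leaf (c ⟨m - 1, last_lt hm⟩) ≠ v := fun v hv e =>
    h.ctx.leafnot _ (e ▸ hv)
  have zseg : ∀ {r : ℕ} {q : ℕ → N.V} {f : Fin r → X}, seg q r = nb '' Set.range f →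
      (∀ i, f i ∈ K) → N.leaf (c ⟨m - 1, last_lt hm⟩) ∉ seg q r := fun hs hf =>
    notseg hs (fun i e => zz _ (h.ctx.nbH _ (hf i)) e.symm)
  have AB1 : qA 1 ≠ qB 1 := by
    intro e
    by_cases hl : l = 0
    · subst hl; rw [zero_add] at hB1; exact tA (hB1 ▸ e ▸ segfirst hk qA)
    · exact Set.disjoint_left.1 dAB (segfirst hk qA) (e ▸ segfirst (by omega) qB)
  have AC : qC m ≠ qA 1 := fun e =>
    Set.disjoint_left.1 dAC (segfirst hk qA) (e ▸ seglast hm qC)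
  have CB : qC m ≠ qB 1 := by
    intro e
    by_cases hl : l = 0
    · subst hl; rw [zero_add] at hB1; exact tC (hB1 ▸ e ▸ seglast hm qC)
    · exact Set.disjoint_left.1 dBC (segfirst (by omega) qB) (e ▸ seglast hm qC)
  have sadj : ∀ {r : ℕ} {q : ℕ → N.V}, Line N.G S r q → q 0 = s → N.G.Adj s (q 1) := by
    intro r q hq e; have := hq.adj 0 (by omega); rwa [e] at this
  have tadj : ∀ {r : ℕ} {q : ℕ → N.V} {t : N.V}, Line N.G S r q → q (r + 1) = t →
      N.G.Adj t (q r) := by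
    intro r q t hq e; have := hq.adj r le_rfl; rw [e] at this; exact this.symm
  have ABk : qA k ≠ qB l := by
    intro e
    by_cases hl : l = 0
    · subst hl; exact sA (hB0 ▸ e ▸ seglast hk qA)
    · exact Set.disjoint_left.1 dAB (seglast hk qA) (e ▸ seglast (by omega) qB)
  have ADk : qA k ≠ qD n := by
    intro e
    by_cases hn : n = 0
    · subst hn; exact uA (hD0 ▸ e ▸ seglast hk qA)
    · exact Set.disjoint_left.1 dAD (seglast hk qA) (e ▸ seglast (by omega) qD)
  have BDk : qB l ≠ qD n := by
    intro e
    by_cases hl : l = 0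
    · subst hl
      by_cases hn : n = 0
      · subst hn; exact h.us (hD0.symm.trans (e.symm.trans hB0))
      · exact sD (hB0 ▸ e ▸ seglast (by omega) qD)
    · by_cases hn : n = 0
      · subst hn; exact uB (hD0 ▸ e ▸ seglast (by omega) qB)
      · exact Set.disjoint_left.1 dBD (seglast (by omega) qB) (e ▸ seglast (by omega) qD)
  exact ⟨qA, qB, qD,
    { A := hA, B := hB, C := hC, D := hD, A0 := hA0, A1 := hA1, B0 := hB0, B1 := hB1, C0 := hC0
      C1 := hC1, D0 := hD0, D1 := hD1
      z0S := h.ctx.SL _ (h.cK _)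
      z0adj := hz ▸ h.ctx.adjnb _
      z0nbr := fun v hv => hz ▸ h.ctx.uniq _ _ hv
      bd := h.bdry, wS := h.wS, uw := h.uw
      snbr := fun v hv => deg3_cover (h.ctx.deg3 _ h.sH) (tadj hC hC1) (sadj hA hA0) (sadj hB hB0)
        AC CB AB1 hv
      AB1 := AB1
      tnbr := fun v hv => deg3_cover (h.ctx.deg3 _ h.tH) (tadj hA hA1) (tadj hB hB1) (tadj hD hD1)
        ABk ADk BDk hv
      dAB := dAB, dAC := dAC, dAD := dAD, dBC := dBC, dBD := dBD, dCD := dCD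
      uA := uA, uB := uB, tC := tC, sD := sD
      zA := zseg hsA h.aK, zB := zseg hsB h.bK, zC := zseg hsC h.cK, zD := zseg hsD h.dK
      zs := zz _ h.sH, zt := zz _ h.tH, zu := zz _ h.uH }⟩

theorem Hyp.count (h : Hyp N H S nb K u w s t k l m n hm a b c d) (hk : 1 ≤ k) {x : N.V}
    (hx : x ∉ S) : pl N.G ∅ (N.leaf (c ⟨m - 1, last_lt hm⟩)) x =
      sh 3 (pl N.G S w x) + sh (l + m + n + 4) (pl N.G S w x)
      + sh (k + m + n + 4) (pl N.G S w x) := by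
  obtain ⟨qC, hC, hsC, hC0, hz, hC1 | hC1⟩ := h.cline
  · obtain ⟨qA, qB, qD, hT⟩ := h.theta' hk hC hsC hC0 hC1 hz
    exact hT.count hx hm
  · obtain ⟨qA, qB, qD, hT⟩ := h.swap.theta' hk hC hsC hC0 hC1 hz
    exact hT.count hx hm

end
end LabGraph

namespace LabGraph
open SimpleGraph Relation

section
variable {X : Type} {N : LabGraph X} {H : N.G.Subgraph}

theorem branch_all (hdeg : ∀ v ∈ H.verts, (N.G.neighborSet v).ncard = 3) {v y : N.V}
    (hv : v ∈ N.branchVerts H) (hy : N.G.Adj v y) : H.Adj v y := by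
  have := Set.eq_of_subset_of_ncard_le (H.neighborSet_subset v)
    (by rw [hdeg v hv.1]; exact hv.2) (Set.toFinite _)
  have hy' : y ∈ H.neighborSet v := by rw [this]; exact hy
  exact hy'

theorem branch_two (hT : N.TwoConnSub H) (hdeg : ∀ v ∈ H.verts, (N.G.neighborSet v).ncard = 3)
    (hr : N.BlobRank H 2) : (N.branchVerts H).ncard = 2 := by
  classical
  have hd : ∀ v : H.verts, H.coe.degree v = 2 + if v.1 ∈ N.branchVerts H then 1 else 0 := by
    intro v
    have e : H.coe.degree v = (H.neighborSet v.1).ncard := by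
      rw [Subgraph.coe_degree, Subgraph.degree, Set.ncard_eq_toFinset_card', Set.toFinset_card]
    have h3 : (H.neighborSet v.1).ncard ≤ 3 := by
      rw [← hdeg v.1 v.2]
      exact Set.ncard_le_ncard (H.neighborSet_subset v.1) (Set.toFinite _)
    have h2 : 2 ≤ (H.neighborSet v.1).ncard := by
      obtain ⟨g1, g2, hne, h1, h2⟩ := two_nbrs hT v.2
      rw [← Set.ncard_pair hne]
      exact Set.ncard_le_ncard (by rintro z (rfl | rfl); exacts [h1, h2]) (Set.toFinite _)
    rw [e]
    split_ifs with hb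
    · have := hb.2; omega
    · have : ¬ 3 ≤ (H.neighborSet v.1).ncard := fun h => hb ⟨v.2, h⟩
      omega
  have hs := H.coe.sum_degrees_eq_twice_card_edges
  have hs : ∑ v : H.verts, (2 + if v.1 ∈ N.branchVerts H then 1 else 0) =
      2 * H.coe.edgeFinset.card := by
    rw [← hs]
    exact Finset.sum_congr (by ext; simp) (fun v _ => by rw [← hd v]; congr!)
  rw [Finset.sum_add_distrib, Finset.sum_boole] at hs
  have hE : H.coe.edgeFinset.card = H.edgeSet.ncard := by
    rw [← Subgraph.image_coe_edgeSet_coe, Set.ncard_image_of_injective _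
      (Sym2.map.injective Subtype.val_injective), Set.ncard_eq_toFinset_card']
    congr 1
  have hV : Fintype.card H.verts = H.verts.ncard := by
    rw [Set.ncard_eq_toFinset_card', Set.toFinset_card]
  have hB : (Finset.univ.filter (fun v : H.verts => v.1 ∈ N.branchVerts H)).card =
      (N.branchVerts H).ncard := by
    rw [← Set.ncard_coe_finset, ← Set.ncard_image_of_injective _ Subtype.val_injective]
    congr 1
    ext v
    simp only [Set.mem_image, Finset.coe_filter, Finset.mem_univ, true_and, Set.mem_ofPred_eq]
    constructor
    · rintro ⟨z, hz, rfl⟩; exact hz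
    · intro hv; exact ⟨⟨v, hv.1⟩, hv, rfl⟩
  simp only [Finset.sum_const, Finset.card_univ, smul_eq_mul, Nat.cast_id] at hs
  rw [hB, hE, hV] at hs
  unfold BlobRank at hr
  omega

theorem side_adj {T : Set N.V} {p q : N.V} (h : H.Adj p q) (hp : p ∉ T) (hq : q ∉ T) :
    (H.deleteVerts T).Adj p q := by
  rw [Subgraph.deleteVerts_adj]
  exact ⟨h.fst_mem, hp, h.snd_mem, hq, h⟩

theorem same_adj {p q : N.V} (h : H.Adj p q) (hp : p ∉ N.branchVerts H)
    (hq : q ∉ N.branchVerts H) : N.SameSide H p q := by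
  have := side_adj h hp hq
  exact ⟨this.fst_mem, this.snd_mem, coe_reach' _ (ReflTransGen.single this)⟩

theorem SameSide.symm {p q : N.V} (h : N.SameSide H p q) : N.SameSide H q p := by
  obtain ⟨h1, h2, h3⟩ := h; exact ⟨h2, h1, h3.symm⟩

theorem SameSide.trans {p q r : N.V} (h : N.SameSide H p q) (h' : N.SameSide H q r) :
    N.SameSide H p r := by
  obtain ⟨h1, h2, h3⟩ := h; obtain ⟨h1', h2', h3'⟩ := h'; exact ⟨h1, h2', h3.trans h3'⟩

theorem sep_adj {u p q : N.V} (h : H.Adj p q) (hp : p ∉ N.branchVerts H)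
    (hq : q ∉ N.branchVerts H) (hpu : p ≠ u) (hqu : q ≠ u) : ¬ N.SepBy H u p q := by
  have := side_adj (T := N.branchVerts H ∪ {u}) h (by rintro (e | e); exacts [hp e, hpu e])
    (by rintro (e | e); exacts [hq e, hqu e])
  exact fun hn => hn ⟨this.fst_mem, this.snd_mem, coe_reach' _ (ReflTransGen.single this)⟩

theorem net_deg [Fintype X] (hN : N.IsNetwork) (hT : N.TwoConnSub H) :
    Function.Injective N.leaf ∧ (∀ x : X, N.degOf (N.leaf x) = 1) ∧
        ∀ v : N.V, v ∉ Set.range N.leaf → N.degOf v = 3 := by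
  refine ⟨hN.2.1, ?_⟩
  rcases hN.2.2 with ⟨_, h⟩ | h
  · have h3 := hT.1
    have := Set.ncard_le_card H.verts
    rw [Nat.card_eq_fintype_card, h] at this
    omega
  · exact h

theorem hyp_of_form [Fintype X] [DecidableEq X] (hN : N.IsNetwork) {k l m n : ℕ} (hm : 1 ≤ m)
    {a : Fin k → X} {b : Fin l → X} {c : Fin m → X} {d : Fin n → X} {u w : N.V}
    (hform : N.IsFormBlob H u w k l m n a b c d)
    (hclosest : N.ClosestToCut H u m c)
    (hw' : w ∉ H.verts ∪
      N.leaf '' (Set.range a ∪ Set.range b ∪ Set.range c ∪ Set.range d)) :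
    ∃ nb s t, Hyp N H (H.verts ∪
      N.leaf '' (Set.range a ∪ Set.range b ∪ Set.range c ∪ Set.range d)) nb
      (Set.range a ∪ Set.range b ∪ Set.range c ∪ Set.range d) u w s t k l m n hm a b c d := by
  obtain ⟨hpend, hrank, hcut, hntriv, huH, hwH, -, -, -, -, ai, bi, ci, di, ab, ac, ad, bc, bd, cd,
    hleaf, cha, chb, chc, chd, sab, sau, sbu, scu, sdu, scd⟩ := hform
  obtain ⟨hblob, huniq⟩ := hpend
  have hT := hblob.1
  obtain ⟨linj, ld1, ld3⟩ := net_deg hN hT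
  have hnb : ∀ x, ∃ v, N.G.neighborSet (N.leaf x) = {v} := fun x => Set.ncard_eq_one.1 (ld1 x)
  choose nb hnb using hnb
  have adjnb : ∀ x, N.G.Adj (N.leaf x) (nb x) := fun x => by
    have : nb x ∈ N.G.neighborSet (N.leaf x) := by rw [hnb]; rfl
    exact this
  have uniq : ∀ x v, N.G.Adj (N.leaf x) v → v = nb x := fun x v hv => by
    have : v ∈ N.G.neighborSet (N.leaf x) := hv
    rwa [hnb] at this
  have leafnot : ∀ x, N.leaf x ∉ H.verts := fun x hx => by
    obtain ⟨g1, g2, hne, h1, h2⟩ := two_nbrs hT hx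
    exact hne ((uniq _ _ h1.adj_sub).trans (uniq _ _ h2.adj_sub).symm)
  have deg3 : ∀ v ∈ H.verts, (N.G.neighborSet v).ncard = 3 := fun v hv =>
    ld3 v (by rintro ⟨x, rfl⟩; exact leafnot x hv)
  set K := Set.range a ∪ Set.range b ∪ Set.range c ∪ Set.range d with hKdef
  have hKiff : ∀ x, N.LeafInBlob x H ↔ x ∈ K := by
    intro x; rw [hleaf x, hKdef]; simp only [Set.mem_union]; tauto
  have ctx : Ctx N H (H.verts ∪ N.leaf '' K) nb K :=
    { two := hT, deg3 := deg3, adjnb := adjnb, uniq := uniq, leafnot := leafnot, leafinj := linj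
      nbH := fun x hx => by
        obtain ⟨v, h1, h2⟩ := (hKiff x).2 hx
        rwa [uniq x v h1] at h2
      SH := Set.subset_union_left
      SL := fun x hx => Or.inr ⟨x, hx, rfl⟩ }
  have aK : ∀ i, a i ∈ K := fun i => Or.inl (Or.inl (Or.inl ⟨i, rfl⟩))
  have bK : ∀ i, b i ∈ K := fun i => Or.inl (Or.inl (Or.inr ⟨i, rfl⟩))
  have cK : ∀ i, c i ∈ K := fun i => Or.inl (Or.inr ⟨i, rfl⟩)
  have dK : ∀ i, d i ∈ K := fun i => Or.inr ⟨i, rfl⟩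
  have hK : ∀ x, x ∈ K → (∃ i, a i = x) ∨ (∃ i, b i = x) ∨ (∃ i, c i = x) ∨ (∃ i, d i = x) := by
    rintro x (((h | h) | h) | h)
    · exact Or.inl h
    · exact Or.inr (Or.inl h)
    · exact Or.inr (Or.inr (Or.inl h))
    · exact Or.inr (Or.inr (Or.inr h))
  obtain ⟨s, t, hst, hBr⟩ := Set.ncard_eq_two.1 (branch_two hT deg3 hrank)
  have hsB : s ∈ N.branchVerts H := by rw [hBr]; simp
  have htB : t ∈ N.branchVerts H := by rw [hBr]; simp
  have huB : u ∉ N.branchVerts H := fun h => hwH (branch_all deg3 h hcut.1).snd_mem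
  have hnB : ∀ x, nb x ∉ N.branchVerts H := fun x h =>
    leafnot x (branch_all deg3 h (adjnb x).symm).snd_mem
  have hBr' : ∀ v, v ∈ N.branchVerts H → v = s ∨ v = t := fun v hv => by rwa [hBr] at hv
  have hnu : ∀ x, nb x ≠ u := by
    intro x e
    have h1 := (adjnb x).symm
    rw [e] at h1
    rcases ctx.nbr huH hwH hcut.1 h1 with h | h
    · exact hntriv ⟨x, by rw [h]; exact Sym2.mem_mk_right _ _⟩
    · exact leafnot x h.snd_mem
  have cover : ∀ v ∈ H.verts, v ∈ N.branchVerts H ∨ v = u ∨ ∃ x ∈ K, v = nb x := by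
    intro v hv
    by_contra hcon
    push Not at hcon
    obtain ⟨hvB, hvu, hvx⟩ := hcon
    have : ∃ v', N.G.Adj v v' ∧ ¬ H.Adj v v' := by
      by_contra hcon
      push Not at hcon
      refine hvB ⟨hv, ?_⟩
      rw [← deg3 v hv]
      exact Set.ncard_le_ncard (fun y hy => hcon y hy) (Set.toFinite _)
    obtain ⟨v', ha, hna⟩ := this
    obtain ⟨g1, g2, hne, h1, h2⟩ := two_nbrs hT hv
    have hce := blob_bridge hblob hv ha hna (fun y hy hyv => by
      rcases deg3_cover (deg3 v hv) h1.adj_sub h2.adj_sub ha hne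
        (by rintro rfl; exact hna h1) (by rintro rfl; exact hna h2) hy with rfl | rfl | rfl
      · exact h1
      · exact h2
      · exact absurd rfl hyv)
    by_cases htr : N.TrivialEdge s(v, v')
    · obtain ⟨x, hx⟩ := htr
      rw [Sym2.mem_iff] at hx
      rcases hx with rfl | rfl
      · exact leafnot x hv
      · exact hvx x ((hKiff x).1 ⟨v, ha.symm, hv⟩) (uniq x v ha.symm)
    · have := huniq.unique ⟨hce, htr, v, hv, Sym2.mem_mk_left _ _⟩
        ⟨hcut, hntriv, u, huH, Sym2.mem_mk_left _ _⟩
      rw [Sym2.eq_iff] at this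
      rcases this with ⟨e, _⟩ | ⟨e, _⟩
      · exact hvu e
      · exact hwH (e ▸ hv)
  have sa : ∀ i, ¬ N.SameSide H (nb (a i)) u := fun i => sau i _ (adjnb _)
  have sb : ∀ i, ¬ N.SameSide H (nb (b i)) u := fun i => sbu i _ (adjnb _)
  have sc : ∀ i, N.SameSide H (nb (c i)) u := fun i => scu i _ (adjnb _)
  have sd : ∀ i, N.SameSide H (nb (d i)) u := fun i => sdu i _ (adjnb _)
  have hC : ∀ i v, H.Adj (nb (c i)) v → v = s ∨ v = t ∨ v = u ∨ ∃ j, v = nb (c j) := by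
    intro i v hv
    rcases cover v hv.snd_mem with h | h | ⟨x, hx, rfl⟩
    · rcases hBr' v h with h | h <;> simp [h]
    · simp [h]
    · have hs := same_adj hv (hnB _) (hnB _)
      rcases hK x hx with ⟨j, rfl⟩ | ⟨j, rfl⟩ | ⟨j, rfl⟩ | ⟨j, rfl⟩
      · exact absurd (hs.symm.trans (sc i)) (sa j)
      · exact absurd (hs.symm.trans (sc i)) (sb j)
      · exact Or.inr (Or.inr (Or.inr ⟨j, rfl⟩))
      · exact absurd (scd i j _ _ (adjnb _) (adjnb _)) (sep_adj hv (hnB _) (hnB _) (hnu _) (hnu _))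
  have hD : ∀ i v, H.Adj (nb (d i)) v → v = s ∨ v = t ∨ v = u ∨ ∃ j, v = nb (d j) := by
    intro i v hv
    rcases cover v hv.snd_mem with h | h | ⟨x, hx, rfl⟩
    · rcases hBr' v h with h | h <;> simp [h]
    · simp [h]
    · have hs := same_adj hv (hnB _) (hnB _)
      rcases hK x hx with ⟨j, rfl⟩ | ⟨j, rfl⟩ | ⟨j, rfl⟩ | ⟨j, rfl⟩
      · exact absurd (hs.symm.trans (sd i)) (sa j)
      · exact absurd (hs.symm.trans (sd i)) (sb j)
      · exact absurd (scd j i _ _ (adjnb _) (adjnb _))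
          (sep_adj hv.symm (hnB _) (hnB _) (hnu _) (hnu _))
      · exact Or.inr (Or.inr (Or.inr ⟨j, rfl⟩))
  have hA : ∀ i v, H.Adj (nb (a i)) v → v = s ∨ v = t ∨ ∃ j, v = nb (a j) := by
    intro i v hv
    rcases cover v hv.snd_mem with h | h | ⟨x, hx, rfl⟩
    · rcases hBr' v h with h | h <;> simp [h]
    · subst h; exact absurd (same_adj hv (hnB _) huB) (sa i)
    · have hs := same_adj hv (hnB _) (hnB _)
      rcases hK x hx with ⟨j, rfl⟩ | ⟨j, rfl⟩ | ⟨j, rfl⟩ | ⟨j, rfl⟩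
      · exact Or.inr (Or.inr ⟨j, rfl⟩)
      · exact absurd hs (sab i j _ _ (adjnb _) (adjnb _))
      · exact absurd (hs.trans (sc j)) (sa i)
      · exact absurd (hs.trans (sd j)) (sa i)
  have hB : ∀ i v, H.Adj (nb (b i)) v → v = s ∨ v = t ∨ ∃ j, v = nb (b j) := by
    intro i v hv
    rcases cover v hv.snd_mem with h | h | ⟨x, hx, rfl⟩
    · rcases hBr' v h with h | h <;> simp [h]
    · subst h; exact absurd (same_adj hv (hnB _) huB) (sb i)
    · have hs := same_adj hv (hnB _) (hnB _)
      rcases hK x hx with ⟨j, rfl⟩ | ⟨j, rfl⟩ | ⟨j, rfl⟩ | ⟨j, rfl⟩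
      · exact absurd hs.symm (sab j i _ _ (adjnb _) (adjnb _))
      · exact Or.inr (Or.inr ⟨j, rfl⟩)
      · exact absurd (hs.trans (sc j)) (sb i)
      · exact absurd (hs.trans (sd j)) (sb i)
  have hCu : H.Adj (nb (c ⟨m - 1, last_lt hm⟩)) u := by
    obtain ⟨hp, hu, hr⟩ := hclosest hm _ (adjnb _)
    rcases ReflTransGen.cases_head (coe_reach _ hr) with e | ⟨v, hv, _⟩
    · exact absurd e (hnu _)
    · rw [Subgraph.deleteVerts_adj] at hv
      obtain ⟨_, _, _, hvT, hv⟩ := hv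
      rw [Set.mem_union, not_or] at hvT
      rcases hC _ _ hv with e | e | e | ⟨j, e⟩
      · exact absurd (e ▸ hsB) hvT.1
      · exact absurd (e ▸ htB) hvT.1
      · exact e ▸ hv
      · exfalso
        by_cases hj : (j : ℕ) + 1 < m
        · exact hvT.2 ⟨j, hj, e ▸ adjnb _⟩
        · have : j = ⟨m - 1, last_lt hm⟩ := Fin.ext (by simp only; omega)
          rw [this] at e
          exact hv.ne e.symm
  have hDu : 1 ≤ n → ∃ j, H.Adj (nb (d j)) u := by
    intro hn
    by_contra hcon
    push Not at hcon
    obtain ⟨_, _, hr⟩ := sd ⟨0, hn⟩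
    have : ∀ z, ReflTransGen (H.deleteVerts (N.branchVerts H)).Adj (nb (d ⟨0, hn⟩)) z →
        ∃ j, z = nb (d j) := by
      intro z hz
      induction hz with
      | refl => exact ⟨_, rfl⟩
      | tail _ hbc ih =>
        obtain ⟨j, rfl⟩ := ih
        rw [Subgraph.deleteVerts_adj] at hbc
        obtain ⟨_, _, _, hvT, hv⟩ := hbc
        rcases hD _ _ hv with e | e | e | e
        · exact absurd (e ▸ hsB) hvT
        · exact absurd (e ▸ htB) hvT
        · exact absurd (e ▸ hv) (hcon j)
        · exact e
    obtain ⟨j, e⟩ := this u (coe_reach _ hr)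
    exact hnu _ e.symm
  have dis : ∀ {r r' : ℕ} {f : Fin r → X} {g : Fin r' → X}, Set.range f ∩ Set.range g = ∅ →
      ∀ i j, f i ≠ g j := by
    intro r r' f g h i j e
    have : f i ∈ Set.range f ∩ Set.range g := ⟨⟨i, rfl⟩, ⟨j, e.symm⟩⟩
    rw [h] at this; exact this
  exact ⟨nb, s, t,
    { ctx := ctx, hK := hK
      hS := by rintro v (h | ⟨x, hx, rfl⟩); exacts [Or.inl h, Or.inr ⟨x, hx, rfl⟩]
      aK := aK, bK := bK, cK := cK, dK := dK, ai := ai, bi := bi, ci := ci, di := di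
      ab := dis ab, ac := dis ac, ad := dis ad, bc := dis bc, bd := dis bd, cd := dis cd
      cha := cha, chb := chb, chc := chc, chd := chd, st := hst, sH := hsB.1, tH := htB.1
      sall := fun v => branch_all deg3 hsB
      tall := fun v => branch_all deg3 htB
      uH := huH
      us := fun e => huB (e ▸ hsB)
      ut := fun e => huB (e ▸ htB)
      uw := hcut.1, wS := hw'
      nbs := fun x _ e => hnB x (e ▸ hsB)
      nbt := fun x _ e => hnB x (e ▸ htB)
      nbu := fun x _ => hnu x
      cover := fun v hv => by
        rcases cover v hv with h | h | h
        · rcases hBr' v h with h | h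
          · exact Or.inl h
          · exact Or.inr (Or.inl h)
        · exact Or.inr (Or.inr (Or.inl h))
        · exact Or.inr (Or.inr (Or.inr h))
      hA := hA, hB := hB, hC := hC, hD := hD, hCu := hCu, hDu := hDu }⟩

end
end LabGraph

namespace LabGraph
open SimpleGraph Relation

section
variable {X : Type} {N : LabGraph X}

theorem rep_h1 (A : Set X) (S : Set N.V) (w : N.V)
    (hmem : ∀ x : X, x ∉ A → N.leaf x ∉ S) (hw : w ∉ S) (a b : {v : N.V // v ∉ S}) :
    (N.blobReplace A S w hmem hw).G.Adj (Sum.inl a) (Sum.inl b) ↔ N.G.Adj a.1 b.1 := by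
  refine (SimpleGraph.fromRel_adj _ _ _).trans ?_
  constructor
  · rintro ⟨_, (⟨v1, v2, h1, h2, h⟩ | ⟨_, h⟩) | (⟨v1, v2, h1, h2, h⟩ | ⟨_, h⟩)⟩
    · cases h1; cases h2; exact h
    · cases h
    · cases h1; cases h2; exact h.symm
    · cases h
  · intro h
    refine ⟨fun e => h.ne ?_, Or.inl (Or.inl ⟨a, b, rfl, rfl, h⟩)⟩
    cases e; rfl

theorem rep_h2 (A : Set X) (S : Set N.V) (w : N.V)
    (hmem : ∀ x : X, x ∉ A → N.leaf x ∉ S) (hw : w ∉ S) (b : {v : N.V // v ∉ S}) :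
    (N.blobReplace A S w hmem hw).G.Adj (Sum.inr ()) (Sum.inl b) ↔ b = ⟨w, hw⟩ := by
  refine (SimpleGraph.fromRel_adj _ _ _).trans ?_
  constructor
  · rintro ⟨_, (⟨v1, v2, h1, h2, h⟩ | ⟨h, _⟩) | (⟨v1, v2, h1, h2, h⟩ | ⟨h, _⟩)⟩
    · cases h1
    · cases h
    · cases h2
    · cases h; rfl
  · rintro rfl
    exact ⟨fun e => (Sum.inr_ne_inl e).elim, Or.inr (Or.inr ⟨rfl, rfl⟩)⟩

theorem rep_reach {V : Type} {G : SimpleGraph V} {S : Set V}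
    {G' : SimpleGraph ({v : V // v ∉ S} ⊕ Unit)}
    (h1 : ∀ a b : {v : V // v ∉ S}, G'.Adj (Sum.inl a) (Sum.inl b) ↔ G.Adj a.1 b.1)
    {x y : V} (p : G.Walk x y) (hp : ∀ z ∈ p.support, z ∉ S) (hx : x ∉ S) (hy : y ∉ S) :
    G'.Reachable (Sum.inl ⟨x, hx⟩) (Sum.inl ⟨y, hy⟩) := by
  induction p with
  | nil => exact Reachable.refl _
  | cons h q ih =>
    rename_i a b c
    have hb : b ∉ S := hp b (by simp)
    exact ((h1 ⟨a, hx⟩ ⟨b, hb⟩).2 h).reachable.trans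
      (ih (fun z hz => hp z (by simp [hz])) hb hy)

theorem rep_net (hcon : N.G.Connected) (hinj : Function.Injective N.leaf)
    (hd1 : ∀ x : X, N.degOf (N.leaf x) = 1)
    (hd3 : ∀ v : N.V, v ∉ Set.range N.leaf → N.degOf v = 3)
    (A : Set X) (S : Set N.V) (w : N.V)
    (hmem : ∀ x : X, x ∉ A → N.leaf x ∉ S) (hw : w ∉ S) (hA : ∀ x ∈ A, N.leaf x ∈ S)
    [Fintype ({x : X // x ∉ A} ⊕ Unit)] {u : N.V} (huS : u ∈ S) (huw : N.G.Adj u w)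
    (bd : ∀ v ∈ S, ∀ f, f ∉ S → N.G.Adj v f → v = u ∧ f = w) :
    (N.blobReplace A S w hmem hw).IsNetwork := by
  have h1 := rep_h1 (N := N) A S w hmem hw
  have h2 := rep_h2 (N := N) A S w hmem hw
  set M := N.blobReplace A S w hmem hw with hM
  have hreach : ∀ v : {v : N.V // v ∉ S} ⊕ Unit, M.G.Reachable v (Sum.inr ()) := by
    rintro (⟨v, hv⟩ | v)
    · obtain ⟨p, hp⟩ := hcon.exists_isPath v w
      exact (rep_reach h1 p (path_avoid bd p hp hv hw) hv hw).trans
        ((h2 _).2 rfl).symm.reachable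
    · exact Reachable.refl _
  have hdeg : ∀ v : {v : N.V // v ∉ S}, M.degOf (Sum.inl v) = N.degOf v.1 := by
    intro v
    let φ : {v : N.V // v ∉ S} ⊕ Unit → N.V := Sum.elim (fun a => a.1) (fun _ => u)
    have hφ : Function.Injective φ := by
      rintro (a | a) (b | b) h
      · exact congrArg _ (Subtype.ext h)
      · exact absurd huS (by have h : a.1 = u := h; rw [← h]; exact a.2)
      · exact absurd huS (by have h : u = b.1 := h; rw [h]; exact b.2)
      · rfl
    have himg : N.G.neighborSet v.1 = φ '' (M.G.neighborSet (Sum.inl v)) := by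
      ext y
      constructor
      · intro hy
        by_cases hyS : y ∈ S
        · obtain ⟨rfl, e⟩ := bd y hyS v.1 v.2 (SimpleGraph.Adj.symm hy)
          exact ⟨Sum.inr (), ((h2 v).2 (Subtype.ext e)).symm, rfl⟩
        · exact ⟨Sum.inl ⟨y, hyS⟩, (h1 v ⟨y, hyS⟩).2 hy, rfl⟩
      · rintro ⟨b | b, hb, rfl⟩
        · exact (h1 v b).1 hb
        · have := (h2 v).1 (SimpleGraph.Adj.symm hb)
          rw [this]; exact huw.symm
    unfold degOf
    rw [himg]
    exact (Set.ncard_image_of_injective _ hφ).symm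
  refine ⟨?_, ?_, Or.inr ⟨?_, ?_⟩⟩
  · have : Nonempty M.V := ⟨(Sum.inr () : {v : N.V // v ∉ S} ⊕ Unit)⟩
    exact ⟨fun x y => (hreach x).trans (hreach y).symm⟩
  · rintro (x | x) (y | y) h
    · have h : (Sum.inl ⟨N.leaf x.1, hmem x.1 x.2⟩ : {v : N.V // v ∉ S} ⊕ Unit) =
        Sum.inl ⟨N.leaf y.1, hmem y.1 y.2⟩ := h
      simp only [Sum.inl.injEq, Subtype.mk.injEq] at h
      exact congrArg _ (Subtype.ext (hinj h))
    · cases h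
    · cases h
    · rfl
  · rintro (x | x)
    · exact (hdeg ⟨N.leaf x.1, hmem x.1 x.2⟩).trans (hd1 x.1)
    · show (M.G.neighborSet (Sum.inr ())).ncard = 1
      rw [Set.ncard_eq_one]
      refine ⟨(Sum.inl ⟨w, hw⟩ : {v : N.V // v ∉ S} ⊕ Unit), ?_⟩
      ext (b | b)
      · exact (h2 b).trans ⟨fun e => congrArg _ e, fun e => Sum.inl.inj e⟩
      · constructor
        · intro hb; exact absurd hb M.G.irrefl
        · intro hb; cases hb
  · rintro (v | v) hv
    · rw [hdeg v]
      apply hd3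
      rintro ⟨x, hx⟩
      have hxA : x ∉ A := fun h => v.2 (hx ▸ hA x h)
      refine hv ⟨Sum.inl ⟨x, hxA⟩, ?_⟩
      show (Sum.inl ⟨N.leaf x, _⟩ : {v : N.V // v ∉ S} ⊕ Unit) = Sum.inl v
      exact congrArg _ (Subtype.ext hx)
    · exact absurd ⟨Sum.inr (), rfl⟩ hv

end

/-- Lemma 11 (reduction of the remaining pendant level-2 blob forms): let `H` be a
pendant level-2 blob of one of the forms `(k,0,m,0)`, `(k,l,m,0)`, `(k,0,m,n)`,
`(k,l,m,n)` (`k, m ≥ 1`; below `l, n ≥ 0` uniformly cover the four cases, the stated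
shifts specialising to `m+3, l+m+3, m+n+3, l+m+n+3` and `k+m+3, k+m+3, k+m+n+3,
k+m+n+3` respectively) with chains `a, b, c, d` and non-trivial cut-edge `uw`
(`u ∈ H`), where `c = (c_1, ..., c_m)` lies on the cut-edge side with `c_m` closest to
the cut-edge.  For every leaf `x` off the four chains, `d(x, c_m)` has a unique
partition into three equal-sized multisets `A, B, C` with
`A - 2 = B - (l+m+n+3) = C - (k+m+n+3)`; replacing the pendant blob by a new leaf `z`
(attached to `w`) yields a network `N'` whose multisets of distances are unchanged off
the chains and satisfy `d^{N'}(x, z) = A - 2`. -/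
theorem pendant_level2_blob_general_reduction
    (X : Type) [Fintype X] [DecidableEq X]
    (N : LabGraph X) (hN : N.IsNetwork) (hlev : N.IsLevel 2)
    (hblobs : N.TwoBlobs) (hleaves : N.AllLeavesInBlobs)
    (k l m n : ℕ) (hk : 1 ≤ k) (hm : 1 ≤ m)
    (a : Fin k → X) (b : Fin l → X) (c : Fin m → X) (d : Fin n → X)
    (H : N.G.Subgraph) (u w : N.V)
    (hform : N.IsFormBlob H u w k l m n a b c d)
    (hclosest : N.ClosestToCut H u m c)
    (hmem : ∀ x : X,
      x ∉ Set.range a ∪ Set.range b ∪ Set.range c ∪ Set.range d →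
      N.leaf x ∉ H.verts ∪
        N.leaf '' (Set.range a ∪ Set.range b ∪ Set.range c ∪ Set.range d))
    (hw' : w ∉ H.verts ∪
      N.leaf '' (Set.range a ∪ Set.range b ∪ Set.range c ∪ Set.range d)) :
    (∀ x : X, x ∉ Set.range a ∪ Set.range b ∪ Set.range c ∪ Set.range d →
      ∃! Q : Multiset ℕ × Multiset ℕ × Multiset ℕ,
        Q.1 + Q.2.1 + Q.2.2 = N.dms x (c ⟨m - 1, by omega⟩) ∧
        Multiset.card Q.1 = Multiset.card Q.2.1 ∧
        Multiset.card Q.1 = Multiset.card Q.2.2 ∧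
        zsub Q.1 2 = zsub Q.2.1 (l + m + n + 3) ∧
        zsub Q.1 2 = zsub Q.2.2 (k + m + n + 3)) ∧
    ∀ N' : LabGraph
        ({x : X // x ∉ Set.range a ∪ Set.range b ∪ Set.range c ∪ Set.range d} ⊕ Unit),
      N' = N.blobReplace (Set.range a ∪ Set.range b ∪ Set.range c ∪ Set.range d)
          (H.verts ∪
            N.leaf '' (Set.range a ∪ Set.range b ∪ Set.range c ∪ Set.range d))
          w hmem hw' →
      (N'.IsNetwork ∧
        (∀ (x y : X)
            (hx : x ∉ Set.range a ∪ Set.range b ∪ Set.range c ∪ Set.range d)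
            (hy : y ∉ Set.range a ∪ Set.range b ∪ Set.range c ∪ Set.range d),
          N'.dms (Sum.inl ⟨x, hx⟩) (Sum.inl ⟨y, hy⟩) = N.dms x y) ∧
        (∀ (x : X)
            (hx : x ∉ Set.range a ∪ Set.range b ∪ Set.range c ∪ Set.range d)
            (A B C : Multiset ℕ),
          A + B + C = N.dms x (c ⟨m - 1, by omega⟩) →
          Multiset.card A = Multiset.card B →
          Multiset.card A = Multiset.card C →
          zsub A 2 = zsub B (l + m + n + 3) →
          zsub A 2 = zsub C (k + m + n + 3) →
          toZ (N'.dms (Sum.inl ⟨x, hx⟩) (Sum.inr ())) = zsub A 2)) := by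
  obtain ⟨nb, s, t, hyp⟩ := hyp_of_form hN hm hform hclosest hw'
  obtain ⟨hinj, hd1, hd3⟩ := net_deg hN hform.1.1.1
  have hbd := hyp.bdry
  have hcount : ∀ x, x ∉ Set.range a ∪ Set.range b ∪ Set.range c ∪ Set.range d →
      ∀ E, E = sh 1 (pl N.G (H.verts ∪
        N.leaf '' (Set.range a ∪ Set.range b ∪ Set.range c ∪ Set.range d)) w (N.leaf x)) →
      N.dms x (c ⟨m - 1, by omega⟩) =
        sh 2 E + sh (l + m + n + 1) (sh 2 E) + sh (k + m + n + 1) (sh 2 E) := by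
    rintro x hx E rfl
    rw [dms_eq_pl, pl_symm, hyp.count hk (hmem x hx)]
    simp only [sh_sh]
  have cl : ((l : ℤ) + m + n + 3) = ((l + m + n : ℕ) : ℤ) + 3 := by push_cast; ring
  have ck : ((k : ℤ) + m + n + 3) = ((k + m + n : ℕ) : ℤ) + 3 := by push_cast; ring
  have hfind : ∀ x, x ∉ Set.range a ∪ Set.range b ∪ Set.range c ∪ Set.range d →
      ∀ E, E = sh 1 (pl N.G (H.verts ∪
        N.leaf '' (Set.range a ∪ Set.range b ∪ Set.range c ∪ Set.range d)) w (N.leaf x)) →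
      ∀ A B C : Multiset ℕ, A + B + C = N.dms x (c ⟨m - 1, by omega⟩) →
          zsub A 2 = zsub B (l + m + n + 3) → zsub A 2 = zsub C (k + m + n + 3) →
          A = sh 2 E ∧ B = sh (l + m + n + 1) (sh 2 E) ∧ C = sh (k + m + n + 1) (sh 2 E) := by
    intro x hx E hE A B C hsum hB hC
    rw [cl] at hB
    rw [ck] at hC
    have hB := zsub_eq hB
    have hC := zsub_eq hC
    rw [hcount x hx E hE, hB, hC] at hsum
    have := sh_cancel (by omega) (by omega) hsum
    rw [this] at hB hC
    exact ⟨this, hB, hC⟩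
  refine ⟨fun x hx => ?_, ?_⟩
  · refine ⟨(sh 2 _, sh (l + m + n + 1) (sh 2 _), sh (k + m + n + 1) (sh 2 _)),
      ⟨(hcount x hx _ rfl).symm, ?_, ?_, ?_, ?_⟩, ?_⟩
    · simp only [card_sh]
    · simp only [card_sh]
    · rw [cl]; exact zsub_sh _ _
    · rw [ck]; exact zsub_sh _ _
    · rintro ⟨A, B, C⟩ ⟨hsum, _, _, hB, hC⟩
      obtain ⟨rfl, rfl, rfl⟩ := hfind x hx _ rfl A B C hsum hB hC
      rfl
  · rintro N' rfl
    refine ⟨?_, ?_, ?_⟩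
    · exact rep_net hN.1 hinj hd1 hd3 _ _ w hmem hw' (fun x hx => Or.inr ⟨x, hx, rfl⟩)
        (Or.inl hyp.uH) hyp.uw hbd
    · intro x y hx hy
      rw [dms_eq_pl, dms_eq_pl]
      exact pl_old_leaves hw' (rep_h1 _ _ w hmem hw') (rep_h2 _ _ w hmem hw') hbd
        ⟨N.leaf x, hmem x hx⟩ ⟨N.leaf y, hmem y hy⟩
    · intro x hx A B C hsum _ _ hB hC
      obtain ⟨rfl, -, -⟩ := hfind x hx _ rfl A B C hsum hB hC
      rw [zsub_sh2, dms_eq_pl, pl_symm]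
      congr 1
      exact pl_new_leaf hw' (rep_h1 _ _ w hmem hw') (rep_h2 _ _ w hmem hw')
        ⟨N.leaf x, hmem x hx⟩

end LabGraph
end

section
/- Let N be a level-2 phylogenetic network on a leaf set X = {x, y} with exactly two leaves. Then every blob of N is a level-2 blob incident to exactly two cut-edges, and d_m(x, y) = 3k + 1, where k is the number of blobs of N. -/
open SimpleGraph

namespace LabGraph

variable {X : Type} [Fintype X] [DecidableEq X]

section Aux

variable {V : Type} {G : SimpleGraph V}

/-- The graph with all bridges removed. -/
def NB (G : SimpleGraph V) : SimpleGraph V := G.deleteEdges {e | G.IsBridge e}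

/-- The vertex set of the bridgeless component of `c`. -/
def cmp (G : SimpleGraph V) (c : V) : Set V := {w | (NB G).Reachable c w}

/-- The side of `q` after the deletion of the edge `pq`. -/
def sd (G : SimpleGraph V) (p q : V) : Set V :=
  {w | (G.deleteEdges {s(p, q)}).Reachable q w}

/-- The ordered pairs forming an edge which leaves `C`. -/
def outs_s19 (G : SimpleGraph V) (C : Set V) : Set (V × V) :=
  {d | d.1 ∈ C ∧ d.2 ∉ C ∧ G.Adj d.1 d.2}

lemma nb_adj {u v : V} : (NB G).Adj u v ↔ G.Adj u v ∧ ¬ G.IsBridge s(u, v) := by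
  simp [NB]

lemma nb_le : NB G ≤ G := SimpleGraph.deleteEdges_le _

lemma nb_le_del {e : Sym2 V} (h : G.IsBridge e) : NB G ≤ G.deleteEdges {e} := by
  intro a b hab
  rw [nb_adj] at hab
  simp only [SimpleGraph.deleteEdges_adj, Set.mem_singleton_iff]
  exact ⟨hab.1, fun h' => hab.2 (h' ▸ h)⟩

lemma nb_adj_of_reach {u v : V} (h : G.Adj u v) (hr : (NB G).Reachable u v) :
    (NB G).Adj u v := by
  rw [nb_adj]
  refine ⟨h, fun hb => ?_⟩
  exact (SimpleGraph.isBridge_iff.1 hb) (hr.mono (nb_le_del hb))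

lemma exists_second {v a : V} (h : (NB G).Adj v a) :
    ∃ b, b ≠ a ∧ (NB G).Adj v b ∧ ∃ w : (NB G).Walk b a, v ∉ w.support := by
  classical
  rw [nb_adj] at h
  obtain ⟨hva, hb⟩ := h
  rw [SimpleGraph.isBridge_iff, not_not,
    SimpleGraph.reachable_deleteEdges_iff_exists_walk] at hb
  obtain ⟨p0, hp0⟩ := hb
  obtain ⟨p, hp, hpe⟩ : ∃ p : G.Walk v a, p.IsPath ∧ s(v, a) ∉ p.edges :=
    ⟨p0.bypass, p0.bypass_isPath, fun h => hp0 (p0.edges_bypass_subset_edges h)⟩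
  have hcyc : (SimpleGraph.Walk.cons hva.symm p).IsCycle := by
    rw [SimpleGraph.Walk.cons_isCycle_iff]
    exact ⟨hp, by rwa [Sym2.eq_swap]⟩
  have hnb : ∀ e ∈ p.edges, e ∈ (NB G).edgeSet := by
    intro e he
    induction e with | h s t =>
    rw [SimpleGraph.mem_edgeSet, nb_adj]
    refine ⟨p.adj_of_mem_edges he, fun hbr => ?_⟩
    exact hbr.notMem_edges_of_isCycle hcyc (by simp [he])
  cases p with
  | nil => exact absurd rfl hva.ne
  | @cons _ b _ hvb q =>
    rw [SimpleGraph.Walk.cons_isPath_iff] at hp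
    refine ⟨b, ?_, ?_, q.transfer (NB G) ?_, ?_⟩
    · rintro rfl
      exact hpe (by simp)
    · exact (SimpleGraph.mem_edgeSet _).1 (hnb s(v, b) (by simp))
    · intro e he
      exact hnb e (by simp [he])
    · simpa using hp.2

lemma mem_cmp_self (c : V) : c ∈ cmp G c := SimpleGraph.Reachable.refl c

lemma cmp_eq {c d : V} (h : d ∈ cmp G c) : cmp G d = cmp G c := by
  ext w
  exact ⟨fun hw => SimpleGraph.Reachable.trans h hw,
    fun hw => SimpleGraph.Reachable.trans (SimpleGraph.Reachable.symm h) hw⟩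

lemma outs_bridge {c p q : V} (h : (p, q) ∈ outs_s19 G (cmp G c)) : G.IsBridge s(p, q) := by
  obtain ⟨h1, h2, h3⟩ := h
  by_contra hb
  exact h2 (SimpleGraph.Reachable.trans h1 (nb_adj.2 ⟨h3, hb⟩).reachable)

/-- The side behind an edge leaving a component misses the component. -/
lemma sd_disj {c p q w : V} (h : (p, q) ∈ outs_s19 G (cmp G c)) (hw : w ∈ sd G p q) :
    w ∉ cmp G c := by
  intro hwc
  have hb := outs_bridge h
  have hpw : (NB G).Reachable p w := SimpleGraph.Reachable.trans (SimpleGraph.Reachable.symm h.1) hwc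
  exact (SimpleGraph.isBridge_iff.1 hb) ((hpw.mono (nb_le_del hb)).trans (SimpleGraph.Reachable.symm hw))

lemma sd_reach {c p q w r t : V} (h : (p, q) ∈ outs_s19 G (cmp G c)) (hw : w ∈ sd G p q)
    (hr : r ∈ cmp G c) : (G.deleteEdges {s(r, t)}).Reachable q w := by
  classical
  obtain ⟨P, hP⟩ := SimpleGraph.reachable_deleteEdges_iff_exists_walk.1 hw
  rw [SimpleGraph.reachable_deleteEdges_iff_exists_walk]
  refine ⟨P, fun he => ?_⟩
  have hrs : r ∈ P.support := P.fst_mem_support_of_mem_edges he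
  refine sd_disj h (w := r) ?_ hr
  change (G.deleteEdges {s(p, q)}).Reachable q r
  rw [SimpleGraph.reachable_deleteEdges_iff_exists_walk]
  exact ⟨P.takeUntil r hrs, fun h' => hP (P.edges_takeUntil_subset_edges hrs h')⟩

/-- From inside a component, leaving by another edge than `rt`. -/
lemma sd_reach' {c p q w r t : V} (h : (p, q) ∈ outs_s19 G (cmp G c)) (hw : w ∈ sd G p q)
    (hr : r ∈ cmp G c) (ht : (r, t) ∈ outs_s19 G (cmp G c)) (hne : (p, q) ≠ (r, t)) :
    (G.deleteEdges {s(r, t)}).Reachable r w := by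
  have h1 := sd_reach (t := t) h hw hr
  have hpq : (G.deleteEdges {s(r, t)}).Adj p q := by
    simp only [SimpleGraph.deleteEdges_adj, Set.mem_singleton_iff]
    refine ⟨h.2.2, fun he => ?_⟩
    rw [Sym2.eq_iff] at he
    rcases he with ⟨rfl, rfl⟩ | ⟨rfl, rfl⟩
    · exact hne rfl
    · exact h.2.1 hr
  have hrp : (NB G).Reachable r p := SimpleGraph.Reachable.trans (SimpleGraph.Reachable.symm hr) h.1
  exact ((hrp.mono (nb_le_del (outs_bridge ht))).trans hpq.reachable).trans h1

lemma sd_disjoint {c p q r t w : V} (h : (p, q) ∈ outs_s19 G (cmp G c))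
    (ht : (r, t) ∈ outs_s19 G (cmp G c)) (hne : (p, q) ≠ (r, t)) (hw : w ∈ sd G p q)
    (hw' : w ∈ sd G r t) : False := by
  have h1 := sd_reach' h hw ht.1 ht hne
  exact (SimpleGraph.isBridge_iff.1 (outs_bridge ht)) (h1.trans (SimpleGraph.Reachable.symm hw'))

/-- The only edge leaving a side is the bridge. -/
lemma sd_boundary {p q a b : V} (ha : a ∈ sd G p q) (hb : b ∉ sd G p q) (hab : G.Adj a b)
    (hbr : G.IsBridge s(p, q)) : a = q ∧ b = p := by
  by_cases he : s(a, b) = s(p, q)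
  · rw [Sym2.eq_iff] at he
    rcases he with ⟨rfl, rfl⟩ | ⟨rfl, rfl⟩
    · exact absurd (SimpleGraph.Reachable.refl _) hb
    · exact ⟨rfl, rfl⟩
  · exfalso
    apply hb
    have : (G.deleteEdges {s(p, q)}).Adj a b := by
      simp only [SimpleGraph.deleteEdges_adj, Set.mem_singleton_iff]
      exact ⟨hab, he⟩
    exact SimpleGraph.Reachable.trans ha this.reachable

lemma leaf_cmp {v : V} (h : (G.neighborSet v).ncard = 1) : cmp G v = {v} := by
  have hno : ∀ a, ¬ (NB G).Adj v a := by
    intro a ha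
    obtain ⟨b, hba, hb, -⟩ := exists_second ha
    obtain ⟨z, hz⟩ := Set.ncard_eq_one.1 h
    have h1 : a ∈ G.neighborSet v := nb_le ha
    have h2 : b ∈ G.neighborSet v := nb_le hb
    rw [hz] at h1 h2
    exact hba (h2.trans h1.symm)
  ext w
  constructor
  · rintro ⟨P⟩
    cases P with
    | nil => rfl
    | cons h' _ => exact absurd h' (hno _)
  · rintro rfl
    exact mem_cmp_self _

/-- In a subcubic graph a component minus a vertex stays connected. -/
lemma cmp_avoid [Finite V] {c v a b : V} (h3 : (G.neighborSet v).ncard ≤ 3)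
    (hv : v ∈ cmp G c) (ha : a ∈ cmp G c) (hb : b ∈ cmp G c) (hav : a ≠ v) (hbv : b ≠ v) :
    ∃ w : (NB G).Walk a b, v ∉ w.support := by
  classical
  let R : V → V → Prop := fun a b => ∃ w : (NB G).Walk a b, v ∉ w.support
  have symm : ∀ {a b}, R a b → R b a := fun ⟨w, hw⟩ => ⟨w.reverse, by simpa using hw⟩
  have trans : ∀ {a b c}, R a b → R b c → R a c := fun ⟨w, hw⟩ ⟨w', hw'⟩ =>
    ⟨w.append w', by simp [SimpleGraph.Walk.mem_support_append_iff, hw, hw']⟩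
  have start : ∀ d, d ∈ cmp G c → d ≠ v → ∃ n, (NB G).Adj v n ∧ R n d := by
    intro d hd hdv
    obtain ⟨P⟩ : (NB G).Reachable v d :=
      SimpleGraph.Reachable.trans (SimpleGraph.Reachable.symm hv) hd
    have hP := P.bypass_isPath
    generalize P.bypass = Q at hP
    cases Q with
    | nil => exact absurd rfl hdv
    | cons h q =>
      rw [SimpleGraph.Walk.cons_isPath_iff] at hP
      exact ⟨_, h, q, hP.2⟩
  have nbrs : ∀ m n, (NB G).Adj v m → (NB G).Adj v n → R m n := by
    intro m n hm hn
    obtain ⟨m', hm1, hm2, hm3⟩ := exists_second hm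
    obtain ⟨n', hn1, hn2, hn3⟩ := exists_second hn
    have hm3 : R m' m := hm3
    have hn3 : R n' n := hn3
    by_contra hmn
    have rf : R m m := trans (symm hm3) hm3
    have e1 : m ≠ n := by rintro rfl; exact hmn rf
    have e2 : m' ≠ n := by rintro rfl; exact hmn (symm hm3)
    have e3 : n' ≠ m := by rintro rfl; exact hmn hn3
    have e4 : m' ≠ n' := by rintro rfl; exact hmn (trans (symm hm3) hn3)
    have hsub : (↑({m, n, m', n'} : Finset V) : Set V) ⊆ G.neighborSet v := by
      intro z hz
      simp only [Finset.coe_insert, Finset.coe_singleton, Set.mem_insert_iff,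
        Set.mem_singleton_iff] at hz
      rcases hz with rfl | rfl | rfl | rfl
      · exact nb_le hm
      · exact nb_le hn
      · exact nb_le hm2
      · exact nb_le hn2
    have hle := Set.ncard_le_ncard hsub (Set.toFinite _)
    rw [Set.ncard_coe_finset] at hle
    have : ({m, n, m', n'} : Finset V).card = 4 := by
      rw [Finset.card_insert_of_notMem, Finset.card_insert_of_notMem,
        Finset.card_insert_of_notMem, Finset.card_singleton]
      · simpa using e4
      · simp [e2.symm, hn1.symm]
      · simp [e1, hm1.symm, e3.symm]
    omega
  obtain ⟨m, hm, hma⟩ := start a ha hav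
  obtain ⟨n, hn, hnb⟩ := start b hb hbv
  exact trans (symm hma) (trans (nbrs m n hm hn) hnb)

lemma induce_connected {S : Set V} (hne : S.Nonempty)
    (h : ∀ a ∈ S, ∀ b ∈ S, ∃ w : G.Walk a b, ∀ z ∈ w.support, z ∈ S) :
    ((⊤ : G.Subgraph).induce S).coe.Connected := by
  rw [← SimpleGraph.induce_eq_coe_induce_top]
  obtain ⟨z, hz⟩ := hne
  have : Nonempty S := ⟨⟨z, hz⟩⟩
  refine @SimpleGraph.Connected.mk _ _ ?_ this
  rintro ⟨a, ha⟩ ⟨b, hb⟩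
  obtain ⟨w, hw⟩ := h a ha b hb
  exact ⟨w.induce S hw⟩

lemma walk_in_cmp {c a b : V} (w : (NB G).Walk a b) (ha : a ∈ cmp G c) :
    ∀ z ∈ w.support, z ∈ cmp G c := by
  classical
  intro z hz
  exact SimpleGraph.Reachable.trans ha ⟨w.takeUntil z hz⟩

/-- A nontrivial component has at least three vertices. -/
lemma three_le_cmp [Finite V] {c : V} (h : cmp G c ≠ {c}) : 3 ≤ (cmp G c).ncard := by
  classical
  obtain ⟨a, ha⟩ : ∃ a, (NB G).Adj c a := by
    by_contra hno
    push Not at hno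
    apply h
    ext w
    constructor
    · rintro ⟨P⟩
      cases P with
      | nil => rfl
      | cons h' _ => exact absurd h' (hno _)
    · rintro rfl
      exact mem_cmp_self _
  obtain ⟨b, hba, hb, -⟩ := exists_second ha
  have hsub : (↑({c, a, b} : Finset V) : Set V) ⊆ cmp G c := by
    intro z hz
    simp only [Finset.coe_insert, Finset.coe_singleton, Set.mem_insert_iff,
      Set.mem_singleton_iff] at hz
    rcases hz with rfl | rfl | rfl
    · exact mem_cmp_self _
    · exact ha.reachable
    · exact hb.reachable
  have hle := Set.ncard_le_ncard hsub (Set.toFinite _)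
  rw [Set.ncard_coe_finset] at hle
  have : ({c, a, b} : Finset V).card = 3 := by
    rw [Finset.card_eq_three]
    exact ⟨c, a, b, ha.ne, hb.ne, hba.symm, rfl⟩
  omega

end Aux

lemma twoConn_cmp (N : LabGraph X) (h3 : ∀ v, (N.G.neighborSet v).ncard ≤ 3) {c : N.V}
    (hc : cmp N.G c ≠ {c}) : N.TwoConnSub ((⊤ : N.G.Subgraph).induce (cmp N.G c)) := by
  have h3c := three_le_cmp hc
  refine ⟨h3c, induce_connected ⟨c, mem_cmp_self c⟩ ?_, ?_⟩
  · intro a ha b hb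
    obtain ⟨w⟩ : (NB N.G).Reachable a b :=
      SimpleGraph.Reachable.trans (SimpleGraph.Reachable.symm ha) hb
    refine ⟨w.mapLe nb_le, ?_⟩
    simpa using walk_in_cmp w ha
  · intro v hv
    have heq : ((⊤ : N.G.Subgraph).induce (cmp N.G c)).deleteVerts {v} =
        (⊤ : N.G.Subgraph).induce (cmp N.G c \ {v}) := by
      ext a b
      · simp
      · simp
        tauto
    rw [heq]
    apply induce_connected
    · rw [Set.nonempty_iff_ne_empty]
      intro h0
      have h1 := Set.le_ncard_sdiff {v} (cmp N.G c)
      rw [h0] at h1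
      simp at h1
      omega
    · rintro a ⟨ha, hav⟩ b ⟨hb, hbv⟩
      obtain ⟨w, hw⟩ := cmp_avoid (h3 v) hv ha hb hav hbv
      refine ⟨w.mapLe nb_le, ?_⟩
      intro z hz
      have hz' : z ∈ w.support := by simpa using hz
      exact ⟨walk_in_cmp w ha z hz', by rintro rfl; exact hw hz'⟩

lemma twoConn_adj (N : LabGraph X) {H : N.G.Subgraph} (hH : N.TwoConnSub H) {u v : N.V}
    (huv : H.Adj u v) : (NB N.G).Adj u v := by
  classical
  rw [nb_adj]
  refine ⟨huv.adj_sub, ?_⟩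
  rw [SimpleGraph.isBridge_iff, not_not]
  obtain ⟨h3, -, hdel⟩ := hH
  obtain ⟨w, hw, hwu, hwv⟩ : ∃ w ∈ H.verts, w ≠ u ∧ w ≠ v := by
    by_contra hno
    push Not at hno
    have hsub : H.verts ⊆ {u, v} := by
      intro w hw
      by_cases h : w = u
      · simp [h]
      · simp [hno w hw h]
    have := Set.ncard_le_ncard hsub (Set.toFinite _)
    have := Set.ncard_pair huv.ne
    omega
  have key : ∀ a b : N.V, a ∈ H.verts → b ∈ H.verts → b ≠ a → w ≠ a → 
      (N.G.deleteEdges {s(a, b)}).Reachable b w := by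
    intro a b ha hb hba hwa
    have hconn := hdel a ha
    let f : (H.deleteVerts {a}).coe →g (N.G.deleteEdges {s(a, b)}) :=
      { toFun := fun z => z.1
        map_rel' := by
          rintro ⟨s, hs⟩ ⟨t, ht⟩ hst
          have hst' : (H.deleteVerts {a}).Adj s t := hst
          rw [SimpleGraph.Subgraph.deleteVerts_adj] at hst'
          simp only [SimpleGraph.deleteEdges_adj, Set.mem_singleton_iff, Sym2.eq_iff]
          refine ⟨hst'.2.2.2.2.adj_sub, ?_⟩
          rintro (⟨h, -⟩ | ⟨-, h⟩)
          · exact hst'.2.1 h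
          · exact hst'.2.2.2.1 h }
    have := hconn.preconnected ⟨b, hb, hba⟩ ⟨w, hw, hwa⟩
    exact this.map f
  have k1 := key u v huv.fst_mem huv.snd_mem huv.ne.symm hwu
  have k2 := key v u huv.snd_mem huv.fst_mem huv.ne hwv
  rw [Sym2.eq_swap] at k2
  exact k2.trans k1.symm

lemma twoConn_sub (N : LabGraph X) {H : N.G.Subgraph} (hH : N.TwoConnSub H) {c : N.V}
    (hc : c ∈ H.verts) : H.verts ⊆ cmp N.G c := by
  intro w hw
  have := hH.2.1.preconnected ⟨c, hc⟩ ⟨w, hw⟩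
  let f : H.coe →g NB N.G :=
    { toFun := fun z => z.1
      map_rel' := fun {s t} hst => twoConn_adj N hH hst }
  exact this.map f

lemma le_induce {V : Type} {G : SimpleGraph V} {H : G.Subgraph} {S : Set V} (h : H.verts ⊆ S) :
    H ≤ (⊤ : G.Subgraph).induce S := by
  refine ⟨h, ?_⟩
  intro a b hab
  simp [h hab.fst_mem, h hab.snd_mem, hab.adj_sub]

lemma cmp_ne_of_twoConn (N : LabGraph X) {H : N.G.Subgraph} (hH : N.TwoConnSub H) {c : N.V}
    (hc : c ∈ H.verts) : cmp N.G c ≠ {c} := by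
  intro h
  have h1 := twoConn_sub N hH hc
  rw [h] at h1
  have h2 := Set.ncard_le_ncard h1 (Set.toFinite _)
  have h4 := hH.1
  rw [Set.ncard_singleton] at h2
  omega

lemma blob_cmp (N : LabGraph X) (h3 : ∀ v, (N.G.neighborSet v).ncard ≤ 3) {c : N.V}
    (hc : cmp N.G c ≠ {c}) : N.IsBlob ((⊤ : N.G.Subgraph).induce (cmp N.G c)) := by
  refine ⟨twoConn_cmp N h3 hc, fun H' hH' hle => ?_⟩
  have hcH : c ∈ H'.verts := hle.1 (mem_cmp_self c)
  exact le_antisymm (le_induce (twoConn_sub N hH' hcH)) hle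

lemma blob_eq (N : LabGraph X) (h3 : ∀ v, (N.G.neighborSet v).ncard ≤ 3) {H : N.G.Subgraph}
    (hH : N.IsBlob H) {c : N.V} (hc : c ∈ H.verts) :
    H = (⊤ : N.G.Subgraph).induce (cmp N.G c) :=
  (hH.2 _ (twoConn_cmp N h3 (cmp_ne_of_twoConn N hH.1 hc))
    (le_induce (twoConn_sub N hH.1 hc))).symm

section Count

variable {V : Type} {G : SimpleGraph V}

lemma ncard_nbr [Fintype V] [DecidableRel G.Adj] (v : V) :
    (G.neighborSet v).ncard = ∑ b, if G.Adj v b then 1 else 0 := by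
  classical
  rw [Set.ncard_eq_toFinset_card', ← Finset.card_filter]
  congr 1
  ext b
  simp

lemma count_edges [Fintype V] (C : Set V) (h3 : ∀ v ∈ C, (G.neighborSet v).ncard = 3) :
    3 * C.ncard = 2 * ((⊤ : G.Subgraph).induce C).edgeSet.ncard + (outs_s19 G C).ncard := by
  classical
  set K := ((⊤ : G.Subgraph).induce C).spanningCoe with hK
  have hKadj : ∀ a b, K.Adj a b ↔ a ∈ C ∧ b ∈ C ∧ G.Adj a b := by
    intro a b
    simp [hK]
  have h1 : 2 * ((⊤ : G.Subgraph).induce C).edgeSet.ncard =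
      ∑ a, ∑ b, if (a ∈ C ∧ b ∈ C ∧ G.Adj a b) then 1 else 0 := by
    have : ((⊤ : G.Subgraph).induce C).edgeSet = K.edgeSet := by simp [hK]
    rw [this, Set.ncard_eq_toFinset_card', Set.toFinset_card, ← SimpleGraph.edgeFinset_card,
      ← SimpleGraph.sum_degrees_eq_twice_card_edges]
    refine Finset.sum_congr rfl fun a _ => ?_
    rw [← Finset.card_filter, ← SimpleGraph.card_neighborFinset_eq_degree]
    congr 1
    ext b
    simp [hKadj]
  have h2 : (outs_s19 G C).ncard =
      ∑ a, ∑ b, if (a ∈ C ∧ b ∉ C ∧ G.Adj a b) then 1 else 0 := by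
    rw [Set.ncard_eq_toFinset_card', ← Fintype.sum_prod_type'
      (f := fun a b => if (a ∈ C ∧ b ∉ C ∧ G.Adj a b) then 1 else 0), ← Finset.card_filter]
    congr 1
    ext d
    rw [Set.mem_toFinset]
    simp [outs_s19]
  have h4 : 3 * C.ncard = ∑ a, ∑ b, if (a ∈ C ∧ G.Adj a b) then 1 else 0 := by
    have : ∀ a, (∑ b, if (a ∈ C ∧ G.Adj a b) then 1 else 0) = if a ∈ C then 3 else 0 := by
      intro a
      by_cases ha : a ∈ C
      · simp only [ha, true_and, if_true]
        rw [← h3 a ha, ncard_nbr]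
      · simp [ha]
    simp_rw [this]
    rw [← Finset.sum_filter, Finset.sum_const, Set.ncard_eq_toFinset_card', smul_eq_mul, mul_comm]
    congr 2
    ext d
    simp
  rw [h1, h2, h4, ← Finset.sum_add_distrib]
  refine Finset.sum_congr rfl fun a _ => ?_
  rw [← Finset.sum_add_distrib]
  refine Finset.sum_congr rfl fun b _ => ?_
  by_cases ha : a ∈ C <;> by_cases hb : b ∈ C <;> by_cases hab : G.Adj a b <;> simp [ha, hb, hab]

lemma outs_small [Finite V] (C : Set V) (h3 : ∀ v ∈ C, (G.neighborSet v).ncard = 3)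
    (hC : C.ncard ≤ 3) : C.ncard ≤ (outs_s19 G C).ncard := by
  have hsub : C ⊆ Prod.fst '' outs_s19 G C := by
    intro v hv
    by_contra hno
    have hs : insert v (G.neighborSet v) ⊆ C := by
      rintro w (rfl | hw)
      · exact hv
      · by_contra hwC
        exact hno ⟨(v, w), ⟨hv, hwC, hw⟩, rfl⟩
    have h1 := Set.ncard_le_ncard hs (Set.toFinite _)
    rw [Set.ncard_insert_of_notMem (by simp) (Set.toFinite _), h3 v hv] at h1
    omega
  exact (Set.ncard_le_ncard hsub (Set.toFinite _)).trans (Set.ncard_image_le (Set.toFinite _))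

/-- The standing hypotheses: a connected graph, cubic except for two leaves, of level 2. -/
structure Net (G : SimpleGraph V) (x y : V) : Prop where
  conn : G.Connected
  ne : x ≠ y
  hx : (G.neighborSet x).ncard = 1
  hy : (G.neighborSet y).ncard = 1
  h3 : ∀ v, v ≠ x → v ≠ y → (G.neighborSet v).ncard = 3
  lev : ∀ c, cmp G c ≠ {c} →
    ((⊤ : G.Subgraph).induce (cmp G c)).edgeSet.ncard + 1 ≤ (cmp G c).ncard + 2

variable [Fintype V] {x y : V}

lemma Net.cmp_deg (h : Net G x y) {c : V} (hcx : c ≠ x) (hcy : c ≠ y) :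
    ∀ v ∈ cmp G c, v ≠ x ∧ v ≠ y ∧ (G.neighborSet v).ncard = 3 := by
  intro v hv
  have e := cmp_eq hv
  have hc : c ∈ cmp G v := e ▸ mem_cmp_self c
  have h1 : v ≠ x := by
    rintro rfl
    rw [leaf_cmp h.hx] at hc
    exact hcx hc
  have h2 : v ≠ y := by
    rintro rfl
    rw [leaf_cmp h.hy] at hc
    exact hcy hc
  exact ⟨h1, h2, h.h3 v h1 h2⟩

lemma Net.two_le (h : Net G x y) {c : V} (hcx : c ≠ x) (hcy : c ≠ y) :
    2 ≤ (outs_s19 G (cmp G c)).ncard := by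
  have hd : ∀ v ∈ cmp G c, (G.neighborSet v).ncard = 3 := fun v hv => (h.cmp_deg hcx hcy v hv).2.2
  have hcount := count_edges (cmp G c) hd
  by_cases hc : cmp G c = {c}
  · have h0 : (outs_s19 G (cmp G c)).ncard = 3 := by
      have h0 : ((⊤ : G.Subgraph).induce (cmp G c)).edgeSet = ∅ := by
        rw [Set.eq_empty_iff_forall_notMem]
        intro e
        induction e with | h a b =>
        rw [hc]
        simp only [SimpleGraph.Subgraph.mem_edgeSet, SimpleGraph.Subgraph.induce_adj,
          Set.mem_singleton_iff, SimpleGraph.Subgraph.top_adj]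
        rintro ⟨rfl, rfl, hab⟩
        exact hab.ne rfl
      rw [h0] at hcount
      have : (cmp G c).ncard = 1 := by rw [hc, Set.ncard_singleton]
      simp [this] at hcount
      omega
    omega
  · have h1 := h.lev c hc
    have h2 := three_le_cmp hc
    by_cases h4 : (cmp G c).ncard ≤ 3
    · have := outs_small _ hd h4
      omega
    · omega

/-- Every side of a bridge contains a leaf. -/
lemma Net.side_leaf (h : Net G x y) : ∀ (n : ℕ) (u v : V), (sd G u v).ncard ≤ n → G.Adj u v →
    G.IsBridge s(u, v) → x ∈ sd G u v ∨ y ∈ sd G u v := by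
  intro n
  induction n with
  | zero =>
    intro u v hn
    have : v ∈ sd G u v := SimpleGraph.Reachable.refl v
    have := (Set.ncard_pos (Set.toFinite _)).2 ⟨v, this⟩
    omega
  | succ n ih =>
    intro u v hn huv hb
    have hvv : v ∈ sd G u v := SimpleGraph.Reachable.refl v
    by_cases hvx : v = x
    · left; rwa [← hvx]
    by_cases hvy : v = y
    · right; rwa [← hvy]
    have h2 := h.two_le hvx hvy
    have hvu : (v, u) ∈ outs_s19 G (cmp G v) := by
      refine ⟨mem_cmp_self v, fun hu => ?_, huv.symm⟩
      exact (SimpleGraph.isBridge_iff.1 hb)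
        (SimpleGraph.Reachable.mono (nb_le_del hb) (SimpleGraph.Reachable.symm hu))
    obtain ⟨⟨p, q⟩, hpq, hne⟩ := Set.exists_ne_of_one_lt_ncard
      (s := outs_s19 G (cmp G v)) (by omega) (v, u)
    have hsub : sd G p q ⊆ sd G u v := by
      intro w hw
      have := sd_reach' hpq hw (mem_cmp_self v) hvu hne
      rw [Sym2.eq_swap] at this
      exact this
    have hp : p ∈ sd G u v := SimpleGraph.Reachable.mono (nb_le_del hb) hpq.1
    have hp' : p ∉ sd G p q := fun hp' => sd_disj hpq hp' hpq.1
    have hlt : (sd G p q).ncard < (sd G u v).ncard :=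
      Set.ncard_lt_ncard ⟨hsub, fun h' => hp' (h' hp)⟩ (Set.toFinite _)
    exact (ih p q (by omega) hpq.2.2 (outs_bridge hpq)).imp (fun h => hsub h) (fun h => hsub h)

lemma Net.out_leaf (h : Net G x y) {c p q : V} (hpq : (p, q) ∈ outs_s19 G (cmp G c)) :
    x ∈ sd G p q ∨ y ∈ sd G p q :=
  h.side_leaf _ p q le_rfl hpq.2.2 (outs_bridge hpq)

/-- Each non-leaf component has exactly two leaving edges, one towards each leaf. -/
lemma Net.exists_outs (h : Net G x y) {c : V} (hcx : c ≠ x) (hcy : c ≠ y) :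
    ∃ p q r t, (p, q) ≠ (r, t) ∧ outs_s19 G (cmp G c) = {(p, q), (r, t)} ∧
      x ∈ sd G p q ∧ y ∈ sd G r t ∧ y ∉ sd G p q ∧ x ∉ sd G r t := by
  have h2 := h.two_le hcx hcy
  obtain ⟨⟨p, q⟩, hpq, ⟨r, t⟩, hrt, hne⟩ := (Set.one_lt_ncard
    (s := outs_s19 G (cmp G c)) (Set.toFinite _)).1 (by omega)
  have only : ∀ p q r t, (p, q) ∈ outs_s19 G (cmp G c) → (r, t) ∈ outs_s19 G (cmp G c) →
      (p, q) ≠ (r, t) → x ∈ sd G p q → y ∈ sd G r t →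
      ∃ p q r t, (p, q) ≠ (r, t) ∧ outs_s19 G (cmp G c) = {(p, q), (r, t)} ∧
      x ∈ sd G p q ∧ y ∈ sd G r t ∧ y ∉ sd G p q ∧ x ∉ sd G r t := by
    intro p q r t hpq hrt hne hx hy
    refine ⟨p, q, r, t, hne, ?_, hx, hy, fun hy' => sd_disjoint hpq hrt hne hy' hy,
      fun hx' => sd_disjoint hpq hrt hne hx hx'⟩
    apply Set.Subset.antisymm
    · rintro ⟨a, b⟩ hab
      by_contra hno
      simp only [Set.mem_insert_iff, Set.mem_singleton_iff, not_or] at hno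
      rcases h.out_leaf hab with h' | h'
      · exact sd_disjoint hab hpq hno.1 h' hx
      · exact sd_disjoint hab hrt hno.2 h' hy
    · rintro d (rfl | rfl)
      · exact hpq
      · exact hrt
  rcases h.out_leaf hpq with h1 | h1
  · rcases h.out_leaf hrt with h2 | h2
    · exact (sd_disjoint hpq hrt hne h1 h2).elim
    · exact only p q r t hpq hrt hne h1 h2
  · rcases h.out_leaf hrt with h2 | h2
    · exact only r t p q hrt hpq hne.symm h2 h1
    · exact (sd_disjoint hpq hrt hne h1 h2).elim

lemma Net.sizes (h : Net G x y) {c : V} (hcx : c ≠ x) (hcy : c ≠ y) :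
    cmp G c ≠ {c} ∧ (cmp G c).ncard = 4 ∧
      ((⊤ : G.Subgraph).induce (cmp G c)).edgeSet.ncard = 5 := by
  have hd : ∀ v ∈ cmp G c, (G.neighborSet v).ncard = 3 := fun v hv => (h.cmp_deg hcx hcy v hv).2.2
  have hcount := count_edges (cmp G c) hd
  have h2 : (outs_s19 G (cmp G c)).ncard = 2 := by
    obtain ⟨p, q, r, t, hne, ho, -⟩ := h.exists_outs hcx hcy
    rw [ho, Set.ncard_pair hne]
  have hc : cmp G c ≠ {c} := by
    intro hc
    have h0 : ((⊤ : G.Subgraph).induce (cmp G c)).edgeSet = ∅ := by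
      rw [Set.eq_empty_iff_forall_notMem]
      intro e
      induction e with | h a b =>
      rw [hc]
      simp only [SimpleGraph.Subgraph.mem_edgeSet, SimpleGraph.Subgraph.induce_adj,
        Set.mem_singleton_iff, SimpleGraph.Subgraph.top_adj]
      rintro ⟨rfl, rfl, hab⟩
      exact hab.ne rfl
    have h1 : (cmp G c).ncard = 1 := by rw [hc, Set.ncard_singleton]
    rw [h0, h1, h2] at hcount
    simp at hcount
  have h1 := h.lev c hc
  have h3 := three_le_cmp hc
  refine ⟨hc, ?_, ?_⟩ <;> omega

end Count

section Dist

variable {V : Type} {G : SimpleGraph V} {x y : V}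

lemma shortest_step (P : G.Walk x y) (hP : P.length = G.dist x y) {i j : ℕ}
    (hj : j ≤ P.length) (hij : i ≤ j) (h : G.Adj (P.getVert i) (P.getVert j)) : j ≤ i + 1 := by
  have := SimpleGraph.dist_le ((P.take i).append (SimpleGraph.Walk.cons h (P.drop j)))
  simp only [SimpleGraph.Walk.length_append, SimpleGraph.Walk.length_cons,
    SimpleGraph.Walk.take_length, SimpleGraph.Walk.drop_length] at this
  omega

/-- A shortest path does not contain the three vertices of a triangle. -/
lemma no_triangle (P : G.Walk x y) (hP : P.length = G.dist x y) {u v w : V}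
    (hu : u ∈ P.support) (hv : v ∈ P.support) (hw : w ∈ P.support)
    (huv : G.Adj u v) (huw : G.Adj u w) (hvw : G.Adj v w) : False := by
  obtain ⟨i, rfl, hi⟩ := SimpleGraph.Walk.mem_support_iff_exists_getVert.1 hu
  obtain ⟨j, rfl, hj⟩ := SimpleGraph.Walk.mem_support_iff_exists_getVert.1 hv
  obtain ⟨k, rfl, hk⟩ := SimpleGraph.Walk.mem_support_iff_exists_getVert.1 hw
  have n1 : i ≠ j := by rintro rfl; exact huv.ne rfl
  have n2 : i ≠ k := by rintro rfl; exact huw.ne rfl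
  have n3 : j ≠ k := by rintro rfl; exact hvw.ne rfl
  have a1 : i ≤ j → j ≤ i + 1 := fun h => shortest_step P hP hj h huv
  have a2 : j ≤ i → i ≤ j + 1 := fun h => shortest_step P hP hi h huv.symm
  have a3 : i ≤ k → k ≤ i + 1 := fun h => shortest_step P hP hk h huw
  have a4 : k ≤ i → i ≤ k + 1 := fun h => shortest_step P hP hi h huw.symm
  have a5 : j ≤ k → k ≤ j + 1 := fun h => shortest_step P hP hk h hvw
  have a6 : k ≤ j → j ≤ k + 1 := fun h => shortest_step P hP hj h hvw.symm
  omega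

lemma four_nbrs [Finite V] {v a b c d : V} (h3 : (G.neighborSet v).ncard = 3)
    (ha : G.Adj v a) (hb : G.Adj v b) (hc : G.Adj v c) (hd : G.Adj v d) (hab : a ≠ b)
    (hac : a ≠ c) (had : a ≠ d) (hbc : b ≠ c) (hbd : b ≠ d) (hcd : c ≠ d) : False := by
  classical
  have hsub : (↑({a, b, c, d} : Finset V) : Set V) ⊆ G.neighborSet v := by
    intro z hz
    simp only [Finset.coe_insert, Finset.coe_singleton, Set.mem_insert_iff,
      Set.mem_singleton_iff] at hz
    rcases hz with rfl | rfl | rfl | rfl <;> assumption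
  have hle := Set.ncard_le_ncard hsub (Set.toFinite _)
  rw [Set.ncard_coe_finset] at hle
  have : ({a, b, c, d} : Finset V).card = 4 := by
    rw [Finset.card_insert_of_notMem, Finset.card_insert_of_notMem,
      Finset.card_insert_of_notMem, Finset.card_singleton]
    · simpa using hcd
    · simp [hbc, hbd]
    · simp [hab, hac, had]
  omega

variable [Fintype V]

/-- A shortest path between the leaves meets each component in exactly three vertices. -/
lemma Net.path_three (h : Net G x y) {P : G.Walk x y} (hP : P.length = G.dist x y) {c : V}
    (hcx : c ≠ x) (hcy : c ≠ y) : (cmp G c ∩ {z | z ∈ P.support}).ncard = 3 := by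
  classical
  obtain ⟨p, q, r, t, hne, ho, hxp, hyr, hyp, hxr⟩ := h.exists_outs hcx hcy
  obtain ⟨-, h4, -⟩ := h.sizes hcx hcy
  have hd := h.cmp_deg hcx hcy
  have hpq : (p, q) ∈ outs_s19 G (cmp G c) := by simp [ho]
  have hrt : (r, t) ∈ outs_s19 G (cmp G c) := by simp [ho]
  have hin : ∀ v ∈ cmp G c, v ≠ p → v ≠ r → G.neighborSet v = cmp G c \ {v} := by
    intro v hv hvp hvr
    apply Set.eq_of_subset_of_ncard_le
    · intro w hw
      refine ⟨?_, fun hwv => ?_⟩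
      · by_contra hwC
        have : (v, w) ∈ outs_s19 G (cmp G c) := ⟨hv, hwC, hw⟩
        rw [ho] at this
        simp only [Set.mem_insert_iff, Set.mem_singleton_iff, Prod.mk.injEq] at this
        rcases this with h | h
        · exact hvp h.1
        · exact hvr h.1
      · rw [Set.mem_singleton_iff] at hwv
        rw [hwv] at hw
        exact SimpleGraph.irrefl G hw
    · rw [Set.ncard_sdiff_singleton_of_mem hv, h4, (hd v hv).2.2]
    · exact Set.toFinite _
  have hadj : ∀ v ∈ cmp G c, v ≠ p → v ≠ r → ∀ w ∈ cmp G c, w ≠ v → G.Adj v w := by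
    intro v hv hvp hvr w hw hwv
    have : w ∈ G.neighborSet v := by
      rw [hin v hv hvp hvr]
      exact ⟨hw, hwv⟩
    exact this
  have hpr : p ≠ r := by
    rintro rfl
    have h3 : (cmp G c \ {p}).ncard = 3 := by
      rw [Set.ncard_sdiff_singleton_of_mem hpq.1, h4]
    obtain ⟨m, n, k, hmn, hmk, hnk, hS⟩ := Set.ncard_eq_three.1 h3
    have hmS : m ∈ cmp G c \ {p} := by simp [hS]
    have hnS : n ∈ cmp G c \ {p} := by simp [hS]
    have hkS : k ∈ cmp G c \ {p} := by simp [hS]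
    have hq : ∀ w ∈ cmp G c \ {p}, w ≠ q := by
      rintro w hw rfl
      exact hpq.2.1 hw.1
    exact four_nbrs (hd p hpq.1).2.2
      (hadj m hmS.1 hmS.2 hmS.2 p hpq.1 (Ne.symm hmS.2)).symm
      (hadj n hnS.1 hnS.2 hnS.2 p hpq.1 (Ne.symm hnS.2)).symm
      (hadj k hkS.1 hkS.2 hkS.2 p hpq.1 (Ne.symm hkS.2)).symm
      hpq.2.2 hmn hmk (hq m hmS) hnk (hq n hnS) (hq k hkS)
  have h2 : (cmp G c \ {p, r}).ncard = 2 := by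
    have hsub : ({p, r} : Set V) ⊆ cmp G c := by
      rintro z (rfl | rfl)
      · exact hpq.1
      · exact hrt.1
    rw [Set.ncard_sdiff hsub (Set.toFinite _), h4, Set.ncard_pair hpr]
  obtain ⟨m, n, hmn, hS⟩ := Set.ncard_eq_two.1 h2
  have hmS : m ∈ cmp G c \ {p, r} := by simp [hS]
  have hnS : n ∈ cmp G c \ {p, r} := by simp [hS]
  obtain ⟨hmC, hm⟩ := hmS
  obtain ⟨hnC, hn⟩ := hnS
  simp only [Set.mem_insert_iff, Set.mem_singleton_iff, not_or] at hm hn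
  have hC : ∀ z ∈ cmp G c, z = p ∨ z = r ∨ z = m ∨ z = n := by
    intro z hz
    by_cases h1 : z = p
    · exact Or.inl h1
    by_cases h2 : z = r
    · exact Or.inr (Or.inl h2)
    have : z ∈ cmp G c \ {p, r} := ⟨hz, by simp [h1, h2]⟩
    rw [hS] at this
    exact Or.inr (Or.inr this)
  have hpm : G.Adj p m := (hadj m hmC hm.1 hm.2 p hpq.1 (Ne.symm hm.1)).symm
  have hpn : G.Adj p n := (hadj n hnC hn.1 hn.2 p hpq.1 (Ne.symm hn.1)).symm
  have hmn' : G.Adj m n := hadj m hmC hm.1 hm.2 n hnC hmn.symm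
  have hqC : ∀ w ∈ cmp G c, w ≠ q := by
    rintro w hw rfl
    exact hpq.2.1 hw
  have hpr' : ¬ G.Adj p r := fun h' => four_nbrs (hd p hpq.1).2.2 hpm hpn h' hpq.2.2
    hmn hm.2 (hqC m hmC) hn.2 (hqC n hnC) (hqC r hrt.1)
  have hpP : p ∈ P.support := by
    obtain ⟨d, hd1, hd2, hd3⟩ := P.exists_boundary_dart (sd G p q) hxp hyp
    have := sd_boundary hd2 hd3 d.adj (outs_bridge hpq)
    rw [← this.2]
    exact P.dart_snd_mem_support_of_mem_darts hd1
  have hrP : r ∈ P.support := by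
    obtain ⟨d, hd1, hd2, hd3⟩ := P.exists_boundary_dart (sd G r t)ᶜ hxr (by simpa using hyr)
    have := sd_boundary (by simpa using hd3) hd2 d.adj.symm (outs_bridge hrt)
    rw [← this.2]
    exact P.dart_fst_mem_support_of_mem_darts hd1
  have hmnP : m ∈ P.support ∨ n ∈ P.support := by
    have hy : y ∉ sd G p q ∪ {p} := by
      rintro (h' | h')
      · exact hyp h'
      · exact (hd p hpq.1).2.1 h'.symm
    obtain ⟨d, hd1, hd2, hd3⟩ := P.exists_boundary_dart (sd G p q ∪ {p}) (Or.inl hxp) hy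
    have hb := P.dart_snd_mem_support_of_mem_darts hd1
    have hda := d.adj
    rcases hd2 with hd2 | hd2
    · exfalso
      have := sd_boundary hd2 (fun h' => hd3 (Or.inl h')) hda (outs_bridge hpq)
      exact hd3 (Or.inr this.2)
    · rw [Set.mem_singleton_iff] at hd2
      rw [hd2] at hda
      have hbC : d.snd ∈ cmp G c := by
        by_contra hbC
        have : (p, d.snd) ∈ outs_s19 G (cmp G c) := ⟨hpq.1, hbC, hda⟩
        rw [ho] at this
        simp only [Set.mem_insert_iff, Set.mem_singleton_iff, Prod.mk.injEq] at this
        rcases this with h' | h'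
        · apply hd3
          left
          rw [h'.2]
          exact SimpleGraph.Reachable.refl q
        · exact hpr h'.1
      rcases hC _ hbC with h' | h' | h' | h'
      · exact absurd h' hda.ne'
      · rw [h'] at hda
        exact absurd hda hpr'
      · left; rwa [← h']
      · right; rwa [← h']
  rw [Set.ncard_eq_three]
  by_cases hmP : m ∈ P.support
  · have hnP : n ∉ P.support := fun hnP => no_triangle P hP hpP hmP hnP hpm hpn hmn'
    refine ⟨p, r, m, hpr, Ne.symm hm.1, Ne.symm hm.2, ?_⟩
    ext z
    constructor
    · rintro ⟨hz, hzP⟩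
      rcases hC z hz with rfl | rfl | rfl | rfl
      · simp
      · simp
      · simp
      · exact absurd hzP hnP
    · rintro (rfl | rfl | rfl)
      · exact ⟨hpq.1, hpP⟩
      · exact ⟨hrt.1, hrP⟩
      · exact ⟨hmC, hmP⟩
  · have hnP : n ∈ P.support := hmnP.resolve_left hmP
    refine ⟨p, r, n, hpr, Ne.symm hn.1, Ne.symm hn.2, ?_⟩
    ext z
    constructor
    · rintro ⟨hz, hzP⟩
      rcases hC z hz with rfl | rfl | rfl | rfl
      · simp
      · simp
      · exact absurd hzP hmP
      · simp
    · rintro (rfl | rfl | rfl)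
      · exact ⟨hpq.1, hpP⟩
      · exact ⟨hrt.1, hrP⟩
      · exact ⟨hnC, hnP⟩

end Dist

/-- Claim (from Lemma `|X| = 2`): a level-2 network on exactly two leaves `x` and `y`
consists only of level-2 blobs, each incident to exactly two cut-edges, and
`d_m(x,y) = 3k + 1` where `k` is the number of blobs. -/
theorem level2_two_leaves_structure
    (X : Type) [Fintype X] [DecidableEq X] (hX : Fintype.card X = 2)
    (x y : X) (hxy : x ≠ y)
    (N : LabGraph X) (hN : N.IsNetwork) (hlev : N.IsLevel 2) :
    (∀ H : N.G.Subgraph, N.IsBlob H →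
      (N.BlobRank H 2 ∧
        ∃ e₁ e₂ : Sym2 N.V, e₁ ≠ e₂ ∧
          N.IsCutEdge e₁ ∧ N.EdgeIncBlob e₁ H ∧
          N.IsCutEdge e₂ ∧ N.EdgeIncBlob e₂ H ∧
          ∀ e : Sym2 N.V, N.IsCutEdge e → N.EdgeIncBlob e H → e = e₁ ∨ e = e₂)) ∧
    N.dm x y = 3 * {H : N.G.Subgraph | N.IsBlob H}.ncard + 1 := by
  obtain ⟨hconn, hinj, ⟨h1, -⟩ | ⟨hd1, hd3⟩⟩ := hN
  · omega
  have hleaf : ∀ z : X, z = x ∨ z = y := by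
    intro z
    by_contra hno
    push Not at hno
    have h1 : ({z, x, y} : Finset X).card = 3 := by
      rw [Finset.card_eq_three]
      exact ⟨z, x, y, hno.1, hno.2, hxy, rfl⟩
    have h2 := Finset.card_le_univ ({z, x, y} : Finset X)
    omega
  have hd3' : ∀ v, v ≠ N.leaf x → v ≠ N.leaf y → (N.G.neighborSet v).ncard = 3 := by
    intro v hvx hvy
    apply hd3
    rintro ⟨z, rfl⟩
    rcases hleaf z with rfl | rfl
    · exact hvx rfl
    · exact hvy rfl
  have hle3 : ∀ v, (N.G.neighborSet v).ncard ≤ 3 := by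
    intro v
    by_cases hvx : v = N.leaf x
    · have : (N.G.neighborSet (N.leaf x)).ncard = 1 := hd1 x
      rw [hvx]; omega
    · by_cases hvy : v = N.leaf y
      · have : (N.G.neighborSet (N.leaf y)).ncard = 1 := hd1 y
        rw [hvy]; omega
      · exact (hd3' v hvx hvy).le
  have net : Net N.G (N.leaf x) (N.leaf y) :=
    { conn := hconn
      ne := fun h => hxy (hinj h)
      hx := hd1 x
      hy := hd1 y
      h3 := hd3'
      lev := fun c hc => hlev _ (blob_cmp N hle3 hc) }
  have blob_pt : ∀ H : N.G.Subgraph, N.IsBlob H → ∀ c ∈ H.verts,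
      c ≠ N.leaf x ∧ c ≠ N.leaf y ∧ H = (⊤ : N.G.Subgraph).induce (cmp N.G c) := by
    intro H hH c hc
    have hne := cmp_ne_of_twoConn N hH.1 hc
    refine ⟨?_, ?_, blob_eq N hle3 hH hc⟩
    · rintro rfl
      exact hne (leaf_cmp (hd1 x))
    · rintro rfl
      exact hne (leaf_cmp (hd1 y))
  have blob_ne : ∀ H : N.G.Subgraph, N.IsBlob H → H.verts.Nonempty := by
    intro H hH
    apply Set.nonempty_of_ncard_ne_zero
    have := hH.1.1
    omega
  constructor
  · intro H hH
    obtain ⟨c, hc⟩ := blob_ne H hH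
    obtain ⟨hcx, hcy, rfl⟩ := blob_pt H hH c hc
    obtain ⟨-, h4, h5⟩ := net.sizes hcx hcy
    refine ⟨?_, ?_⟩
    · change _ + 1 = (cmp N.G c).ncard + 2
      rw [h4, h5]
    · obtain ⟨p, q, r, t, hne, ho, -⟩ := net.exists_outs hcx hcy
      have hpq : (p, q) ∈ outs_s19 N.G (cmp N.G c) := by simp [ho]
      have hrt : (r, t) ∈ outs_s19 N.G (cmp N.G c) := by simp [ho]
      have cut : ∀ a b, (a, b) ∈ outs_s19 N.G (cmp N.G c) → N.IsCutEdge s(a, b) := by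
        intro a b hab
        refine ⟨hab.2.2, fun hcon => ?_⟩
        exact (SimpleGraph.isBridge_iff.1 (outs_bridge hab)) (hcon.preconnected a b)
      refine ⟨s(p, q), s(r, t), ?_, cut _ _ hpq, ⟨p, hpq.1, by simp⟩, cut _ _ hrt,
        ⟨r, hrt.1, by simp⟩, ?_⟩
      · intro he
        rw [Sym2.eq_iff] at he
        rcases he with ⟨rfl, rfl⟩ | ⟨rfl, rfl⟩
        · exact hne rfl
        · exact hpq.2.1 hrt.1
      · rintro e ⟨he, hcut⟩ ⟨v, hv, hve⟩
        have hv : v ∈ cmp N.G c := hv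
        obtain ⟨w, rfl⟩ := hve
        have hadj : N.G.Adj v w := he
        have hbr : N.G.IsBridge s(v, w) := by
          by_contra hb
          exact hcut (hconn.connected_delete_edge_of_not_isBridge hb)
        have hvw : (v, w) ∈ outs_s19 N.G (cmp N.G c) := by
          refine ⟨hv, fun hw => ?_, hadj⟩
          have hr : (NB N.G).Reachable v w :=
            SimpleGraph.Reachable.trans (SimpleGraph.Reachable.symm hv) hw
          exact (nb_adj.1 (nb_adj_of_reach hadj hr)).2 hbr
        rw [ho] at hvw
        simp only [Set.mem_insert_iff, Set.mem_singleton_iff, Prod.mk.injEq] at hvw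
        rcases hvw with ⟨rfl, rfl⟩ | ⟨rfl, rfl⟩
        · left; rfl
        · right; rfl
  · classical
    obtain ⟨P, hP, hlen⟩ := hconn.exists_path_of_dist (N.leaf x) (N.leaf y)
    change N.G.dist (N.leaf x) (N.leaf y) = _
    rw [← hlen]
    have hfin : {H : N.G.Subgraph | N.IsBlob H}.Finite := Set.toFinite _
    rw [Set.ncard_eq_toFinset_card _ hfin]
    have hcard : P.support.toFinset.card = P.length + 1 := by
      rw [List.toFinset_card_of_nodup hP.support_nodup, SimpleGraph.Walk.length_support]
    have hunion : P.support.toFinset = {N.leaf x, N.leaf y} ∪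
        hfin.toFinset.biUnion (fun H => P.support.toFinset.filter (fun z => z ∈ H.verts)) := by
      ext z
      simp only [Finset.mem_union, Finset.mem_insert, Finset.mem_singleton, Finset.mem_biUnion,
        Finset.mem_filter, Set.Finite.mem_toFinset, Set.mem_ofPred_eq, List.mem_toFinset]
      constructor
      · intro hz
        by_cases hzx : z = N.leaf x
        · exact Or.inl (Or.inl hzx)
        by_cases hzy : z = N.leaf y
        · exact Or.inl (Or.inr hzy)
        right
        exact ⟨_, blob_cmp N hle3 (net.sizes hzx hzy).1, hz, mem_cmp_self z⟩
      · rintro ((rfl | rfl) | ⟨H, -, hz, -⟩)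
        · exact P.start_mem_support
        · exact P.end_mem_support
        · exact hz
    rw [hunion, Finset.card_union_of_disjoint, Finset.card_biUnion, Finset.card_pair net.ne,
      Finset.sum_congr rfl (g := fun _ => 3), Finset.sum_const, smul_eq_mul] at hcard
    · omega
    · intro H hH
      rw [Set.Finite.mem_toFinset] at hH
      obtain ⟨c, hc⟩ := blob_ne H hH
      obtain ⟨hcx, hcy, rfl⟩ := blob_pt H hH c hc
      rw [← net.path_three hlen hcx hcy, ← Set.ncard_coe_finset]
      congr 1
      ext z
      simp [and_comm]
    · intro H₁ h₁ H₂ h₂ hne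
      rw [Function.onFun, Finset.disjoint_left]
      intro z hz1 hz2
      rw [Finset.mem_filter] at hz1 hz2
      rw [Finset.mem_coe, Set.Finite.mem_toFinset] at h₁ h₂
      exact hne ((blob_pt H₁ h₁ z hz1.2).2.2.trans (blob_pt H₂ h₂ z hz2.2).2.2.symm)
    · rw [Finset.disjoint_left]
      intro z hz1 hz2
      rw [Finset.mem_biUnion] at hz2
      obtain ⟨H, hH, hz2⟩ := hz2
      rw [Finset.mem_filter] at hz2
      rw [Set.Finite.mem_toFinset] at hH
      have := blob_pt H hH z hz2.2
      simp only [Finset.mem_insert, Finset.mem_singleton] at hz1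
      rcases hz1 with h | h
      · exact this.1 h
      · exact this.2.1 h

end LabGraph
end
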